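/- arXiv:2106.14759 — 3 statements merged into one kernel-verified Lean document; each statement's English description precedes it below -/
import Mathlib

section
/- Let a = (a_1,…,a_r) and b = (b_1,…,b_r) be degree sequences with a_i ≤ b_i for all i = 1,…,r. If a homogeneous ideal I ⊆ A = K[x_1,…,x_n] satisfies EGH_a, then it satisfies EGH_b. -/
open MvPolynomial

section Defs

variable {K : Type*} [Field K]

/-- Total degree of an exponent vector. -/
def expDeg {n : ℕ} (m : Fin n →₀ ℕ) : ℕ := ∑ i, m i

/-- `lexLe m m'` means `m ≤ m'` in the lexicographic order with `x_1 > x_2 > … > x_n`. -/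
def lexLe {n : ℕ} (m m' : Fin n →₀ ℕ) : Prop :=
  m = m' ∨ ∃ i : Fin n, (∀ j : Fin n, j < i → m j = m' j) ∧ m i < m' i

/-- A lex-segment in degree `d`: an upward (w.r.t. lex) closed set of degree-`d`
exponent vectors. -/
def IsLexSegment (n d : ℕ) (S : Set (Fin n →₀ ℕ)) : Prop :=
  (∀ m ∈ S, expDeg m = d) ∧
    ∀ m ∈ S, ∀ m' : Fin n →₀ ℕ, expDeg m' = d → lexLe m m' → m' ∈ S

/-- The pure-powers ideal `(x_1^{a_1}, …, x_r^{a_r})`. -/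
noncomputable def purePowers (K : Type*) [Field K] {n r : ℕ} (hrn : r ≤ n)
    (a : Fin r → ℕ) : Ideal (MvPolynomial (Fin n) K) :=
  Ideal.span (Set.range fun i : Fin r => X (Fin.castLE hrn i) ^ a i)

/-- A homogeneous ideal. -/
def IsHomog {n : ℕ} (I : Ideal (MvPolynomial (Fin n) K)) : Prop :=
  ∀ f ∈ I, ∀ d : ℕ, homogeneousComponent d f ∈ I

/-- The degree-`d` component of an ideal, as a `K`-subspace. -/
noncomputable def component {n : ℕ} (I : Ideal (MvPolynomial (Fin n) K)) (d : ℕ) :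
    Submodule K (MvPolynomial (Fin n) K) :=
  Submodule.restrictScalars K I ⊓ homogeneousSubmodule (Fin n) K d

/-- Hilbert function of an ideal: `dim_K I_d`. -/
noncomputable def hilb {n : ℕ} (I : Ideal (MvPolynomial (Fin n) K)) (d : ℕ) : ℕ :=
  Module.finrank K ↥(component I d)

/-- An `a`-lpp (lex-plus-powers) ideal: a homogeneous (monomial) ideal each of whose graded
components is the span of a lex-segment plus the corresponding component of the
pure-powers ideal. -/
def IsLPP {n r : ℕ} (hrn : r ≤ n) (a : Fin r → ℕ)
    (J : Ideal (MvPolynomial (Fin n) K)) : Prop :=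
  IsHomog J ∧
    ∀ d : ℕ, ∃ S : Set (Fin n →₀ ℕ), IsLexSegment n d S ∧
      component J d =
        Submodule.span K ((fun m => (monomial m (1 : K) : MvPolynomial (Fin n) K)) '' S)
          ⊔ component (purePowers K hrn a) d

/-- `I` satisfies `EGH_a(d)`. -/
def EGHd {n r : ℕ} (hrn : r ≤ n) (a : Fin r → ℕ)
    (I : Ideal (MvPolynomial (Fin n) K)) (d : ℕ) : Prop :=
  ∃ J : Ideal (MvPolynomial (Fin n) K), IsLPP hrn a J ∧
    hilb J d = hilb I d ∧ hilb J (d + 1) ≤ hilb I (d + 1)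

/-- `I` satisfies `EGH_a`. -/
def EGH {n r : ℕ} (hrn : r ≤ n) (a : Fin r → ℕ)
    (I : Ideal (MvPolynomial (Fin n) K)) : Prop :=
  ∀ d : ℕ, EGHd hrn a I d

/-- A monomial ideal. -/
def IsMonomialIdeal {n : ℕ} (I : Ideal (MvPolynomial (Fin n) K)) : Prop :=
  ∃ M : Set (Fin n →₀ ℕ),
    I = Ideal.span ((fun m => (monomial m (1 : K) : MvPolynomial (Fin n) K)) '' M)

/-- A strongly stable (monomial) ideal. -/
def IsStronglyStable {n : ℕ} (S : Ideal (MvPolynomial (Fin n) K)) : Prop :=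
  IsMonomialIdeal S ∧
    ∀ (m : Fin n →₀ ℕ) (i j : Fin n), j ≤ i →
      (monomial (m + Finsupp.single i 1) (1 : K) : MvPolynomial (Fin n) K) ∈ S →
      (monomial (m + Finsupp.single j 1) (1 : K) : MvPolynomial (Fin n) K) ∈ S

/-- An `a`-spp (strongly-stable-plus-powers) ideal. -/
def IsSPP {n r : ℕ} (hrn : r ≤ n) (a : Fin r → ℕ)
    (J : Ideal (MvPolynomial (Fin n) K)) : Prop :=
  ∃ S : Ideal (MvPolynomial (Fin n) K), IsStronglyStable S ∧ J = S ⊔ purePowers K hrn a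

/-- A regular sequence: each `f i` is a non-zerodivisor modulo `(f j : j < i)`. -/
def IsRegSeq {n r : ℕ} (f : Fin r → MvPolynomial (Fin n) K) : Prop :=
  ∀ i : Fin r, ∀ g : MvPolynomial (Fin n) K,
    g * f i ∈ Ideal.span { p | ∃ j : Fin r, j < i ∧ p = f j } →
    g ∈ Ideal.span { p | ∃ j : Fin r, j < i ∧ p = f j }

/-- `I` contains a homogeneous regular sequence of degree `a`. -/
def ContainsRegSeq {n r : ℕ} (a : Fin r → ℕ)
    (I : Ideal (MvPolynomial (Fin n) K)) : Prop :=
  ∃ f : Fin r → MvPolynomial (Fin n) K,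
    (∀ i, f i ∈ I) ∧ IsRegSeq f ∧ ∀ i, (f i).IsHomogeneous (a i)

/-- `dim_K (N/P)` for ideals `P ≤ N` (the `K`-dimension of `N/(N ∩ P)`). -/
noncomputable def quotDim (K : Type*) [Field K] {n : ℕ}
    (N P : Ideal (MvPolynomial (Fin n) K)) : ℕ :=
  Module.finrank K
    (↥(Submodule.restrictScalars K N) ⧸
      Submodule.comap (Submodule.restrictScalars K N).subtype (Submodule.restrictScalars K P))

/-- `dim_K (I/F)_d`. -/
noncomputable def relHilb {n : ℕ} (I F : Ideal (MvPolynomial (Fin n) K)) (d : ℕ) : ℕ :=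
  Module.finrank K
    (↥(component I d) ⧸ Submodule.comap (component I d).subtype (Submodule.restrictScalars K F))

/-- `dim_K (A/I)_d`. -/
noncomputable def hilbQ {n : ℕ} (I : Ideal (MvPolynomial (Fin n) K)) (d : ℕ) : ℕ :=
  Module.finrank K
    (↥(homogeneousSubmodule (Fin n) K d) ⧸
      Submodule.comap (homogeneousSubmodule (Fin n) K d).subtype (Submodule.restrictScalars K I))

end Defs

section ClementsLindstrom

open Finset
open scoped Classical

variable {n : ℕ}

/-- The strict lexicographic order on exponent vectors. -/
def lexLt (x y : Fin n →₀ ℕ) : Prop := ∃ i, (∀ j, j < i → x j = y j) ∧ x i < y i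

theorem lexLt_iff {x y : Fin n →₀ ℕ} : lexLt x y ↔ toLex x < toLex y :=
  Finsupp.Lex.lt_iff.symm

theorem lexLt_trans {x y z : Fin n →₀ ℕ} (h : lexLt x y) (h' : lexLt y z) : lexLt x z := by
  rw [lexLt_iff] at *; exact h.trans h'

theorem lexLt_irrefl (x : Fin n →₀ ℕ) : ¬ lexLt x x := by
  rw [lexLt_iff]; exact lt_irrefl _

theorem lexLt_trichotomy (x y : Fin n →₀ ℕ) : lexLt x y ∨ x = y ∨ lexLt y x := by
  rw [lexLt_iff, lexLt_iff]
  rcases lt_trichotomy (toLex x) (toLex y) with h | h | h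
  · exact Or.inl h
  · exact Or.inr (Or.inl (toLex.injective h))
  · exact Or.inr (Or.inr h)

theorem lexLe_trans {x y z : Fin n →₀ ℕ} (h : lexLe x y) (h' : lexLe y z) : lexLe x z := by
  rcases h with rfl | h
  · exact h'
  · rcases h' with rfl | h'
    · exact Or.inr h
    · exact Or.inr (lexLt_trans h h')

theorem exists_lexLe_min {T : Finset (Fin n →₀ ℕ)} (hT : T.Nonempty) :
    ∃ x ∈ T, ∀ y ∈ T, lexLe x y := by
  obtain ⟨x, hx, h⟩ := Finset.exists_min_image T toLex hT
  refine ⟨x, hx, fun y hy => ?_⟩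
  rcases lexLt_trichotomy x y with h1 | h1 | h1
  · exact Or.inr h1
  · exact Or.inl h1
  · exact absurd (h y hy) (not_le_of_gt (lexLt_iff.1 h1))

theorem lexLt_of_le_of_lt {x y : Fin n →₀ ℕ} (s : Fin n) (h : ∀ i, i < s → x i ≤ y i)
    (hs : x s < y s) : lexLt x y := by
  rcases lexLt_trichotomy x y with h1 | h1 | ⟨i, hi, hlt⟩
  · exact h1
  · subst h1; exact absurd hs (lt_irrefl _)
  · exfalso
    rcases lt_trichotomy i s with h2 | h2 | h2
    · have := h i h2; omega
    · subst h2; omega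
    · have := hi s h2; omega

theorem lexLe_of_le_of_ge {x y : Fin n →₀ ℕ} (s : Fin n) (h : ∀ i, i ≤ s → x i ≤ y i)
    (hgt : ∀ i, s < i → y i ≤ x i) (hdeg : expDeg x = expDeg y) : lexLe x y := by
  by_cases hall : ∀ i, i ≤ s → x i = y i
  · left
    have hle : ∀ i ∈ (univ : Finset (Fin n)), y i ≤ x i := by
      intro i _
      rcases le_or_gt i s with h1 | h1
      · exact (hall i h1).ge
      · exact hgt i h1
    have := (Finset.sum_eq_sum_iff_of_le hle).1 hdeg.symm
    ext i
    exact (this i (mem_univ i)).symm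
  · right
    push Not at hall
    obtain ⟨i, hi, hne⟩ := hall
    exact lexLt_of_le_of_lt i (fun j hj => h j (hj.le.trans hi)) (lt_of_le_of_ne (h i hi) hne)

theorem expDeg_add (x y : Fin n →₀ ℕ) : expDeg (x + y) = expDeg x + expDeg y := by
  simp [expDeg, Finset.sum_add_distrib]

theorem expDeg_single (i : Fin n) (k : ℕ) : expDeg (Finsupp.single i k) = k := by
  simp [expDeg, Finsupp.single_apply]

theorem expDeg_add_single (x : Fin n →₀ ℕ) (i : Fin n) :
    expDeg (x + Finsupp.single i 1) = expDeg x + 1 := by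
  rw [expDeg_add, expDeg_single]

theorem lexLt_add_right {x y : Fin n →₀ ℕ} (z : Fin n →₀ ℕ) :
    lexLt (x + z) (y + z) ↔ lexLt x y := by
  simp [lexLt]

theorem sub_add_single {x : Fin n →₀ ℕ} {i : Fin n} (h : 0 < x i) :
    x - Finsupp.single i 1 + Finsupp.single i 1 = x :=
  tsub_add_cancel_of_le (Finsupp.single_le_iff.2 h)

/-- `x` and `y` have the same degree and agree outside `S`. -/
def SameFiber (S : Finset (Fin n)) (x y : Fin n →₀ ℕ) : Prop :=
  (∀ i, i ∉ S → x i = y i) ∧ expDeg x = expDeg y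

theorem SameFiber.refl (S : Finset (Fin n)) (x : Fin n →₀ ℕ) : SameFiber S x x :=
  ⟨fun _ _ => rfl, rfl⟩

theorem SameFiber.symm {S : Finset (Fin n)} {x y : Fin n →₀ ℕ} (h : SameFiber S x y) :
    SameFiber S y x := ⟨fun i hi => (h.1 i hi).symm, h.2.symm⟩

theorem SameFiber.trans {S : Finset (Fin n)} {x y z : Fin n →₀ ℕ} (h : SameFiber S x y)
    (h' : SameFiber S y z) : SameFiber S x z :=
  ⟨fun i hi => (h.1 i hi).trans (h'.1 i hi), h.2.trans h'.2⟩

theorem SameFiber.mono {S U : Finset (Fin n)} (hSU : S ⊆ U) {x y : Fin n →₀ ℕ}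
    (h : SameFiber S x y) : SameFiber U x y := ⟨fun i hi => h.1 i fun h' => hi (hSU h'), h.2⟩

theorem SameFiber.add_single {S : Finset (Fin n)} {x y : Fin n →₀ ℕ} (h : SameFiber S x y)
    (k : Fin n) : SameFiber S (x + Finsupp.single k 1) (y + Finsupp.single k 1) :=
  ⟨fun i hi => by simp [h.1 i hi], by rw [expDeg_add_single, expDeg_add_single, h.2]⟩

theorem SameFiber.add_single_add_single {S : Finset (Fin n)} {x y : Fin n →₀ ℕ}
    (h : SameFiber S x y) {k l : Fin n} (hk : k ∈ S) (hl : l ∈ S) :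
    SameFiber S (x + Finsupp.single k 1) (y + Finsupp.single l 1) := by
  refine ⟨fun i hi => ?_, by rw [expDeg_add_single, expDeg_add_single, h.2]⟩
  have h1 : k ≠ i := by rintro rfl; exact hi hk
  have h2 : l ≠ i := by rintro rfl; exact hi hl
  simp [h.1 i hi, h1, h2]

theorem SameFiber.of_add_single {S : Finset (Fin n)} {x y : Fin n →₀ ℕ} {k l : Fin n}
    (hk : k ∈ S) (hl : l ∈ S)
    (h : SameFiber S (x + Finsupp.single k 1) (y + Finsupp.single l 1)) : SameFiber S x y := by
  refine ⟨fun i hi => ?_, by have := h.2; rw [expDeg_add_single, expDeg_add_single] at this; omega⟩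
  have h1 : k ≠ i := by rintro rfl; exact hi hk
  have h2 : l ≠ i := by rintro rfl; exact hi hl
  simpa [Finsupp.single_apply, h1, h2] using h.1 i hi

theorem SameFiber.of_add_single_same {S : Finset (Fin n)} {x y : Fin n →₀ ℕ} {k : Fin n}
    (h : SameFiber S (x + Finsupp.single k 1) (y + Finsupp.single k 1)) : SameFiber S x y := by
  refine ⟨fun i hi => ?_, by have := h.2; rw [expDeg_add_single, expDeg_add_single] at this; omega⟩
  simpa using h.1 i hi

/-- The last coordinate of `S` at which `v` is nonzero can be lowered without dropping below `w`,
provided that `v` lies lexicographically above a multiple of `w` and does not exceed `w`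
outside `S`. -/
theorem exists_lexLe_of_add_single_lexLt {S : Finset (Fin n)} {w v : Fin n →₀ ℕ} {k : Fin n}
    (hv : ∀ i, i ∉ S → v i ≤ w i) (hdeg : expDeg (w + Finsupp.single k 1) = expDeg v)
    (hlt : lexLt (w + Finsupp.single k 1) v) :
    ∃ l ∈ S, ∃ u, v = u + Finsupp.single l 1 ∧ lexLe w u := by
  obtain ⟨s, hs, hslt⟩ := hlt
  have hwle : ∀ i, w i ≤ (w + Finsupp.single k 1 : Fin n →₀ ℕ) i := fun i => by simp
  have hsS : s ∈ S := by
    by_contra h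
    exact absurd ((hv s h).trans (hwle s)) (not_le_of_gt hslt)
  have hne : (S.filter fun i => 0 < v i).Nonempty := ⟨s, mem_filter.2 ⟨hsS, by omega⟩⟩
  obtain ⟨l, hlm, hlmax⟩ := Finset.exists_max_image _ id hne
  rw [mem_filter] at hlm
  have hsl : s ≤ l := hlmax s (mem_filter.2 ⟨hsS, by omega⟩)
  have hzero : ∀ i ∈ S, l < i → v i = 0 := by
    intro i hi hli
    by_contra h
    exact absurd (hlmax i (mem_filter.2 ⟨hi, Nat.pos_of_ne_zero h⟩)) (not_le_of_gt hli)
  obtain ⟨u, rfl⟩ : ∃ u, v = u + Finsupp.single l 1 := ⟨_, (sub_add_single hlm.2).symm⟩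
  refine ⟨l, hlm.1, u, rfl, ?_⟩
  rw [expDeg_add_single, expDeg_add_single, add_left_inj] at hdeg
  have hbefore : ∀ i, i < l →
      (u + Finsupp.single l 1 : Fin n →₀ ℕ) i = u i := fun i hi => by
    simp [hi.ne]
  rcases hsl.lt_or_eq with h | h
  · right
    refine lexLt_of_le_of_lt s (fun i hi => ?_) ?_
    · rw [← hbefore i (hi.trans h), ← hs i hi]; exact hwle i
    · rw [← hbefore s h]; exact (hwle s).trans_lt hslt
  · subst h
    refine lexLe_of_le_of_ge s (fun i hi => ?_) (fun i hi => ?_) hdeg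
    · rcases hi.lt_or_eq with h1 | rfl
      · rw [← hbefore i h1, ← hs i h1]; exact hwle i
      · have := hwle i
        simp only [Finsupp.add_apply, Finsupp.single_eq_same] at *
        omega
    · by_cases hiS : i ∈ S
      · have := hzero i hiS hi
        simp only [Finsupp.add_apply] at this
        omega
      · have := hv i hiS
        simp only [Finsupp.add_apply] at this
        omega

theorem SameFiber.le_of_add_single {S : Finset (Fin n)} {w v : Fin n →₀ ℕ} {k : Fin n}
    (hk : k ∈ S) (h : SameFiber S (w + Finsupp.single k 1) v) {i : Fin n} (hi : i ∉ S) :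
    v i ≤ w i := by
  have hki : k ≠ i := by rintro rfl; exact hi hk
  rw [← h.1 i hi]
  simp [hki]

/-- The exponent vectors that are coordinatewise strictly below `c`. -/
noncomputable def capBox (c : Fin n → ℕ) : Finset (Fin n →₀ ℕ) :=
  (Fintype.piFinset fun i => range (c i)).map Finsupp.equivFunOnFinite.symm.toEmbedding

theorem mem_capBox {c : Fin n → ℕ} {m : Fin n →₀ ℕ} : m ∈ capBox c ↔ ∀ i, m i < c i := by
  simp only [capBox, mem_map_equiv, Equiv.symm_symm, Fintype.mem_piFinset, mem_range]
  rfl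

theorem mem_capBox_of_add {c : Fin n → ℕ} {m m' : Fin n →₀ ℕ} (h : m + m' ∈ capBox c) :
    m ∈ capBox c :=
  mem_capBox.2 fun i => lt_of_le_of_lt (by simp) (mem_capBox.1 h i)

theorem add_single_mem_capBox {c : Fin n → ℕ} {m : Fin n →₀ ℕ} {k : Fin n} (h : m ∈ capBox c)
    (hk : m k + 1 < c k) : m + Finsupp.single k 1 ∈ capBox c := by
  refine mem_capBox.2 fun i => ?_
  rcases eq_or_ne k i with rfl | hne
  · simpa using hk
  · simpa [Finsupp.single_apply, hne] using mem_capBox.1 h i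

/-- The members of the box in the `S`-fiber of `m`. -/
noncomputable def fiber (c : Fin n → ℕ) (S : Finset (Fin n)) (m : Fin n →₀ ℕ) :
    Finset (Fin n →₀ ℕ) := (capBox c).filter (SameFiber S m)

theorem mem_fiber {c : Fin n → ℕ} {S : Finset (Fin n)} {m x : Fin n →₀ ℕ} :
    x ∈ fiber c S m ↔ x ∈ capBox c ∧ SameFiber S m x := mem_filter

theorem fiber_congr {c : Fin n → ℕ} {S : Finset (Fin n)} {m x : Fin n →₀ ℕ}
    (h : SameFiber S m x) : fiber c S m = fiber c S x := by
  ext y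
  simp only [mem_fiber]
  exact ⟨fun hy => ⟨hy.1, h.symm.trans hy.2⟩, fun hy => ⟨hy.1, h.trans hy.2⟩⟩

theorem fiber_eq_iff {c : Fin n → ℕ} {S : Finset (Fin n)} {m x : Fin n →₀ ℕ} (hx : x ∈ capBox c) :
    fiber c S x = fiber c S m ↔ x ∈ fiber c S m := by
  refine ⟨fun h => h ▸ mem_fiber.2 ⟨hx, .refl _ _⟩, fun h => (fiber_congr (mem_fiber.1 h).2).symm⟩

theorem card_le_of_card_inter_fiber_le {c : Fin n → ℕ} {S : Finset (Fin n)}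
    {X Y : Finset (Fin n →₀ ℕ)} (hX : X ⊆ capBox c) (hY : Y ⊆ capBox c)
    (h : ∀ m ∈ capBox c, #(X ∩ fiber c S m) ≤ #(Y ∩ fiber c S m)) : #X ≤ #Y := by
  have key : ∀ Z ⊆ capBox c, #Z = ∑ F ∈ (capBox c).image (fiber c S), #(Z ∩ F) := by
    intro Z hZ
    rw [card_eq_sum_card_fiberwise (f := fiber c S) (t := (capBox c).image (fiber c S))
      fun z hz => mem_image_of_mem _ (hZ hz)]
    refine sum_congr rfl fun F hF => ?_
    obtain ⟨m, -, rfl⟩ := mem_image.1 hF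
    congr 1
    ext z
    rw [mem_filter, mem_inter]
    exact and_congr_right fun hz => fiber_eq_iff (hZ hz)
  rw [key X hX, key Y hY]
  refine sum_le_sum fun F hF => ?_
  obtain ⟨m, hm, rfl⟩ := mem_image.1 hF
  exact h m hm

/-- `T` meets every `S`-fiber of the box in a lexicographic initial (upward closed) segment. -/
def IsFiberSegment (c : Fin n → ℕ) (S : Finset (Fin n)) (T : Finset (Fin n →₀ ℕ)) : Prop :=
  ∀ x ∈ T, ∀ y ∈ capBox c, SameFiber S x y → lexLt x y → y ∈ T

theorem IsFiberSegment.mem_of_lexLe {c : Fin n → ℕ} {S : Finset (Fin n)}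
    {T : Finset (Fin n →₀ ℕ)} (hT : IsFiberSegment c S T) {x y : Fin n →₀ ℕ} (hx : x ∈ T)
    (hy : y ∈ capBox c) (hxy : SameFiber S x y) (h : lexLe x y) : y ∈ T := by
  rcases h with rfl | h
  · exact hx
  · exact hT x hx y hy hxy h

theorem IsFiberSegment.mono {c : Fin n → ℕ} {S U : Finset (Fin n)} (hSU : S ⊆ U)
    {T : Finset (Fin n →₀ ℕ)} (hT : IsFiberSegment c U T) : IsFiberSegment c S T :=
  fun x hx y hy hxy h => hT x hx y hy (hxy.mono hSU) h

/-- Each `S`-fiber of `T` is replaced by the lexicographic segment of the same size. -/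
noncomputable def compress (c : Fin n → ℕ) (S : Finset (Fin n)) (T : Finset (Fin n →₀ ℕ)) :
    Finset (Fin n →₀ ℕ) :=
  (capBox c).filter fun m => #((fiber c S m).filter (lexLt m)) < #(T ∩ fiber c S m)

theorem compress_subset (c : Fin n → ℕ) (S : Finset (Fin n)) (T : Finset (Fin n →₀ ℕ)) :
    compress c S T ⊆ capBox c := filter_subset _ _

theorem card_filter_card_lexLt {F : Finset (Fin n →₀ ℕ)} {k : ℕ} (hk : k ≤ #F) :
    #(F.filter fun x => #(F.filter (lexLt x)) < k) = k := by
  set ρ : (Fin n →₀ ℕ) → ℕ := fun x => #(F.filter (lexLt x)) with hρ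
  have hlt : ∀ x ∈ F, ∀ y ∈ F, lexLt x y → ρ y < ρ x := by
    intro x _ y hy h
    refine card_lt_card ((ssubset_iff_of_subset ?_).2 ⟨y, mem_filter.2 ⟨hy, h⟩, ?_⟩)
    · intro z hz
      rw [mem_filter] at hz ⊢
      exact ⟨hz.1, lexLt_trans h hz.2⟩
    · intro h'
      exact lexLt_irrefl y (mem_filter.1 h').2
  have hinj : Set.InjOn ρ F := by
    intro x hx y hy h
    rcases lexLt_trichotomy x y with h1 | h1 | h1
    · have := hlt x hx y hy h1; omega
    · exact h1
    · have := hlt y hy x hx h1; omega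
  have himg : F.image ρ = range #F := by
    refine eq_of_subset_of_card_le ?_ ?_
    · intro j hj
      obtain ⟨x, hx, rfl⟩ := mem_image.1 hj
      refine mem_range.2 (card_lt_card ((ssubset_iff_of_subset (filter_subset _ _)).2 ⟨x, hx, ?_⟩))
      intro h'
      exact lexLt_irrefl x (mem_filter.1 h').2
    · rw [card_range, card_image_of_injOn hinj]
  rw [← card_image_of_injOn (hinj.mono (filter_subset _ _)), ← card_range k]
  congr 1
  ext j
  simp only [mem_image, mem_filter, mem_range]
  constructor
  · rintro ⟨x, ⟨_, h⟩, rfl⟩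
    simpa using h
  · intro hj
    have : j ∈ F.image ρ := by rw [himg, mem_range]; omega
    obtain ⟨x, hx, rfl⟩ := mem_image.1 this
    exact ⟨x, ⟨hx, by simpa using hj⟩, rfl⟩

theorem card_compress_inter_fiber (c : Fin n → ℕ) (S : Finset (Fin n))
    (T : Finset (Fin n →₀ ℕ)) (m : Fin n →₀ ℕ) :
    #(compress c S T ∩ fiber c S m) = #(T ∩ fiber c S m) := by
  rw [← card_filter_card_lexLt (card_le_card (inter_subset_right : T ∩ fiber c S m ⊆ fiber c S m))]
  congr 1
  ext x
  rw [mem_inter, mem_filter, compress, mem_filter, and_comm]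
  refine and_congr_right fun hx => ?_
  rw [← fiber_congr (mem_fiber.1 hx).2]
  exact and_iff_right (mem_fiber.1 hx).1

theorem card_compress {c : Fin n → ℕ} (S : Finset (Fin n)) {T : Finset (Fin n →₀ ℕ)}
    (hT : T ⊆ capBox c) : #(compress c S T) = #T :=
  le_antisymm
    (card_le_of_card_inter_fiber_le (S := S) (compress_subset _ _ _) hT
      fun m _ => (card_compress_inter_fiber c S T m).le)
    (card_le_of_card_inter_fiber_le (S := S) hT (compress_subset _ _ _)
      fun m _ => (card_compress_inter_fiber c S T m).ge)

theorem isFiberSegment_compress (c : Fin n → ℕ) (S : Finset (Fin n))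
    (T : Finset (Fin n →₀ ℕ)) : IsFiberSegment c S (compress c S T) := by
  intro x hx y hy hxy h
  refine mem_filter.2 ⟨hy, ?_⟩
  rw [← fiber_congr hxy]
  refine lt_of_le_of_lt (card_le_card ?_) (mem_filter.1 hx).2
  intro z hz
  rw [mem_filter] at hz ⊢
  exact ⟨hz.1, lexLt_trans h hz.2⟩

theorem exists_sameFiber_of_mem_compress {c : Fin n → ℕ} {S : Finset (Fin n)}
    {T : Finset (Fin n →₀ ℕ)} {x : Fin n →₀ ℕ} (hx : x ∈ compress c S T) :
    ∃ y ∈ T, SameFiber S y x := by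
  obtain ⟨y, hy⟩ := card_pos.1 ((Nat.zero_le _).trans_lt (mem_filter.1 hx).2)
  rw [mem_inter, mem_fiber] at hy
  exact ⟨y, hy.1, hy.2.2.symm⟩

theorem compress_subset_fiber {c : Fin n → ℕ} {S U : Finset (Fin n)} (hSU : S ⊆ U)
    {T : Finset (Fin n →₀ ℕ)} {m : Fin n →₀ ℕ} (hT : T ⊆ fiber c U m) :
    compress c S T ⊆ fiber c U m := by
  intro x hx
  obtain ⟨y, hy, hyx⟩ := exists_sameFiber_of_mem_compress hx
  exact mem_fiber.2 ⟨compress_subset _ _ _ hx, (mem_fiber.1 (hT hy)).2.trans (hyx.mono hSU)⟩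

/-- If compression moves something, then it moves something lying lexicographically below
everything it adds. -/
theorem exists_lexLt_of_not_isFiberSegment {c : Fin n → ℕ} {S : Finset (Fin n)}
    {T : Finset (Fin n →₀ ℕ)} (hT : T ⊆ capBox c) (hseg : ¬ IsFiberSegment c S T) :
    ∃ x ∈ T, x ∉ compress c S T ∧ ∀ y ∈ compress c S T, y ∉ T → lexLt x y := by
  have hne : (compress c S T \ T).Nonempty := by
    rw [sdiff_nonempty]
    intro h
    apply hseg
    rw [← eq_of_subset_of_card_le h (card_compress S hT).ge]
    exact isFiberSegment_compress c S T
  obtain ⟨z, hz, hzmin⟩ := exists_lexLe_min hne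
  rw [mem_sdiff] at hz
  have hzbox := compress_subset _ _ _ hz.1
  have hzf : z ∈ fiber c S z := mem_fiber.2 ⟨hzbox, .refl _ _⟩
  obtain ⟨x, hx, hxz⟩ : ∃ x ∈ T ∩ fiber c S z, x ∉ compress c S T ∩ fiber c S z := by
    by_contra! h
    exact hz.2 (mem_inter.1 (eq_of_subset_of_card_le h
      (card_compress_inter_fiber c S T z).le ▸ mem_inter.2 ⟨hz.1, hzf⟩)).1
  rw [mem_inter] at hx
  have hxC : x ∉ compress c S T := fun h => hxz (mem_inter.2 ⟨h, hx.2⟩)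
  refine ⟨x, hx.1, hxC, fun y hy hyT => ?_⟩
  have hxz' : lexLt x z := by
    rcases lexLt_trichotomy x z with h1 | h1 | h1
    · exact h1
    · subst h1; exact absurd hx.1 hz.2
    · exact absurd (isFiberSegment_compress c S T z hz.1 x (hT hx.1) (mem_fiber.1 hx.2).2 h1) hxC
  rcases hzmin y (mem_sdiff.2 ⟨hy, hyT⟩) with rfl | h
  · exact hxz'
  · exact lexLt_trans hxz' h

/-- The upper shadow of `T` in the directions of `S`, inside the box. -/
noncomputable def boxShadow (c : Fin n → ℕ) (S : Finset (Fin n)) (T : Finset (Fin n →₀ ℕ)) :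
    Finset (Fin n →₀ ℕ) :=
  (capBox c).filter fun m => ∃ k ∈ S, ∃ t ∈ T, m = t + Finsupp.single k 1

theorem mem_boxShadow {c : Fin n → ℕ} {S : Finset (Fin n)} {T : Finset (Fin n →₀ ℕ)}
    {m : Fin n →₀ ℕ} :
    m ∈ boxShadow c S T ↔ m ∈ capBox c ∧ ∃ k ∈ S, ∃ t ∈ T, m = t + Finsupp.single k 1 := mem_filter

theorem boxShadow_mono {c : Fin n → ℕ} {S U : Finset (Fin n)} (hSU : S ⊆ U)
    {T T' : Finset (Fin n →₀ ℕ)} (hT : T ⊆ T') : boxShadow c S T ⊆ boxShadow c U T' := by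
  intro m hm
  rw [mem_boxShadow] at hm ⊢
  obtain ⟨hb, k, hk, t, ht, rfl⟩ := hm
  exact ⟨hb, k, hSU hk, t, hT ht, rfl⟩

/-- Among the subsets of the box inside one `S`-fiber, lexicographic segments have the smallest
upper shadow in the directions of `S`. -/
def SegmentsMinimizeShadow (c : Fin n → ℕ) (S : Finset (Fin n)) : Prop :=
  ∀ (m : Fin n →₀ ℕ) (T T' : Finset (Fin n →₀ ℕ)), T ⊆ fiber c S m → T' ⊆ fiber c S m →
    IsFiberSegment c S T' → #T' ≤ #T → #(boxShadow c S T') ≤ #(boxShadow c S T)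

theorem card_boxShadow_compress_inter_fiber_le {c : Fin n → ℕ} {S U : Finset (Fin n)}
    (hS : SegmentsMinimizeShadow c S) (hSU : S ⊆ U) (T : Finset (Fin n →₀ ℕ)) (m : Fin n →₀ ℕ) :
    #(boxShadow c U (compress c S T) ∩ fiber c S m) ≤ #(boxShadow c U T ∩ fiber c S m) := by
  rcases (boxShadow c U (compress c S T) ∩ fiber c S m).eq_empty_or_nonempty with he | hne
  · simp [he]
  obtain ⟨x, hx, hmin⟩ := exists_lexLe_min hne
  rw [mem_inter, mem_boxShadow] at hx
  obtain ⟨⟨hxb, k, hkU, t, ht, rfl⟩, hxf⟩ := hx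
  have htb : t ∈ capBox c := mem_capBox_of_add hxb
  have hseg := isFiberSegment_compress c S T
  have hmx := (mem_fiber.1 hxf).2
  by_cases hk : k ∈ S
  · have h1 : boxShadow c U (compress c S T) ∩ fiber c S m ⊆
        boxShadow c S (compress c S T ∩ fiber c S t) := by
      intro y hy
      have hy' := mem_inter.1 hy
      have hyb := (mem_boxShadow.1 hy'.1).1
      have hxy := hmx.symm.trans (mem_fiber.1 hy'.2).2
      rcases hmin y hy with rfl | hlt
      · exact mem_boxShadow.2 ⟨hxb, k, hk, t,
          mem_inter.2 ⟨ht, mem_fiber.2 ⟨htb, .refl _ _⟩⟩, rfl⟩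
      · obtain ⟨l, hl, u, rfl, hu⟩ := exists_lexLe_of_add_single_lexLt
          (fun i hi => hxy.le_of_add_single hk hi) hxy.2 hlt
        have htu : SameFiber S t u := .of_add_single hk hl hxy
        have hub := mem_capBox_of_add hyb
        exact mem_boxShadow.2 ⟨hyb, l, hl, u, mem_inter.2
          ⟨hseg.mem_of_lexLe ht hub htu hu, mem_fiber.2 ⟨hub, htu⟩⟩, rfl⟩
    refine (card_le_card h1).trans ((hS t (T ∩ fiber c S t) _ inter_subset_right
      inter_subset_right ?_ (card_compress_inter_fiber c S T t).le).trans (card_le_card ?_))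
    · intro y hy z hz hyz h
      rw [mem_inter, mem_fiber] at hy ⊢
      exact ⟨hseg y hy.1 z hz hyz h, hz, hy.2.2.trans hyz⟩
    · intro y hy
      refine mem_inter.2 ⟨boxShadow_mono hSU inter_subset_left hy, ?_⟩
      obtain ⟨hyb, l, hl, u, hu, rfl⟩ := mem_boxShadow.1 hy
      exact mem_fiber.2 ⟨hyb, hmx.trans
        ((mem_fiber.1 (mem_inter.1 hu).2).2.add_single_add_single hk hl)⟩
  · have h1 : #(boxShadow c U (compress c S T) ∩ fiber c S m) ≤
        #(compress c S T ∩ fiber c S t) := by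
      refine card_le_card_of_injOn (fun y => y - Finsupp.single k 1) ?_ ?_
      · intro y hy
        have hy' := mem_inter.1 hy
        have hyb := (mem_boxShadow.1 hy'.1).1
        have hxy := hmx.symm.trans (mem_fiber.1 hy'.2).2
        have hpos : 0 < y k := by rw [← hxy.1 k hk]; simp
        obtain ⟨u, rfl⟩ : ∃ u, y = u + Finsupp.single k 1 := ⟨_, (sub_add_single hpos).symm⟩
        have hub := mem_capBox_of_add hyb
        have htu := hxy.of_add_single_same
        have hle : lexLe t u := by
          rcases hmin _ hy with h | h
          · exact Or.inl (add_right_cancel h)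
          · exact Or.inr ((lexLt_add_right _).1 h)
        simp only [add_tsub_cancel_right]
        exact mem_coe.2 (mem_inter.2
          ⟨hseg.mem_of_lexLe ht hub htu hle, mem_fiber.2 ⟨hub, htu⟩⟩)
      · intro y hy z hz h
        have hpos : ∀ y ∈ boxShadow c U (compress c S T) ∩ fiber c S m, 0 < y k := by
          intro y hy
          rw [← (hmx.symm.trans (mem_fiber.1 (mem_inter.1 hy).2).2).1 k hk]
          simp
        rw [← sub_add_single (hpos y hy), ← sub_add_single (hpos z hz)]
        simp only at h
        rw [h]
    refine h1.trans ((card_compress_inter_fiber c S T t).le.trans ?_)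
    refine card_le_card_of_injOn (fun y => y + Finsupp.single k 1) ?_
      (fun y _ z _ h => add_right_cancel h)
    intro y hy
    obtain ⟨hyT, hyf⟩ := mem_inter.1 hy
    obtain ⟨hyb, hty⟩ := mem_fiber.1 hyf
    have hb : y + Finsupp.single k 1 ∈ capBox c := by
      refine add_single_mem_capBox hyb ?_
      rw [← hty.1 k hk]
      simpa using mem_capBox.1 hxb k
    exact mem_coe.2 (mem_inter.2 ⟨mem_boxShadow.2 ⟨hb, k, hkU, y, hyT, rfl⟩,
      mem_fiber.2 ⟨hb, hmx.trans (hty.add_single k)⟩⟩)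

theorem card_boxShadow_compress_le {c : Fin n → ℕ} {S U : Finset (Fin n)}
    (hS : SegmentsMinimizeShadow c S) (hSU : S ⊆ U) (T : Finset (Fin n →₀ ℕ)) :
    #(boxShadow c U (compress c S T)) ≤ #(boxShadow c U T) :=
  card_le_of_card_inter_fiber_le (S := S) (filter_subset _ _) (filter_subset _ _)
    fun m _ => card_boxShadow_compress_inter_fiber_le hS hSU T m

/-- Replacing a factor `x_a` by some `x_l` with `l ∈ S` does not leave `T`,
unless it leaves the box. -/
def IsStable (c : Fin n → ℕ) (S : Finset (Fin n)) (a : Fin n) (T : Finset (Fin n →₀ ℕ)) : Prop :=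
  ∀ l ∈ S, ∀ u, u + Finsupp.single a 1 ∈ T → u + Finsupp.single l 1 ∈ capBox c →
    u + Finsupp.single l 1 ∈ T

theorem IsStable.of_isFiberSegment {c : Fin n → ℕ} {S : Finset (Fin n)} {a : Fin n}
    (ha : ∀ l ∈ S, l < a) {T : Finset (Fin n →₀ ℕ)}
    (hT : ∀ l ∈ S, IsFiberSegment c {l, a} T) : IsStable c S a T := by
  intro l hl u hu hb
  refine hT l hl _ hu _ hb ((SameFiber.refl _ u).add_single_add_single (by simp) (by simp)) ?_
  refine ⟨l, fun j hj => ?_, ?_⟩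
  · simp [hj.ne, (hj.trans (ha l hl)).ne]
  · simp [(ha l hl).ne]

theorem card_boxShadow_insert {c : Fin n → ℕ} {S : Finset (Fin n)} {a : Fin n} (haS : a ∉ S)
    {T : Finset (Fin n →₀ ℕ)} (hTb : T ⊆ capBox c) (hT : IsStable c S a T) :
    #(boxShadow c (insert a S) T) =
      #(boxShadow c S (T.filter fun x => x a = 0)) + #(T.filter fun x => x a + 1 < c a) := by
  rw [← card_filter_add_card_filter_not (s := boxShadow c (insert a S) T) fun x => x a = 0]
  congr 1
  · congr 1
    ext x
    simp only [mem_filter, mem_boxShadow]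
    constructor
    · rintro ⟨⟨hb, k, hk, t, ht, rfl⟩, h0⟩
      rw [Finsupp.add_apply, Nat.add_eq_zero_iff] at h0
      refine ⟨hb, k, ?_, t, ⟨ht, h0.1⟩, rfl⟩
      rcases mem_insert.1 hk with rfl | hk
      · simp at h0
      · exact hk
    · rintro ⟨hb, k, hk, t, ⟨ht, h0⟩, rfl⟩
      have hka : k ≠ a := by rintro rfl; exact haS hk
      exact ⟨⟨hb, k, mem_insert_of_mem hk, t, ht, rfl⟩, by simp [h0, hka]⟩
  · refine card_bij' (fun x _ => x - Finsupp.single a 1) (fun x _ => x + Finsupp.single a 1)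
      ?_ ?_ ?_ ?_
    · intro x hx
      obtain ⟨hx, hx0⟩ := mem_filter.1 hx
      obtain ⟨hb, k, hk, t, ht, hxt⟩ := mem_boxShadow.1 hx
      obtain ⟨u, rfl⟩ : ∃ u, x = u + Finsupp.single a 1 :=
        ⟨_, (sub_add_single (Nat.pos_of_ne_zero hx0)).symm⟩
      rw [add_tsub_cancel_right]
      refine mem_filter.2 ⟨?_, by simpa using mem_capBox.1 hb a⟩
      rcases mem_insert.1 hk with rfl | hk
      · rwa [add_right_cancel hxt]
      · have hka : k ≠ a := fun h => haS (h ▸ hk)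
        have hta : 0 < t a := by
          have := DFunLike.congr_fun hxt a
          simp [hka.symm] at this
          omega
        obtain ⟨v, rfl⟩ : ∃ v, t = v + Finsupp.single a 1 := ⟨_, (sub_add_single hta).symm⟩
        have huv : u = v + Finsupp.single k 1 := by
          rw [add_right_comm] at hxt
          exact add_right_cancel hxt
        rw [huv] at hb ⊢
        exact hT k hk v ht (mem_capBox_of_add hb)
    · intro x hx
      obtain ⟨hx, hxa⟩ := mem_filter.1 hx
      exact mem_filter.2 ⟨mem_boxShadow.2
        ⟨add_single_mem_capBox (hTb hx) hxa, a, mem_insert_self _ _, x, hx, rfl⟩, by simp⟩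
    · intro x hx
      exact sub_add_single (Nat.pos_of_ne_zero (mem_filter.1 hx).2)
    · intro x hx
      simp

theorem SameFiber.pair_sum {l a : Fin n} (hla : l ≠ a) {x y : Fin n →₀ ℕ}
    (h : SameFiber {l, a} x y) : x l + x a = y l + y a := by
  have h2 := h.2
  rw [expDeg, expDeg, ← sum_add_sum_compl {l, a}, ← sum_add_sum_compl {l, a} (fun i => y i),
    sum_congr rfl fun i hi => h.1 i (mem_compl.1 hi), add_left_inj, sum_pair hla,
    sum_pair hla] at h2
  exact h2

theorem SameFiber.pair_eq {l a : Fin n} (hla : l ≠ a) {x y : Fin n →₀ ℕ}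
    (h : SameFiber {l, a} x y) (hl : x l = y l) : x = y := by
  have := h.pair_sum hla
  ext i
  by_cases hi : i ∈ ({l, a} : Finset (Fin n))
  · rcases mem_insert.1 hi with rfl | hi
    · exact hl
    · rw [mem_singleton.1 hi]; omega
  · exact h.1 i hi

theorem card_lt_card_boxShadow_pair {c : Fin n → ℕ} {l a : Fin n} (hla : l ≠ a)
    {m : Fin n →₀ ℕ} {T : Finset (Fin n →₀ ℕ)} (hT : T ⊆ fiber c {l, a} m) (hne : T.Nonempty)
    (hl : m l + m a + 1 < c l) (ha : m l + m a + 1 < c a) : #T < #(boxShadow c {l, a} T) := by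
  obtain ⟨x, hx, hmax⟩ := exists_max_image T (fun x => x l) hne
  have hbound : ∀ y ∈ T, y ∈ capBox c ∧ y l + 1 < c l ∧ y a + 1 < c a := fun y hy => by
    have hy := mem_fiber.1 (hT hy)
    have := hy.2.pair_sum hla
    exact ⟨hy.1, by omega, by omega⟩
  have hnot : x + Finsupp.single l 1 ∉ T.image (· + Finsupp.single a 1) := by
    intro h
    obtain ⟨y, hy, hxy⟩ := mem_image.1 h
    have h1 := DFunLike.congr_fun hxy l
    simp [hla] at h1
    have := hmax y hy
    omega
  have hcard : #(insert (x + Finsupp.single l 1) (T.image (· + Finsupp.single a 1))) = #T + 1 := by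
    rw [card_insert_of_notMem hnot, card_image_of_injective _ (add_left_injective _)]
  refine Nat.lt_of_succ_le (hcard.ge.trans (card_le_card ?_))
  refine insert_subset ?_ (image_subset_iff.2 fun y hy => ?_)
  · obtain ⟨hb, h1, -⟩ := hbound x hx
    exact mem_boxShadow.2 ⟨add_single_mem_capBox hb h1, l, by simp, x, hx, rfl⟩
  · obtain ⟨hb, -, h1⟩ := hbound y hy
    exact mem_boxShadow.2 ⟨add_single_mem_capBox hb h1, a, by simp, y, hy, rfl⟩

theorem card_le_card_boxShadow_pair {c : Fin n → ℕ} {l a : Fin n} (hla : l ≠ a)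
    {m g : Fin n →₀ ℕ} {T : Finset (Fin n →₀ ℕ)} (hT : T ⊆ fiber c {l, a} m)
    (hg : g ∈ fiber c {l, a} m) (hgT : g ∉ T) : #T ≤ #(boxShadow c {l, a} T) := by
  have hgap : ∀ x ∈ T, x ∈ capBox c ∧ x l ≠ g l ∧ x l + x a = g l + g a := fun x hx => by
    have hx' := mem_fiber.1 (hT hx)
    have hxg := hx'.2.symm.trans (mem_fiber.1 hg).2
    exact ⟨hx'.1, fun h => hgT (hxg.pair_eq hla h ▸ hx), hxg.pair_sum hla⟩
  have hgb := mem_capBox.1 (mem_fiber.1 hg).1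
  refine card_le_card_of_injOn
    (fun x => if x l < g l then x + Finsupp.single l 1 else x + Finsupp.single a 1) ?_ ?_
  · intro x hx
    obtain ⟨hb, h1, h2⟩ := hgap x hx
    have := hgb l
    have := hgb a
    simp only
    split_ifs with h
    · exact mem_boxShadow.2 ⟨add_single_mem_capBox hb (by omega), l, by simp, x, hx, rfl⟩
    · exact mem_boxShadow.2 ⟨add_single_mem_capBox hb (by omega), a, by simp, x, hx, rfl⟩
  · intro x hx y hy h
    have h1 := (hgap x hx).2.1
    have h2 := (hgap y hy).2.1
    simp only at h
    split_ifs at h with h3 h4 h4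
    · exact add_right_cancel h
    · have := DFunLike.congr_fun h l
      simp [hla] at this
      omega
    · have := DFunLike.congr_fun h l
      simp [hla] at this
      omega
    · exact add_right_cancel h

theorem segmentsMinimizeShadow_pair {c : Fin n → ℕ} {l a : Fin n} (hla : l < a)
    (hc : c l ≤ c a) : SegmentsMinimizeShadow c {l, a} := by
  intro m T₀ T' hT₀ hT' hseg hcard
  obtain ⟨T, hTT, hTcard⟩ := exists_subset_card_eq hcard
  refine le_trans ?_ (card_le_card (boxShadow_mono (Subset.refl _) hTT))
  have hT := hTT.trans hT₀
  rcases T'.eq_empty_or_nonempty with rfl | hne'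
  · simp [boxShadow]
  have hbox : ∀ x ∈ T', x ∈ capBox c ∧ x l + x a = m l + m a := fun x hx =>
    ⟨(mem_fiber.1 (hT' hx)).1, ((mem_fiber.1 (hT' hx)).2.pair_sum hla.ne).symm⟩
  have hstable : IsStable c {l} a T' :=
    .of_isFiberSegment (by simpa using hla) (by simpa using hseg)
  have hcount := card_boxShadow_insert (by simpa using hla.ne') (fun x hx => (hbox x hx).1) hstable
  rw [pair_comm a l] at hcount
  have hfilter := card_filter_le T' fun x => x a + 1 < c a
  by_cases hlt : m l + m a + 1 < c l
  · have h1 := card_lt_card_boxShadow_pair hla.ne hT (card_pos.1 (hTcard ▸ card_pos.2 hne'))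
      hlt (by omega)
    have h2 : #(boxShadow c {l} (T'.filter fun x => x a = 0)) ≤ 1 := by
      rw [card_le_one]
      intro x hx y hy
      obtain ⟨-, k, hk, t, ht, rfl⟩ := mem_boxShadow.1 hx
      obtain ⟨-, k', hk', t', ht', rfl⟩ := mem_boxShadow.1 hy
      rw [mem_singleton.1 hk, mem_singleton.1 hk']
      rw [mem_filter] at ht ht'
      have htt := (mem_fiber.1 (hT' ht.1)).2.symm.trans (mem_fiber.1 (hT' ht'.1)).2
      have := htt.pair_sum hla.ne
      rw [htt.pair_eq hla.ne (by omega)]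
    omega
  · have h2 : boxShadow c {l} (T'.filter fun x => x a = 0) = ∅ := by
      rw [eq_empty_iff_forall_notMem]
      intro x hx
      obtain ⟨hb, k, hk, t, ht, rfl⟩ := mem_boxShadow.1 hx
      rw [mem_singleton.1 hk] at hb
      rw [mem_filter] at ht
      have h3 := mem_capBox.1 hb l
      have := (hbox t ht.1).2
      simp at h3
      omega
    rw [h2, card_empty, zero_add] at hcount
    by_cases hall : T = fiber c {l, a} m
    · rw [hall, eq_of_subset_of_card_le hT' (by rw [← hall, hTcard])]
    · obtain ⟨g, hg, hgT⟩ := exists_of_ssubset (hT.ssubset_of_ne hall)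
      have := card_le_card_boxShadow_pair hla.ne hT hg hgT
      omega

theorem mem_of_lexLe_of_isStable {c : Fin n → ℕ} {S : Finset (Fin n)} {a : Fin n} (haS : a ∉ S)
    {T : Finset (Fin n →₀ ℕ)} (hseg : IsFiberSegment c S T) (hT : IsStable c S a T)
    {p : Fin n →₀ ℕ} (hp : p ∈ T) (hpb : p ∈ capBox c) (k : ℕ) :
    ∀ q ∈ capBox c, SameFiber (insert a S) p q → lexLe p q → p a = q a + k → q ∈ T := by
  induction k with
  | zero =>
    intro q hq hpq hle hk
    refine hseg.mem_of_lexLe hp hq ⟨fun i hi => ?_, hpq.2⟩ hle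
    by_cases hia : i = a
    · rw [hia]; exact hk
    · exact hpq.1 i (by simp [hia, hi])
  | succ k ih =>
    intro q hq hpq hle hk
    rcases hle with rfl | hlt
    · exact hp
    obtain ⟨w, rfl⟩ : ∃ w, p = w + Finsupp.single a 1 :=
      ⟨_, (sub_add_single (by omega : 0 < p a)).symm⟩
    have hwa : w a = q a + k := by simpa [← add_assoc] using hk
    obtain ⟨l, hl, u, rfl, hwu⟩ := exists_lexLe_of_add_single_lexLt (S := S) (fun i hi => by
      by_cases hia : i = a
      · rw [hia]; omega
      · exact hpq.le_of_add_single (mem_insert_self a S) (by simp [hia, hi])) hpq.2 hlt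
    have hla : l ≠ a := by rintro rfl; exact haS hl
    have hua : (u + Finsupp.single l 1 : Fin n →₀ ℕ) a = u a := by simp [hla.symm]
    rw [hua] at hwa
    have hpa := mem_capBox.1 hpb a
    simp only [Finsupp.add_apply, Finsupp.single_eq_same] at hpa
    refine hT l hl u (ih _ (add_single_mem_capBox (mem_capBox_of_add hq) (by omega)) ?_ ?_ ?_) hq
    · exact hpq.trans ((SameFiber.refl _ u).add_single_add_single
        (mem_insert_of_mem hl) (mem_insert_self _ _))
    · rcases hwu with rfl | h
      · exact Or.inl rfl
      · exact Or.inr ((lexLt_add_right _).2 h)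
    · simp; omega

theorem card_filter_le_card_filter_of_isStable {c : Fin n → ℕ} {S : Finset (Fin n)} {a : Fin n}
    (haS : a ∉ S) {m : Fin n →₀ ℕ} {T T' : Finset (Fin n →₀ ℕ)} (hTm : T ⊆ fiber c (insert a S) m)
    (hTm' : T' ⊆ fiber c (insert a S) m) (hseg : IsFiberSegment c S T) (hT : IsStable c S a T)
    (hseg' : IsFiberSegment c (insert a S) T') (hcard : #T' ≤ #T) (P : ℕ → Prop)
    [DecidablePred P] (hP : ∀ i j, i ≤ j → P j → P i) :
    #(T'.filter fun x => P (x a)) ≤ #(T.filter fun x => P (x a)) := by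
  by_contra! h
  have h1 := card_filter_add_card_filter_not (s := T) fun x => P (x a)
  have h2 := card_filter_add_card_filter_not (s := T') fun x => P (x a)
  obtain ⟨q, hq, hqT⟩ := exists_mem_notMem_of_card_lt_card h
  obtain ⟨p, hp, hpT⟩ := exists_mem_notMem_of_card_lt_card
    (s := T'.filter fun x => ¬ P (x a)) (t := T.filter fun x => ¬ P (x a)) (by omega)
  rw [mem_filter] at hq hp hqT hpT
  have hqT' : q ∉ T := fun h' => hqT ⟨h', hq.2⟩
  have hpT' : p ∉ T' := fun h' => hpT ⟨h', hp.2⟩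
  have hlt : q a < p a := by
    by_contra! hle
    exact hp.2 (hP _ _ hle hq.2)
  have hqf := mem_fiber.1 (hTm' hq.1)
  have hpf := mem_fiber.1 (hTm hp.1)
  have hpq := hpf.2.symm.trans hqf.2
  rcases lexLt_trichotomy p q with h3 | h3 | h3
  · exact hqT' (mem_of_lexLe_of_isStable haS hseg hT hp.1 hpf.1 (p a - q a) q hqf.1 hpq
      (Or.inr h3) (by omega))
  · subst h3; exact hpT' hq.1
  · exact hpT' (hseg' q hq.1 p hpf.1 hpq.symm h3)

theorem exists_minimal_subset_fiber {c : Fin n → ℕ} (U : Finset (Fin n)) {m : Fin n →₀ ℕ}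
    {T : Finset (Fin n →₀ ℕ)} (hT : T ⊆ fiber c U m) :
    ∃ T₁ ⊆ fiber c U m, #T₁ = #T ∧ #(boxShadow c U T₁) ≤ #(boxShadow c U T) ∧
      ∀ S ⊆ U, SegmentsMinimizeShadow c S → IsFiberSegment c S T₁ := by
  let f : (Fin n →₀ ℕ) ↪ (Lex (Fin n →₀ ℕ))ᵒᵈ := (toLex.trans OrderDual.toDual).toEmbedding
  let A := (fiber c U m).powerset.filter fun T₁ =>
    #T₁ = #T ∧ #(boxShadow c U T₁) ≤ #(boxShadow c U T)
  obtain ⟨T₁, hT₁, hmin⟩ := exists_min_image A (fun X => toColex (X.map f))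
    ⟨T, mem_filter.2 ⟨mem_powerset.2 hT, rfl, le_rfl⟩⟩
  obtain ⟨hsub, hcard, hsh⟩ := mem_filter.1 hT₁
  rw [mem_powerset] at hsub
  refine ⟨T₁, hsub, hcard, hsh, fun S hSU hS => ?_⟩
  have hb : T₁ ⊆ capBox c := hsub.trans (filter_subset _ _)
  by_contra hseg
  obtain ⟨x, hx, hxC, hlow⟩ := exists_lexLt_of_not_isFiberSegment hb hseg
  refine absurd (hmin (compress c S T₁) (mem_filter.2 ⟨mem_powerset.2
    (compress_subset_fiber hSU hsub), (card_compress S hb).trans hcard,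
    (card_boxShadow_compress_le hS hSU T₁).trans hsh⟩)) (not_le_of_gt ?_)
  rw [Finset.Colex.toColex_lt_toColex_iff_exists_forall_lt]
  refine ⟨f x, mem_map_of_mem f hx, fun h => hxC ((mem_map' f).1 h), fun y hy hyT => ?_⟩
  obtain ⟨z, hz, rfl⟩ := mem_map.1 hy
  exact lexLt_iff.1 (hlow z hz fun h => hyT (mem_map_of_mem f h))

/-- The Clements–Lindström theorem, relative to a set `S` of coordinates. -/
theorem segmentsMinimizeShadow_of_monotone {c : Fin n → ℕ} (hc : Monotone c)
    (S : Finset (Fin n)) : SegmentsMinimizeShadow c S := by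
  induction S using Finset.induction_on_max with
  | empty =>
    intro m T T' _ _ _ _
    simp [boxShadow]
  | insert a S ha ih =>
    have haS : a ∉ S := fun h => lt_irrefl _ (ha a h)
    intro m T₀ T' hT₀ hT' hseg' hcard
    obtain ⟨T, hT, hTcard, hsh, hmin⟩ := exists_minimal_subset_fiber (insert a S) hT₀
    refine le_trans ?_ hsh
    rw [← hTcard] at hcard
    have hpair : ∀ l ∈ S, ({l, a} : Finset (Fin n)) ⊆ insert a S := fun l hl =>
      insert_subset (mem_insert_of_mem hl) (singleton_subset_iff.2 (mem_insert_self _ _))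
    have hst : IsStable c S a T := .of_isFiberSegment ha fun l hl =>
      hmin _ (hpair l hl) (segmentsMinimizeShadow_pair (ha l hl) (hc (ha l hl).le))
    have hst' : IsStable c S a T' := .of_isFiberSegment ha fun l hl => hseg'.mono (hpair l hl)
    have hseg := hmin S (subset_insert _ _) ih
    have key := fun (P : ℕ → Prop) (_ : DecidablePred P) =>
      card_filter_le_card_filter_of_isStable haS hT hT' hseg hst hseg' hcard P
    rw [card_boxShadow_insert haS (hT.trans (filter_subset _ _)) hst,
      card_boxShadow_insert haS (hT'.trans (filter_subset _ _)) hst']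
    refine add_le_add ?_ (key (fun i => i + 1 < c a) _ fun i j hij hj => by omega)
    rcases (T'.filter fun x => x a = 0).eq_empty_or_nonempty with he | ⟨z, hz⟩
    · simp [he, boxShadow]
    · have hz' := mem_filter.1 hz
      have hsub : ∀ X ⊆ fiber c (insert a S) m, (X.filter fun x => x a = 0) ⊆ fiber c S z := by
        intro X hX x hx
        rw [mem_filter] at hx
        have hxf := mem_fiber.1 (hX hx.1)
        have hzx := (mem_fiber.1 (hT' hz'.1)).2.symm.trans hxf.2
        refine mem_fiber.2 ⟨hxf.1, fun i hi => ?_, hzx.2⟩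
        by_cases hia : i = a
        · rw [hia, hx.2, hz'.2]
        · exact hzx.1 i (by simp [hia, hi])
      refine ih z _ _ (hsub T hT) (hsub T' hT') ?_
        (key (fun i => i = 0) _ fun i j hij hj => by omega)
      intro x hx y hy hxy h
      rw [mem_filter] at hx ⊢
      exact ⟨(hseg'.mono (subset_insert a S)) x hx.1 y hy hxy h, by rw [← hxy.1 a haS, hx.2]⟩

end ClementsLindstrom

section MonomialIdeals

variable {K : Type*} [Field K] {n : ℕ}

/-- The exponent vectors of degree `d` that are divisible by a member of `M`. -/
def multiplesOfDegree (M : Set (Fin n →₀ ℕ)) (d : ℕ) : Set (Fin n →₀ ℕ) :=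
  {m | expDeg m = d ∧ ∃ s ∈ M, s ≤ m}

theorem multiplesOfDegree_union (M M' : Set (Fin n →₀ ℕ)) (d : ℕ) :
    multiplesOfDegree (M ∪ M') d = multiplesOfDegree M d ∪ multiplesOfDegree M' d := by
  ext m
  simp only [multiplesOfDegree, Set.mem_ofPred_eq, Set.mem_union, or_and_right, exists_or,
    and_or_left]

theorem expDeg_eq_degree (m : Fin n →₀ ℕ) : expDeg m = m.degree := (Finsupp.degree_eq_sum m).symm

theorem expDeg_mono {x y : Fin n →₀ ℕ} (h : x ≤ y) : expDeg x ≤ expDeg y :=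
  Finset.sum_le_sum fun i _ => h i

theorem eq_of_le_of_expDeg_eq {x y : Fin n →₀ ℕ} (h : x ≤ y) (hdeg : expDeg x = expDeg y) :
    x = y := by
  have := (Finset.sum_eq_sum_iff_of_le (s := Finset.univ) fun i _ => h i).1 hdeg
  ext i
  exact this i (Finset.mem_univ i)

theorem finite_of_expDeg_eq {N : Set (Fin n →₀ ℕ)} {d : ℕ} (h : ∀ m ∈ N, expDeg m = d) :
    N.Finite :=
  (Finsupp.finite_of_degree_eq d).subset fun m hm => (expDeg_eq_degree m).symm.trans (h m hm)

theorem mem_span_monomial_iff {N : Set (Fin n →₀ ℕ)} {f : MvPolynomial (Fin n) K} :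
    f ∈ Submodule.span K ((fun m => (monomial m (1 : K) : MvPolynomial (Fin n) K)) '' N) ↔
      ∀ m ∈ f.support, m ∈ N := by
  constructor
  · intro hf
    induction hf using Submodule.span_induction with
    | mem x hx =>
      obtain ⟨s, hs, rfl⟩ := hx
      intro m hm
      rw [Finset.mem_singleton.1 (support_monomial_subset hm)]
      exact hs
    | zero => simp
    | add x y _ _ hx hy =>
      intro m hm
      classical
      rcases Finset.mem_union.1 (support_add hm) with h | h
      · exact hx m h
      · exact hy m h
    | smul a x _ hx => exact fun m hm => hx m (support_smul hm)
  · intro h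
    rw [f.as_sum]
    refine Submodule.sum_mem _ fun m hm => ?_
    have : monomial m (coeff m f) = coeff m f • (monomial m (1 : K)) := by
      rw [smul_monomial, smul_eq_mul, mul_one]
    rw [this]
    exact Submodule.smul_mem _ _ (Submodule.subset_span ⟨m, h m hm, rfl⟩)

theorem mem_component_iff {I : Ideal (MvPolynomial (Fin n) K)} {d : ℕ}
    {f : MvPolynomial (Fin n) K} :
    f ∈ component I d ↔ f ∈ I ∧ ∀ m ∈ f.support, expDeg m = d := by
  rw [component, Submodule.mem_inf, Submodule.restrictScalars_mem, mem_homogeneousSubmodule]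
  refine and_congr_right fun _ => ⟨fun h m hm => ?_, fun h m hm => ?_⟩
  · rw [expDeg_eq_degree, Finsupp.degree_eq_weight_one]
    exact h (mem_support_iff.1 hm)
  · have := h m (mem_support_iff.2 hm)
    rwa [expDeg_eq_degree, Finsupp.degree_eq_weight_one] at this

theorem monomial_mem_component_iff {I : Ideal (MvPolynomial (Fin n) K)} {d : ℕ}
    {m : Fin n →₀ ℕ} :
    (monomial m (1 : K) : MvPolynomial (Fin n) K) ∈ component I d ↔
      expDeg m = d ∧ (monomial m (1 : K) : MvPolynomial (Fin n) K) ∈ I := by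
  classical
  rw [mem_component_iff, support_monomial, if_neg one_ne_zero, and_comm]
  simp

theorem component_span_monomial (M : Set (Fin n →₀ ℕ)) (d : ℕ) :
    component (Ideal.span ((fun m => (monomial m (1 : K) : MvPolynomial (Fin n) K)) '' M)) d =
      Submodule.span K
        ((fun m => (monomial m (1 : K) : MvPolynomial (Fin n) K)) '' multiplesOfDegree M d) := by
  ext f
  rw [mem_component_iff, mem_span_monomial_iff, mem_ideal_span_monomial_image]
  exact ⟨fun h m hm => ⟨h.2 m hm, h.1 m hm⟩, fun h => ⟨fun m hm => (h m hm).2,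
    fun m hm => (h m hm).1⟩⟩

theorem finrank_span_monomial {N : Set (Fin n →₀ ℕ)} (hN : N.Finite) :
    Module.finrank K (Submodule.span K
      ((fun m => (monomial m (1 : K) : MvPolynomial (Fin n) K)) '' N)) = N.ncard := by
  have := hN.fintype
  have hli : LinearIndependent K
      fun m : N => (monomial (m : Fin n →₀ ℕ) (1 : K) : MvPolynomial (Fin n) K) := by
    have h := (basisMonomials (Fin n) K).linearIndependent.comp _
      (Subtype.val_injective : Function.Injective (Subtype.val : N → Fin n →₀ ℕ))
    simpa [Function.comp_def] using h
  rw [Set.image_eq_range, finrank_span_eq_card hli, Set.ncard_eq_toFinset_card',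
    Set.toFinset_card]

theorem hilb_eq_ncard {I : Ideal (MvPolynomial (Fin n) K)} {d : ℕ} {N : Set (Fin n →₀ ℕ)}
    (h : component I d =
      Submodule.span K ((fun m => (monomial m (1 : K) : MvPolynomial (Fin n) K)) '' N)) :
    hilb I d = N.ncard := by
  have hdeg : ∀ m ∈ N, expDeg m = d := fun m hm =>
    (monomial_mem_component_iff.1 (by rw [h]; exact Submodule.subset_span ⟨m, hm, rfl⟩)).1
  rw [hilb, h, finrank_span_monomial (finite_of_expDeg_eq hdeg)]

/-- The exponent vectors of the generators of the pure-powers ideal. -/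
def powerExponents {r : ℕ} (hrn : r ≤ n) (a : Fin r → ℕ) : Set (Fin n →₀ ℕ) :=
  Set.range fun i => Finsupp.single (Fin.castLE hrn i) (a i)

theorem purePowers_eq_span {r : ℕ} (hrn : r ≤ n) (a : Fin r → ℕ) :
    purePowers K hrn a = Ideal.span
      ((fun m => (monomial m (1 : K) : MvPolynomial (Fin n) K)) '' powerExponents hrn a) := by
  rw [purePowers, powerExponents, ← Set.range_comp]
  congr 2
  ext i
  simp [X_pow_eq_monomial]

theorem multiplesOfDegree_powerExponents_anti {r : ℕ} (hrn : r ≤ n) {a b : Fin r → ℕ}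
    (hab : ∀ i, a i ≤ b i) (d : ℕ) : multiplesOfDegree (powerExponents hrn b) d ⊆
      multiplesOfDegree (powerExponents hrn a) d := by
  rintro m ⟨hm, _, ⟨i, rfl⟩, hi⟩
  exact ⟨hm, _, ⟨i, rfl⟩, (Finsupp.single_mono (hab i)).trans hi⟩

/-- The monomials of degree `d` in an ideal. -/
def monomialsOfDegree (I : Ideal (MvPolynomial (Fin n) K)) (d : ℕ) : Set (Fin n →₀ ℕ) :=
  {m | expDeg m = d ∧ (monomial m (1 : K) : MvPolynomial (Fin n) K) ∈ I}

theorem IsLPP.component_eq {r : ℕ} {hrn : r ≤ n} {a : Fin r → ℕ}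
    {J : Ideal (MvPolynomial (Fin n) K)} (hJ : IsLPP hrn a J) (d : ℕ) :
    multiplesOfDegree (powerExponents hrn a) d ⊆ monomialsOfDegree J d ∧
      component J d = Submodule.span K
        ((fun m => (monomial m (1 : K) : MvPolynomial (Fin n) K)) '' monomialsOfDegree J d) := by
  obtain ⟨S, -, hS⟩ := hJ.2 d
  rw [purePowers_eq_span, component_span_monomial, ← Submodule.span_union, ← Set.image_union] at hS
  have : S ∪ multiplesOfDegree (powerExponents hrn a) d = monomialsOfDegree J d := by
    ext m
    rw [monomialsOfDegree, Set.mem_ofPred_eq, ← monomial_mem_component_iff, hS,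
      mem_span_monomial_iff]
    classical
    rw [support_monomial, if_neg one_ne_zero]
    simp
  rw [this] at hS
  exact ⟨this ▸ Set.subset_union_right, hS⟩

theorem isHomog_span_monomial (M : Set (Fin n →₀ ℕ)) :
    IsHomog (Ideal.span ((fun m => (monomial m (1 : K) : MvPolynomial (Fin n) K)) '' M)) := by
  classical
  intro f hf d
  rw [mem_ideal_span_monomial_image] at hf ⊢
  intro m hm
  rw [mem_support_iff, coeff_homogeneousComponent] at hm
  exact hf m (mem_support_iff.2 fun h => hm (by rw [h, ite_self]))

theorem exists_lexLe_le_of_isLexSegment {d : ℕ} {S : Set (Fin n →₀ ℕ)}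
    (hS : IsLexSegment n d S) (k : ℕ) : ∀ x y s : Fin n →₀ ℕ, s ∈ S → s ≤ x →
      expDeg x = d + k → expDeg y = d + k → lexLe x y → ∃ t ∈ S, t ≤ y := by
  induction k with
  | zero =>
    intro x y s hs hsx hx hy hxy
    obtain rfl := eq_of_le_of_expDeg_eq hsx (by rw [hS.1 s hs, hx, add_zero])
    exact ⟨y, hS.2 s hs y hy hxy, le_rfl⟩
  | succ k ih =>
    intro x y s hs hsx hx hy hxy
    rcases hxy with rfl | hlt
    · exact ⟨s, hs, hsx⟩
    obtain ⟨i, hi⟩ : ∃ i, s i < x i := by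
      by_contra! h
      have := expDeg_mono (show x ≤ s from h)
      have := hS.1 s hs
      omega
    obtain ⟨w, rfl⟩ : ∃ w, x = w + Finsupp.single i 1 :=
      ⟨_, (sub_add_single (by omega : 0 < x i)).symm⟩
    obtain ⟨l, -, u, rfl, hwu⟩ := exists_lexLe_of_add_single_lexLt (S := Finset.univ)
      (fun j hj => absurd (Finset.mem_univ j) hj) (hx.trans hy.symm) hlt
    rw [expDeg_add_single] at hx hy
    have hsw : s ≤ w := fun j => by
      by_cases hij : i = j
      · subst hij
        simpa [Nat.lt_succ_iff] using hi
      · simpa [Finsupp.single_apply, hij] using hsx j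
    obtain ⟨t, ht, htu⟩ := ih w u s hs hsw (by omega) (by omega) hwu
    exact ⟨t, ht, htu.trans le_self_add⟩

theorem IsLexSegment.multiplesOfDegree {d : ℕ} {S : Set (Fin n →₀ ℕ)}
    (hS : IsLexSegment n d S) (e : ℕ) : IsLexSegment n e (multiplesOfDegree S e) := by
  refine ⟨fun m hm => hm.1, ?_⟩
  rintro x ⟨hx, s, hs, hsx⟩ y hy hxy
  have hle := expDeg_mono hsx
  rw [hS.1 s hs, hx] at hle
  obtain ⟨k, rfl⟩ := Nat.exists_eq_add_of_le hle
  exact ⟨hy, exists_lexLe_le_of_isLexSegment hS k x y s hs hsx hx hy hxy⟩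

/-- The ideal generated by a lex-segment of one degree and the pure powers is lex-plus-powers. -/
theorem isLPP_span_union {r : ℕ} (hrn : r ≤ n) (a : Fin r → ℕ) {d : ℕ}
    {S : Set (Fin n →₀ ℕ)} (hS : IsLexSegment n d S) :
    IsLPP hrn a (Ideal.span ((fun m => (monomial m (1 : K) : MvPolynomial (Fin n) K)) ''
      (S ∪ powerExponents hrn a))) := by
  refine ⟨isHomog_span_monomial _, fun e => ⟨_, hS.multiplesOfDegree e, ?_⟩⟩
  rw [component_span_monomial, multiplesOfDegree_union, Set.image_union, Submodule.span_union,
    purePowers_eq_span, component_span_monomial]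

/-- The exponents `b`, extended past the first `r` coordinates by a bound `D`. -/
def extendedCaps {r : ℕ} (b : Fin r → ℕ) (D : ℕ) (i : Fin n) : ℕ :=
  if h : (i : ℕ) < r then b ⟨i, h⟩ else D

theorem extendedCaps_monotone {r : ℕ} {b : Fin r → ℕ} (hb : Monotone b) {D : ℕ}
    (hD : ∀ i, b i ≤ D) : Monotone (extendedCaps (n := n) b D) := by
  intro i j hij
  have hij' : (i : ℕ) ≤ j := hij
  simp only [extendedCaps]
  split_ifs with h1 h2 h2
  · exact hb hij
  · exact hD _
  · omega
  · exact le_rfl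

theorem notMem_capBox_extendedCaps_iff {r : ℕ} (hrn : r ≤ n) {b : Fin r → ℕ} {D : ℕ}
    {m : Fin n →₀ ℕ} (hm : expDeg m < D) :
    m ∉ capBox (extendedCaps b D) ↔ ∃ s ∈ powerExponents hrn b, s ≤ m := by
  simp only [mem_capBox, powerExponents, Set.exists_range_iff, Finsupp.single_le_iff, not_forall,
    not_lt]
  constructor
  · rintro ⟨i, hi⟩
    have hmi : m i ≤ expDeg m :=
      Finset.single_le_sum (f := fun i => m i) (fun _ _ => Nat.zero_le _) (Finset.mem_univ i)
    simp only [extendedCaps] at hi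
    split_ifs at hi with h
    · exact ⟨⟨i, h⟩, hi⟩
    · omega
  · rintro ⟨i, hi⟩
    refine ⟨Fin.castLE hrn i, ?_⟩
    simpa [extendedCaps] using hi

theorem ncard_eq_card_add_ncard {r : ℕ} (hrn : r ≤ n) {b : Fin r → ℕ} {D e : ℕ} (he : e < D)
    {N : Set (Fin n →₀ ℕ)} (hN : ∀ m ∈ N, expDeg m = e)
    (hb : multiplesOfDegree (powerExponents hrn b) e ⊆ N) {T : Finset (Fin n →₀ ℕ)}
    (hT : ∀ m, m ∈ T ↔ m ∈ N ∧ m ∈ capBox (extendedCaps b D)) :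
    N.ncard = T.card + (multiplesOfDegree (powerExponents hrn b) e).ncard := by
  have hunion : N = ↑T ∪ multiplesOfDegree (powerExponents hrn b) e := by
    ext m
    rw [Set.mem_union, Finset.mem_coe, hT]
    refine ⟨fun hm => ?_, fun hm => hm.elim And.left fun h => hb h⟩
    by_cases hmb : m ∈ capBox (extendedCaps b D)
    · exact Or.inl ⟨hm, hmb⟩
    · exact Or.inr ⟨hN m hm, (notMem_capBox_extendedCaps_iff hrn (by rw [hN m hm]; exact he)).1 hmb⟩
  have hdisj : Disjoint (T : Set (Fin n →₀ ℕ)) (multiplesOfDegree (powerExponents hrn b) e) := by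
    rw [Set.disjoint_left]
    rintro m hm ⟨hme, h⟩
    exact (notMem_capBox_extendedCaps_iff hrn (by omega)).2 h ((hT m).1 hm).2
  conv_lhs => rw [hunion]
  rw [Set.ncard_union_eq hdisj T.finite_toSet (finite_of_expDeg_eq fun m hm => hm.1),
    Set.ncard_coe_finset]

theorem exists_eq_add_single_of_le {x y : Fin n →₀ ℕ} (h : x ≤ y) (hdeg : expDeg y = expDeg x + 1) :
    ∃ k, y = x + Finsupp.single k 1 := by
  obtain ⟨k, hk⟩ : ∃ k, x k < y k := by
    by_contra! hle
    have := expDeg_mono (show y ≤ x from hle)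
    omega
  refine ⟨k, (eq_of_le_of_expDeg_eq (fun i => ?_) (by rw [expDeg_add_single, hdeg])).symm⟩
  by_cases hik : k = i
  · subst hik
    simpa using Nat.succ_le_of_lt hk
  · simpa [Finsupp.single_apply, hik] using h i

/-- The Clements–Lindström step: a lex-plus-powers ideal for `a` can be replaced, in two
consecutive degrees, by one for the larger exponents `b`. -/
theorem IsLPP.exists_isLPP_of_le {r : ℕ} {hrn : r ≤ n} {a b : Fin r → ℕ}
    (hbmono : Monotone b) (hab : ∀ i, a i ≤ b i) {J : Ideal (MvPolynomial (Fin n) K)}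
    (hJ : IsLPP hrn a J) (d : ℕ) :
    ∃ J' : Ideal (MvPolynomial (Fin n) K), IsLPP hrn b J' ∧
      hilb J' d = hilb J d ∧ hilb J' (d + 1) ≤ hilb J (d + 1) := by
  classical
  set D := d + 2 + ∑ i, b i with hD
  have hbD : ∀ i, b i ≤ D := fun i =>
    (Finset.single_le_sum (fun _ _ => Nat.zero_le _) (Finset.mem_univ i)).trans
      (Nat.le_add_left _ _)
  set c : Fin n → ℕ := extendedCaps b D with hc
  have hcmono : Monotone c := extendedCaps_monotone hbmono hbD
  have hJb : ∀ e, multiplesOfDegree (powerExponents hrn b) e ⊆ monomialsOfDegree J e := fun e =>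
    (multiplesOfDegree_powerExponents_anti hrn hab e).trans (hJ.component_eq e).1
  let T : ℕ → Finset (Fin n →₀ ℕ) := fun e => (capBox c).filter (· ∈ monomialsOfDegree J e)
  have hhilbJ : ∀ e < D, hilb J e =
      (T e).card + (multiplesOfDegree (powerExponents hrn b) e).ncard := fun e he => by
    rw [hilb_eq_ncard (hJ.component_eq e).2]
    exact ncard_eq_card_add_ncard hrn he (fun m hm => hm.1) (hJb e)
      fun m => Finset.mem_filter.trans and_comm
  have hshadow : boxShadow c Finset.univ (T d) ⊆ T (d + 1) := by
    intro m hm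
    obtain ⟨hmc, k, -, t, ht, rfl⟩ := mem_boxShadow.1 hm
    obtain ⟨-, htd, htJ⟩ := Finset.mem_filter.1 ht
    refine Finset.mem_filter.2 ⟨hmc, by rw [expDeg_add_single, htd], ?_⟩
    rw [← mul_one (1 : K), ← monomial_mul]
    exact J.mul_mem_right _ htJ
  set T' := compress c Finset.univ (T d) with hT'
  have hdegT' : ∀ t ∈ T', expDeg t = d := fun t ht => by
    obtain ⟨y, hy, hyt⟩ := exists_sameFiber_of_mem_compress ht
    rw [← hyt.2]
    exact (Finset.mem_filter.1 hy).2.1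
  set S : Set (Fin n →₀ ℕ) := {m | expDeg m = d ∧ ∃ t ∈ T', lexLe t m} with hS
  have hSlex : IsLexSegment n d S := by
    refine ⟨fun m hm => hm.1, ?_⟩
    rintro m ⟨-, t, ht, htm⟩ m' hm' hmm'
    exact ⟨hm', t, ht, lexLe_trans htm hmm'⟩
  have hST' : ∀ m ∈ S, m ∈ capBox c → m ∈ T' := by
    rintro m ⟨hm, t, ht, htm⟩ hmc
    exact (isFiberSegment_compress c Finset.univ (T d)).mem_of_lexLe ht hmc
      ⟨fun i hi => absurd (Finset.mem_univ i) hi, (hdegT' t ht).trans hm.symm⟩ htm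
  have hmult : ∀ e < D, ∀ m ∈ multiplesOfDegree (S ∪ powerExponents hrn b) e, m ∈ capBox c →
      ∃ s ∈ T', s ≤ m := by
    rintro e he m ⟨hm, s, hs | hs, hsm⟩ hmc
    · refine ⟨s, hST' s hs ?_, hsm⟩
      exact mem_capBox.2 fun i => (hsm i).trans_lt (mem_capBox.1 hmc i)
    · exact absurd hmc ((notMem_capBox_extendedCaps_iff hrn (by omega)).2 ⟨s, hs, hsm⟩)
  let T'' : ℕ → Finset (Fin n →₀ ℕ) := fun e =>
    (capBox c).filter (· ∈ multiplesOfDegree (S ∪ powerExponents hrn b) e)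
  refine ⟨_, isLPP_span_union hrn b hSlex, ?_⟩
  have hhilb : ∀ e < D, hilb (Ideal.span ((fun m =>
        (monomial m (1 : K) : MvPolynomial (Fin n) K)) '' (S ∪ powerExponents hrn b))) e =
      (T'' e).card + (multiplesOfDegree (powerExponents hrn b) e).ncard := fun e he => by
    rw [hilb_eq_ncard (component_span_monomial _ e)]
    exact ncard_eq_card_add_ncard hrn he (fun m hm => hm.1)
      (by rw [multiplesOfDegree_union]; exact Set.subset_union_right)
      fun m => Finset.mem_filter.trans and_comm
  have hd : d < D := by omega
  have hd1 : d + 1 < D := by omega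
  rw [hhilb d hd, hhilb _ hd1, hhilbJ d hd, hhilbJ _ hd1]
  constructor
  · have : T'' d = T' := by
      ext m
      simp only [T'', Finset.mem_filter]
      constructor
      · rintro ⟨hmc, hm⟩
        obtain ⟨s, hs, hsm⟩ := hmult d hd m hm hmc
        rwa [← eq_of_le_of_expDeg_eq hsm ((hdegT' s hs).trans hm.1.symm)]
      · intro hm
        exact ⟨compress_subset _ _ _ hm, hdegT' m hm, m,
          Or.inl ⟨hdegT' m hm, m, hm, Or.inl rfl⟩, le_rfl⟩
    rw [this, hT', card_compress _ (Finset.filter_subset _ _)]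
  · have : T'' (d + 1) ⊆ boxShadow c Finset.univ T' := by
      intro m hm
      obtain ⟨hmc, hm⟩ := Finset.mem_filter.1 hm
      obtain ⟨s, hs, hsm⟩ := hmult _ hd1 m hm hmc
      obtain ⟨k, hk⟩ := exists_eq_add_single_of_le hsm (by rw [hm.1, hdegT' s hs])
      exact mem_boxShadow.2 ⟨hmc, k, Finset.mem_univ k, s, hs, hk⟩
    exact Nat.add_le_add_right ((Finset.card_le_card this).trans
      ((card_boxShadow_compress_le (segmentsMinimizeShadow_of_monotone hcmono Finset.univ)
        (Finset.subset_univ _) (T d)).trans (Finset.card_le_card hshadow))) _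

end MonomialIdeals

/-- If `a` and `b` are degree sequences with `a_i ≤ b_i` for all `i`, then any homogeneous
ideal satisfying `EGH_a` also satisfies `EGH_b`. -/
theorem egh_of_le_degree_sequence {K : Type*} [Field K] {n r : ℕ} (hrn : r ≤ n)
    (a b : Fin r → ℕ) (hapos : ∀ i, 0 < a i) (hamono : Monotone a)
    (hbpos : ∀ i, 0 < b i) (hbmono : Monotone b) (hab : ∀ i, a i ≤ b i)
    (I : Ideal (MvPolynomial (Fin n) K)) (hI : IsHomog I)
    (hEGH : EGH hrn a I) : EGH hrn b I := by
  intro d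
  obtain ⟨J, hJ, hJd, hJd1⟩ := hEGH d
  obtain ⟨J', hJ', hJ'd, hJ'd1⟩ := hJ.exists_isLPP_of_le hbmono hab d
  exact ⟨J', hJ', hJ'd.trans hJd, hJ'd1.trans hJd1⟩
end

section
/- Assume K is an infinite field. Let I ⊆ A = K[x_1,…,x_n] be a homogeneous ideal containing a homogeneous regular sequence f_1,…,f_r with deg f_i = a_i, where a = (a_1,…,a_r) is a degree sequence. If b = (b_1,…,b_r) is a degree sequence with b_i ≥ a_i for all i, then I contains a homogeneous regular sequence g_1,…,g_r with deg g_i = b_i. -/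
open MvPolynomial

section RegularElements

variable {R : Type*} [CommRing R]

/-- `x` is a non-zerodivisor modulo the ideal `A`. -/
def RegMod (A : Ideal R) (x : R) : Prop := ∀ g, g * x ∈ A → g ∈ A

/-- `J` contains a sequence of length `s` which is (weakly) regular modulo `A`. -/
def HasRegSeqMod (J : Ideal R) : ℕ → Ideal R → Prop
  | 0, _ => True
  | s + 1, A => ∃ x ∈ J, RegMod A x ∧ HasRegSeqMod J s (A ⊔ Ideal.span {x})

lemma mem_sup_span_singleton_iff {A : Ideal R} {x g : R} :
    g ∈ A ⊔ Ideal.span {x} ↔ ∃ c, g - c * x ∈ A := by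
  rw [Submodule.mem_sup]
  constructor
  · rintro ⟨u, hu, v, hv, rfl⟩
    obtain ⟨c, rfl⟩ := Ideal.mem_span_singleton'.1 hv
    exact ⟨c, by simpa using hu⟩
  · rintro ⟨c, hc⟩
    exact ⟨_, hc, c * x, Ideal.mem_span_singleton'.2 ⟨c, rfl⟩, by ring⟩

lemma RegMod.swap {A : Ideal R} {x z : R} (hx : RegMod A x)
    (hzx : RegMod (A ⊔ Ideal.span {x}) z) : RegMod (A ⊔ Ideal.span {z}) x := by
  intro g hg
  obtain ⟨c, hc⟩ := mem_sup_span_singleton_iff.1 hg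
  have hcx : c ∈ A ⊔ Ideal.span {x} := by
    refine hzx c (mem_sup_span_singleton_iff.2 ⟨g, ?_⟩)
    rw [← neg_mem_iff]
    convert hc using 1
    ring
  obtain ⟨e, he⟩ := mem_sup_span_singleton_iff.1 hcx
  refine mem_sup_span_singleton_iff.2 ⟨e, hx _ ?_⟩
  convert A.add_mem hc (A.mul_mem_right z he) using 1
  ring

/-- Zero divisors modulo `A` are covered by finitely many primes containing `A`,
each annihilating, modulo `A`, some element outside `A`. -/
lemma exists_finite_primes_cover_zeroDivisors [IsNoetherianRing R] (A : Ideal R) :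
    ∃ T : Set (Ideal R), T.Finite ∧
      (∀ p ∈ T, p.IsPrime ∧ A ≤ p ∧ ∃ m ∉ A, ∀ g ∈ p, m * g ∈ A) ∧
      ∀ x, ¬ RegMod A x → ∃ p ∈ T, x ∈ p := by
  have key : ∀ x, x ∈ ⋃ p ∈ associatedPrimes R (R ⧸ A), (p : Set R) ↔ ¬ RegMod A x := by
    intro x
    rw [biUnion_associatedPrimes_eq_compl_regular, Set.mem_compl_iff, Set.mem_ofPred_eq,
      isSMulRegular_quotient_iff_mem_of_smul_mem]
    simp only [RegMod, smul_eq_mul, mul_comm]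
  refine ⟨associatedPrimes R (R ⧸ A), associatedPrimes.finite R (R ⧸ A), fun p hp => ?_,
    fun x hx => by simpa using (key x).2 hx⟩
  have hprime := hp.isPrime
  obtain ⟨-, y, rfl⟩ := isAssociatedPrime_iff.1 hp
  obtain ⟨y, rfl⟩ := Ideal.Quotient.mk_surjective y
  have hmem : ∀ a, a ∈ Submodule.colon (⊥ : Submodule R (R ⧸ A)) {Ideal.Quotient.mk A y} ↔
      y * a ∈ A := by
    intro a
    rw [Submodule.mem_colon_singleton, Submodule.mem_bot, ← Ideal.Quotient.mk_eq_mk,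
      ← Submodule.Quotient.mk_smul, Submodule.Quotient.mk_eq_zero, smul_eq_mul, mul_comm]
  refine ⟨hprime, fun a ha => (hmem a).2 (A.mul_mem_left _ ha), y, fun hy => ?_,
    fun g hg => (hmem g).1 hg⟩
  exact hprime.ne_top ((Ideal.eq_top_iff_one _).2 ((hmem 1).2 (A.mul_mem_right _ hy)))

/-- If `J` consists of zero divisors modulo `A`, then it annihilates, modulo `A`, some element
outside `A`. -/
lemma exists_annihilated_of_forall_not_regMod [IsNoetherianRing R] {J A : Ideal R}
    (h : ∀ x ∈ J, ¬ RegMod A x) : ∃ m ∉ A, ∀ g ∈ J, m * g ∈ A := by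
  obtain ⟨T, hT, hTp, hTc⟩ := exists_finite_primes_cover_zeroDivisors A
  obtain ⟨p, hp, hJp⟩ := (Ideal.subset_union_prime_finite (f := id) hT ⊥ ⊥
    (fun p hp _ _ => (hTp p hp).1) (I := J)).1
    (fun z hz => by simpa using hTc z (h z hz))
  obtain ⟨-, -, m, hm, hmp⟩ := hTp p hp
  exact ⟨m, hm, fun g hg => hmp g (hJp hg)⟩

/-- Three instances of "`J` contains a regular element" have a common witness. -/
lemma exists_common_regMod [IsNoetherianRing R] {J A B C : Ideal R}
    (hA : ∃ x ∈ J, RegMod A x) (hB : ∃ x ∈ J, RegMod B x) (hC : ∃ x ∈ J, RegMod C x) :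
    ∃ z ∈ J, RegMod A z ∧ RegMod B z ∧ RegMod C z := by
  obtain ⟨S, hS, hSp, hSc⟩ := exists_finite_primes_cover_zeroDivisors A
  obtain ⟨T, hT, hTp, hTc⟩ := exists_finite_primes_cover_zeroDivisors B
  obtain ⟨U, hU, hUp, hUc⟩ := exists_finite_primes_cover_zeroDivisors C
  by_contra! hcon
  have hsub : (J : Set R) ⊆ ⋃ p ∈ S ∪ T ∪ U, ((id p : Ideal R) : Set R) := by
    intro z hz
    simp only [Set.mem_iUnion, id, exists_prop]
    by_cases h1 : RegMod A z
    · by_cases h2 : RegMod B z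
      · obtain ⟨p, hp, hzp⟩ := hUc z (hcon z hz h1 h2)
        exact ⟨p, Or.inr hp, hzp⟩
      · obtain ⟨p, hp, hzp⟩ := hTc z h2
        exact ⟨p, Or.inl (Or.inr hp), hzp⟩
    · obtain ⟨p, hp, hzp⟩ := hSc z h1
      exact ⟨p, Or.inl (Or.inl hp), hzp⟩
  obtain ⟨p, hp, hJp⟩ := (Ideal.subset_union_prime_finite ((hS.union hT).union hU) ⊥ ⊥
    (fun p hp _ _ => by
      rcases hp with (hp | hp) | hp
      exacts [(hSp p hp).1, (hTp p hp).1, (hUp p hp).1])).1 hsub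
  rcases hp with (hp | hp) | hp
  · obtain ⟨x, hx, hr⟩ := hA
    obtain ⟨-, -, m, hm, hmp⟩ := hSp p hp
    exact hm (hr m (hmp x (hJp hx)))
  · obtain ⟨x, hx, hr⟩ := hB
    obtain ⟨-, -, m, hm, hmp⟩ := hTp p hp
    exact hm (hr m (hmp x (hJp hx)))
  · obtain ⟨x, hx, hr⟩ := hC
    obtain ⟨-, -, m, hm, hmp⟩ := hUp p hp
    exact hm (hr m (hmp x (hJp hx)))

/-- Dividing by any regular element of `J` lowers the length of regular sequences in `J` by at
most one. -/
lemma HasRegSeqMod.sup_span_singleton [IsNoetherianRing R] {J : Ideal R} {s : ℕ} {A : Ideal R}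
    (h : HasRegSeqMod J (s + 1) A) {y : R} (hyJ : y ∈ J) (hy : RegMod A y) :
    HasRegSeqMod J s (A ⊔ Ideal.span {y}) := by
  induction s generalizing A y with
  | zero => trivial
  | succ s ih =>
    obtain ⟨x, hxJ, hx, hs⟩ := h
    obtain ⟨w, hwJ, hw, -⟩ := id hs
    have hregy : ∃ w ∈ J, RegMod (A ⊔ Ideal.span {y}) w := by
      by_contra! hcon
      obtain ⟨m, hm, hmJ⟩ := exists_annihilated_of_forall_not_regMod hcon
      obtain ⟨c, hc⟩ := mem_sup_span_singleton_iff.1 (hmJ x hxJ)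
      obtain ⟨d, hd⟩ := mem_sup_span_singleton_iff.1 (hmJ w hwJ)
      have hcx : c ∈ A ⊔ Ideal.span {x} := by
        refine hw c (mem_sup_span_singleton_iff.2 ⟨d, hy _ ?_⟩)
        convert A.sub_mem (A.mul_mem_right x hd) (A.mul_mem_right w hc) using 1
        ring
      obtain ⟨e, he⟩ := mem_sup_span_singleton_iff.1 hcx
      refine hm (mem_sup_span_singleton_iff.2 ⟨e, hx _ ?_⟩)
      convert A.add_mem hc (A.mul_mem_right y he) using 1
      ring
    obtain ⟨z, hzJ, hz, hzx, hzy⟩ := exists_common_regMod ⟨x, hxJ, hx⟩ ⟨w, hwJ, hw⟩ hregy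
    have hx' := hx.swap hzx
    have hy' := hy.swap hzy
    have h1 : HasRegSeqMod J (s + 1) (A ⊔ Ideal.span {z}) :=
      ⟨x, hxJ, hx', by rw [sup_right_comm]; exact ih hs hzJ hzx⟩
    exact ⟨z, hzJ, hzy, by rw [sup_right_comm]; exact ih h1 hyJ hy'⟩

/-- The ideal generated by the terms of `f` of index less than `k`. -/
def initialIdeal {r : ℕ} (f : Fin r → R) (k : ℕ) : Ideal R :=
  Ideal.span (f '' {j | (j : ℕ) < k})

lemma initialIdeal_zero {r : ℕ} (f : Fin r → R) : initialIdeal f 0 = ⊥ := by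
  simp [initialIdeal]

lemma initialIdeal_succ {r : ℕ} (f : Fin r → R) (i : Fin r) :
    initialIdeal f (i + 1) = initialIdeal f i ⊔ Ideal.span {f i} := by
  have h : {j : Fin r | (j : ℕ) < i + 1} = {j : Fin r | (j : ℕ) < i} ∪ {i} := by
    ext j
    simp only [Set.mem_ofPred_eq, Set.mem_union, Set.mem_singleton_iff, Fin.ext_iff]
    omega
  rw [initialIdeal, h, Set.image_union, Ideal.span_union, Set.image_singleton, initialIdeal]

lemma initialIdeal_congr {r : ℕ} {f g : Fin r → R} {k : ℕ}
    (h : ∀ j : Fin r, (j : ℕ) < k → f j = g j) : initialIdeal f k = initialIdeal g k := by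
  exact congrArg Ideal.span (Set.image_congr h)

lemma hasRegSeqMod_initialIdeal {r : ℕ} {f : Fin r → R} {J : Ideal R} (s i : ℕ) (hr : i + s ≤ r)
    (hf : ∀ j : Fin r, (j : ℕ) < i + s → f j ∈ J ∧ RegMod (initialIdeal f j) (f j)) :
    HasRegSeqMod J s (initialIdeal f i) := by
  induction s generalizing i with
  | zero => trivial
  | succ s ih =>
    obtain ⟨hJ, hreg⟩ := hf ⟨i, by omega⟩ (by simp)
    refine ⟨_, hJ, hreg, ?_⟩
    have h := ih (i + 1) (by omega) fun j hj => hf j (by omega)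
    rwa [initialIdeal_succ f ⟨i, by omega⟩] at h

lemma HasRegSeqMod.initialIdeal [IsNoetherianRing R] {r : ℕ} {g : Fin r → R} {J : Ideal R}
    (s k : ℕ) (hr : k ≤ r) (h : HasRegSeqMod J (s + k) ⊥)
    (hg : ∀ j : Fin r, (j : ℕ) < k → g j ∈ J ∧ RegMod (initialIdeal g j) (g j)) :
    HasRegSeqMod J s (initialIdeal g k) := by
  induction k generalizing s with
  | zero => rwa [initialIdeal_zero]
  | succ k ih =>
    have hk := hg ⟨k, by omega⟩ (by simp)
    rw [initialIdeal_succ g ⟨k, by omega⟩]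
    exact (ih (s + 1) (by omega) (by convert h using 1; omega)
      fun j hj => hg j (by omega)).sup_span_singleton hk.1 hk.2

end RegularElements

lemma isRegSeq_iff {K : Type*} [Field K] {n r : ℕ} {f : Fin r → MvPolynomial (Fin n) K} :
    IsRegSeq f ↔ ∀ i : Fin r, RegMod (initialIdeal f i) (f i) := by
  have h : ∀ i : Fin r, {p | ∃ j : Fin r, j < i ∧ p = f j} = f '' {j | (j : ℕ) < i} := by
    intro i
    ext p
    exact exists_congr fun j => and_congr Iff.rfl eq_comm
  simp only [IsRegSeq, RegMod, initialIdeal, h]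

lemma regMod_initialIdeal_X {K : Type*} [Field K] {n : ℕ} (i : Fin n) :
    RegMod (initialIdeal (X : Fin n → MvPolynomial (Fin n) K) i) (X i) := by
  intro g hg
  rw [initialIdeal, mem_ideal_span_X_image] at hg ⊢
  intro m hm
  obtain ⟨j, hj, hmj⟩ := hg (m + Finsupp.single i 1) (by
    rw [mem_support_iff, coeff_mul_X]
    exact mem_support_iff.1 hm)
  refine ⟨j, hj, ?_⟩
  have hij : i ≠ j := by
    rintro rfl
    exact lt_irrefl (i : ℕ) hj
  simpa [Finsupp.single_apply, hij] using hmj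

/-- Vector space prime avoidance: a subspace of a ring consisting of elements that lie in one of
finitely many ideals lies in one of these ideals. -/
lemma exists_subspace_le_of_subset_biUnion {K E : Type*} [Field K] [Infinite K] [CommRing E]
    [Algebra K E] {T : Set (Ideal E)} (hT : T.Finite) (W : Submodule K E)
    (h : ∀ w ∈ W, ∃ p ∈ T, w ∈ p) : ∃ p ∈ T, ∀ w ∈ W, w ∈ p := by
  have := hT.to_subtype
  obtain ⟨p, hp⟩ := Subspace.exists_eq_top_of_iUnion_eq_univ (k := K) (E := W)
    (p := fun p : T => ((p : Ideal E).restrictScalars K).comap W.subtype) (by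
      refine Set.eq_univ_of_forall fun w => ?_
      obtain ⟨p, hp, hw⟩ := h w w.2
      exact Set.mem_iUnion.2 ⟨⟨p, hp⟩, hw⟩)
  refine ⟨p, p.2, fun w hw => ?_⟩
  have hmem : (⟨w, hw⟩ : W) ∈ ((p : Ideal E).restrictScalars K).comap W.subtype :=
    hp ▸ Submodule.mem_top
  exact hmem

/-- A homogeneous regular sequence in `I` of length `k` extends by an element of `I` of degree
`d`, as soon as `I` contains a regular sequence of length `k + 1` of elements of degrees at most
`d`. -/
lemma exists_homogeneous_regMod {K : Type*} [Field K] [Infinite K] {n r : ℕ} (hrn : r ≤ n)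
    {a : Fin r → ℕ} {I : Ideal (MvPolynomial (Fin n) K)} {f g : Fin r → MvPolynomial (Fin n) K}
    (hfI : ∀ i, f i ∈ I) (hfreg : ∀ i : Fin r, RegMod (initialIdeal f i) (f i))
    (hfa : ∀ i, (f i).IsHomogeneous (a i)) (i : Fin r) {d : ℕ} (hd : ∀ j ≤ i, a j ≤ d)
    (hg : ∀ j < i, RegMod (initialIdeal g j) (g j)) :
    ∃ x ∈ I, x.IsHomogeneous d ∧ RegMod (initialIdeal g i) x := by
  obtain ⟨T, hT, hTp, hTc⟩ := exists_finite_primes_cover_zeroDivisors (initialIdeal g i)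
  by_contra! hcon
  obtain ⟨p, hp, hWp⟩ := exists_subspace_le_of_subset_biUnion hT (component I d)
    fun w hw => hTc w (hcon w hw.1 hw.2)
  obtain ⟨hprime, hle, m, hm, hmp⟩ := hTp p hp
  have hlong : HasRegSeqMod p (1 + i) ⊥ := by
    by_cases hfp : ∀ j ≤ i, f j ∈ p
    · rw [← initialIdeal_zero f]
      exact hasRegSeqMod_initialIdeal _ _ (by omega) fun j hj =>
        ⟨hfp j (Fin.le_def.2 (by omega)), hfreg j⟩
    · push Not at hfp
      obtain ⟨j, hji, hj⟩ := hfp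
      rw [← initialIdeal_zero (X : Fin n → MvPolynomial (Fin n) K)]
      refine hasRegSeqMod_initialIdeal _ _ (by omega) fun k _ => ⟨?_, regMod_initialIdeal_X k⟩
      have hmem : f j * X k ^ (d - a j) ∈ p := by
        refine hWp _ ⟨I.mul_mem_right _ (hfI j), ?_⟩
        have h := (hfa j).mul ((isHomogeneous_X K k).pow (d - a j))
        have he : a j + 1 * (d - a j) = d := by have := hd j hji; omega
        rw [he] at h
        exact h
      exact hprime.mem_of_pow_mem _ ((hprime.mem_or_mem hmem).resolve_left hj)
  obtain ⟨x, hx, hreg, -⟩ := hlong.initialIdeal 1 i i.2.le fun j hj =>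
    ⟨hle (Ideal.subset_span ⟨j, hj, rfl⟩), hg j hj⟩
  exact hm (hreg m (hmp x hx))


/-- Over an infinite field, a homogeneous ideal containing a homogeneous regular sequence
of degree `a` contains a homogeneous regular sequence of any larger degree `b ≥ a`. -/
theorem contains_regseq_of_higher_degree {K : Type*} [Field K] [Infinite K] {n r : ℕ}
    (hrn : r ≤ n) (a b : Fin r → ℕ) (hapos : ∀ i, 0 < a i) (hamono : Monotone a)
    (hbpos : ∀ i, 0 < b i) (hbmono : Monotone b) (hab : ∀ i, a i ≤ b i)
    (I : Ideal (MvPolynomial (Fin n) K)) (hI : IsHomog I)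
    (hreg : ContainsRegSeq a I) : ContainsRegSeq b I := by
  obtain ⟨f, hfI, hfreg, hfa⟩ := hreg
  rw [isRegSeq_iff] at hfreg
  have key : ∀ k ≤ r, ∃ g : Fin r → MvPolynomial (Fin n) K, ∀ i : Fin r, (i : ℕ) < k →
      g i ∈ I ∧ (g i).IsHomogeneous (b i) ∧ RegMod (initialIdeal g i) (g i) := by
    intro k hk
    induction k with
    | zero => exact ⟨0, fun i hi => absurd hi (by omega)⟩
    | succ k ih =>
      obtain ⟨g, hg⟩ := ih (by omega)
      obtain ⟨x, hxI, hxb, hx⟩ := exists_homogeneous_regMod (d := b ⟨k, hk⟩) hrn hfI hfreg hfa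
        ⟨k, hk⟩ (fun j hj => (hab j).trans (hbmono hj)) (fun j hj => (hg j hj).2.2)
      have hne : ∀ j : Fin r, (j : ℕ) < k → Function.update g ⟨k, hk⟩ x j = g j := fun j hj =>
        Function.update_of_ne (fun h => by simp [h] at hj) _ _
      refine ⟨Function.update g ⟨k, hk⟩ x, fun i hi => ?_⟩
      rw [initialIdeal_congr fun j hj => hne j (by omega)]
      rcases Nat.lt_succ_iff_lt_or_eq.1 hi with hi | hi
      · rw [hne i hi]
        exact hg i hi
      · obtain rfl : i = ⟨k, hk⟩ := Fin.ext hi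
        rw [Function.update_self]
        exact ⟨hxI, hxb, hx⟩
  obtain ⟨g, hg⟩ := key r le_rfl
  exact ⟨g, fun i => (hg i i.2).1, isRegSeq_iff.2 fun i => (hg i i.2).2.2, fun i => (hg i i.2).2.1⟩
end

section
/- (Chong) Let f ⊆ A = K[x_1,…,x_n] be an ideal generated by a homogeneous regular sequence of degree a = (a_1,…,a_n), and let I ⊇ f be a homogeneous ideal. Suppose b = (b_1,…,b_n) is a degree sequence with b_i ≤ a_i for all i, and that the link I^ℓ = (f :_A I) satisfies EGH_b. Then I satisfies EGH_a. -/
open MvPolynomial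

namespace LexPlusPowers

section Combinatorics

variable {n : ℕ}

/-- The exponent vectors of degree `e` lying strictly below `a` in every coordinate. -/
def box (a : Fin n → ℕ) (e : ℕ) : Finset (Fin n → ℕ) :=
  (Fintype.piFinset fun i => Finset.range (a i)).filter fun m => ∑ i, m i = e

lemma mem_box {a : Fin n → ℕ} {e : ℕ} {m : Fin n → ℕ} :
    m ∈ box a e ↔ (∀ i, m i < a i) ∧ ∑ i, m i = e := by
  simp [box]

/-- `C` is a lexicographically upward closed subset of `B`. -/
def IsInitial (B C : Finset (Fin n → ℕ)) : Prop :=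
  C ⊆ B ∧ ∀ m ∈ C, ∀ m' ∈ B, toLex m < toLex m' → m' ∈ C

/-- Every product of a monomial of `T` with a variable which stays below `a` lies in `T'`. -/
def UpClosed (a : Fin n → ℕ) (T T' : Finset (Fin n → ℕ)) : Prop :=
  ∀ m ∈ T, ∀ i, m i + 1 < a i → m + Pi.single i 1 ∈ T'

/-- The products of monomials of `T` with variables which stay below `a`. -/
def upShadow (a : Fin n → ℕ) (T : Finset (Fin n → ℕ)) : Finset (Fin n → ℕ) :=
  T.biUnion fun m => (Finset.univ.filter fun i => m i + 1 < a i).image fun i => m + Pi.single i 1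

lemma mem_upShadow {a : Fin n → ℕ} {T : Finset (Fin n → ℕ)} {m : Fin n → ℕ} :
    m ∈ upShadow a T ↔ ∃ c ∈ T, ∃ i, c i + 1 < a i ∧ c + Pi.single i 1 = m := by
  simp [upShadow]

lemma upClosed_iff_upShadow_subset {a : Fin n → ℕ} {T T' : Finset (Fin n → ℕ)} :
    UpClosed a T T' ↔ upShadow a T ⊆ T' := by
  constructor
  · intro h m hm
    obtain ⟨c, hc, i, hi, rfl⟩ := mem_upShadow.1 hm
    exact h c hc i hi
  · intro h m hm i hi
    exact h (mem_upShadow.2 ⟨m, hm, i, hi, rfl⟩)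

lemma lex_lt_iff {m m' : Fin n → ℕ} :
    toLex m < toLex m' ↔ ∃ i, (∀ j < i, m j = m' j) ∧ m i < m' i := Iff.rfl

lemma lex_lt_or_lt {m m' : Fin n → ℕ} (h : m ≠ m') :
    toLex m < toLex m' ∨ toLex m' < toLex m :=
  lt_or_gt_of_ne fun h' => h (toLex.injective h')

lemma sum_add_single (m : Fin n → ℕ) (i : Fin n) :
    ∑ j, (m + (Pi.single i 1 : Fin n → ℕ)) j = ∑ j, m j + 1 := by
  simp [Finset.sum_add_distrib]

lemma add_single_mem_box {a : Fin n → ℕ} {e : ℕ} {m : Fin n → ℕ} (hm : m ∈ box a e) {i : Fin n}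
    (hi : m i + 1 < a i) : m + Pi.single i 1 ∈ box a (e + 1) := by
  rw [mem_box] at hm ⊢
  refine ⟨fun j => ?_, by rw [sum_add_single, hm.2]⟩
  rcases eq_or_ne j i with rfl | hj
  · simpa using hi
  · simpa [Pi.single_eq_of_ne hj] using hm.1 j

lemma exists_add_single {m : Fin n → ℕ} {i : Fin n} (h : 0 < m i) :
    ∃ c : Fin n → ℕ, c + Pi.single i 1 = m := by
  refine ⟨m - Pi.single i 1, ?_⟩
  ext j
  rcases eq_or_ne j i with rfl | hj
  · simp; omega
  · simp [Pi.single_eq_of_ne hj]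

lemma mem_box_of_add_single {a : Fin n → ℕ} {e : ℕ} {m : Fin n → ℕ} {i : Fin n}
    (h : m + Pi.single i 1 ∈ box a (e + 1)) : m ∈ box a e := by
  rw [mem_box, sum_add_single] at h
  rw [mem_box]
  refine ⟨fun j => lt_of_le_of_lt ?_ (h.1 j), by omega⟩
  simp

lemma lt_of_add_single_mem_box {a : Fin n → ℕ} {e : ℕ} {m : Fin n → ℕ} {i : Fin n}
    (h : m + Pi.single i 1 ∈ box a e) : m i + 1 < a i := by
  simpa using (mem_box.1 h).1 i

lemma upShadow_subset_box {a : Fin n → ℕ} {e : ℕ} {T : Finset (Fin n → ℕ)} (hT : T ⊆ box a e) :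
    upShadow a T ⊆ box a (e + 1) := by
  intro m hm
  obtain ⟨c, hc, i, hi, rfl⟩ := mem_upShadow.1 hm
  exact add_single_mem_box (hT hc) hi

lemma exists_isInitial (B : Finset (Fin n → ℕ)) {t : ℕ} (ht : t ≤ B.card) :
    ∃ C, IsInitial B C ∧ C.card = t := by
  induction t with
  | zero => exact ⟨∅, ⟨by simp, by simp⟩, rfl⟩
  | succ t ih =>
    obtain ⟨C, hC, hCt⟩ := ih (by omega)
    have hne : (B \ C).Nonempty := by
      rw [← Finset.card_pos, Finset.card_sdiff_of_subset hC.1]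
      omega
    obtain ⟨x, hx, hmax⟩ := (B \ C).exists_max_image toLex hne
    rw [Finset.mem_sdiff] at hx
    refine ⟨insert x C, ⟨Finset.insert_subset hx.1 hC.1, ?_⟩, by
      rw [Finset.card_insert_of_notMem hx.2, hCt]⟩
    intro m hm m' hm' hlt
    rw [Finset.mem_insert] at hm ⊢
    by_contra! hcon
    have hle := hmax m' (Finset.mem_sdiff.2 ⟨hm', hcon.2⟩)
    rcases hm with rfl | hm
    · exact absurd hlt (not_lt.2 hle)
    · exact hcon.2 (hC.2 m hm m' hm' hlt)

lemma IsInitial.subset_of_card_le {B C D : Finset (Fin n → ℕ)} (hC : IsInitial B C)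
    (hD : IsInitial B D) (h : C.card ≤ D.card) : C ⊆ D := by
  by_contra hCD
  obtain ⟨x, hx, hxD⟩ := Finset.not_subset.1 hCD
  have hDC : D ⊆ C := by
    intro y hy
    have hne : y ≠ x := by rintro rfl; exact hxD hy
    rcases lex_lt_or_lt hne with hlt | hlt
    · exact absurd (hD.2 y hy x (hC.1 hx) hlt) hxD
    · exact hC.2 x hx y (hD.1 hy) hlt
  exact hCD (Finset.eq_of_subset_of_card_le hDC h).symm.subset

lemma IsInitial.sum_le {B C S : Finset (Fin n → ℕ)} (hC : IsInitial B C) (hS : S ⊆ B)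
    (hcard : S.card = C.card) {w : (Fin n → ℕ) → ℕ}
    (hw : ∀ m ∈ B, ∀ m' ∈ B, toLex m < toLex m' → w m < w m') :
    ∑ m ∈ S, w m ≤ ∑ m ∈ C, w m ∧ (S ≠ C → ∑ m ∈ S, w m < ∑ m ∈ C, w m) := by
  suffices h : S ≠ C → ∑ m ∈ S, w m < ∑ m ∈ C, w m by
    refine ⟨?_, h⟩
    by_cases hSC : S = C
    · rw [hSC]
    · exact (h hSC).le
  intro hne
  have hcard' : (S \ C).card = (C \ S).card := by
    have h1 := Finset.card_sdiff_add_card_inter S C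
    have h2 := Finset.card_sdiff_add_card_inter C S
    rw [Finset.inter_comm C S] at h2
    omega
  have hpos : 0 < (S \ C).card := by
    rw [Finset.card_pos, Finset.sdiff_nonempty]
    exact fun h => hne (Finset.eq_of_subset_of_card_le h hcard.ge)
  obtain ⟨x, hx, hmax⟩ := (S \ C).exists_max_image w (Finset.card_pos.1 hpos)
  rw [Finset.mem_sdiff] at hx
  have h1 : ∑ m ∈ S \ C, w m ≤ (S \ C).card • w x := Finset.sum_le_card_nsmul _ _ _ hmax
  have h2 : (C \ S).card • (w x + 1) ≤ ∑ m ∈ C \ S, w m := by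
    refine Finset.card_nsmul_le_sum _ _ _ fun y hy => ?_
    rw [Finset.mem_sdiff] at hy
    have hxy : x ≠ y := by rintro rfl; exact hy.2 hx.1
    rcases lex_lt_or_lt hxy with hlt | hlt
    · exact hw x (hS hx.1) y (hC.1 hy.1) hlt
    · exact absurd (hC.2 y hy.1 x (hS hx.1) hlt) hx.2
  have h3 := Finset.sum_inter_add_sum_sdiff S C w
  have h4 := Finset.sum_inter_add_sum_sdiff C S w
  rw [Finset.inter_comm C S] at h4
  simp only [smul_eq_mul] at h1 h2
  rw [← hcard'] at h2
  rw [← h3, ← h4]; nlinarith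

lemma lt_add_single_of_lt {c : Fin n → ℕ} {i k : Fin n} (h : i < k) :
    toLex (c + Pi.single k 1) < toLex (c + Pi.single i 1) := by
  refine lex_lt_iff.2 ⟨i, fun j hj => ?_, ?_⟩
  · simp [Pi.single_eq_of_ne hj.ne, Pi.single_eq_of_ne (hj.trans h).ne]
  · simp [Pi.single_eq_of_ne h.ne]

/-- The products of an initial segment with the variables form an initial segment. -/
lemma IsInitial.upShadow {a : Fin n → ℕ} {e : ℕ} {C : Finset (Fin n → ℕ)}
    (hC : IsInitial (box a e) C) : IsInitial (box a (e + 1)) (upShadow a C) := by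
  refine ⟨upShadow_subset_box hC.1, fun m hm m' hm' hlt => ?_⟩
  obtain ⟨c, hc, i, hi, rfl⟩ := mem_upShadow.1 hm
  have hne : (Finset.univ.filter fun k => 0 < m' k).Nonempty := by
    by_contra hcon
    rw [Finset.not_nonempty_iff_eq_empty, Finset.filter_eq_empty_iff] at hcon
    have h0 : ∑ k, m' k = 0 := Finset.sum_eq_zero fun k hk => by
      have := hcon hk
      omega
    have := (mem_box.1 hm').2
    omega
  obtain ⟨k, hk, hmax⟩ := Finset.exists_max_image _ id hne
  simp only [Finset.mem_filter, Finset.mem_univ, true_and, id] at hk hmax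
  obtain ⟨c', rfl⟩ := exists_add_single hk
  have hc' := mem_box_of_add_single hm'
  refine mem_upShadow.2 ⟨c', ?_, k, lt_of_add_single_mem_box hm', rfl⟩
  by_contra hcon
  have hne' : c' ≠ c := by rintro rfl; exact hcon hc
  have hlt' : toLex c' < toLex c := by
    rcases lex_lt_or_lt hne' with h | h
    · exact h
    · exact absurd (hC.2 c hc c' hc' h) hcon
  obtain ⟨l, hl, hll⟩ := lex_lt_iff.1 hlt
  obtain ⟨p, hp, hpp⟩ := lex_lt_iff.1 hlt'
  have hlk : l ≤ k := hmax l (by omega)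
  have hval : ∀ j, j ≠ k → (c' + (Pi.single k 1 : Fin n → ℕ)) j = c' j := fun j hj => by
    simp [Pi.single_eq_of_ne hj]
  have hmono : ∀ j, c j ≤ (c + (Pi.single i 1 : Fin n → ℕ)) j := fun j => by simp
  -- the first difference lies after `k`, where the smaller vector vanishes
  have hge : ∀ j ≤ l, c j ≤ c' j := by
    intro j hj
    rcases hj.lt_or_eq with hj' | rfl
    · have := hl j hj'
      rw [hval j (hj'.trans_le hlk).ne] at this
      exact this ▸ hmono j
    · rcases eq_or_ne j k with rfl | hjk
      · have := hmono j
        simp only [Pi.add_apply, Pi.single_eq_same] at hll this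
        omega
      · rw [hval j hjk] at hll
        have := hmono j
        omega
  have hlp : l < p := by
    by_contra! hpl
    have := hge p hpl
    omega
  rcases hlk.lt_or_eq with hlk' | rfl
  · have h1 := hp l hlp
    rw [hval l hlk'.ne] at hll
    have := hmono l
    omega
  · have hsum : ∑ j, c' j < ∑ j, c j := by
      refine Finset.sum_lt_sum (fun j _ => ?_) ⟨p, Finset.mem_univ _, hpp⟩
      rcases lt_trichotomy j l with h | h | h
      · exact (hp j (h.trans hlp)).le
      · exact (hp j (h ▸ hlp)).le
      · have : ¬ 0 < (c' + (Pi.single l 1 : Fin n → ℕ)) j := fun h0 => absurd (hmax j h0) (not_le.2 h)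
        rw [hval j h.ne'] at this
        omega
    have h1 := (mem_box.1 hc').2
    have h2 := (mem_box.1 (hC.1 hc)).2
    omega

end Combinatorics
section Combinatorics

variable {n : ℕ}

/-- The part of `T` with `i`-th exponent `j`, with that exponent removed. -/
noncomputable def slice (i : Fin (n + 1)) (j : ℕ) (T : Finset (Fin (n + 1) → ℕ)) :
    Finset (Fin n → ℕ) :=
  T.preimage (fun p => (i.insertNth j p : Fin (n + 1) → ℕ))
    (Fin.insertNth_right_injective (α := fun _ => ℕ) j).injOn

lemma mem_slice {i : Fin (n + 1)} {j : ℕ} {T : Finset (Fin (n + 1) → ℕ)} {p : Fin n → ℕ} :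
    p ∈ slice i j T ↔ (i.insertNth j p : Fin (n + 1) → ℕ) ∈ T := by
  simp [slice]

/-- The set with prescribed slices `S j`, for `j < k`. -/
def glue (i : Fin (n + 1)) (k : ℕ) (S : ℕ → Finset (Fin n → ℕ)) : Finset (Fin (n + 1) → ℕ) :=
  (Finset.range k).biUnion fun j => (S j).image fun p => (i.insertNth j p : Fin (n + 1) → ℕ)

lemma insertNth_eq_iff {i : Fin (n + 1)} {j j' : ℕ} {p p' : Fin n → ℕ} :
    (i.insertNth j p : Fin (n + 1) → ℕ) = i.insertNth j' p' ↔ j = j' ∧ p = p' :=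
  Fin.insertNth_inj (α := fun _ => ℕ)

lemma exists_eq_insertNth (i : Fin (n + 1)) (m : Fin (n + 1) → ℕ) :
    ∃ p : Fin n → ℕ, m = i.insertNth (m i) p :=
  ⟨i.removeNth m, (Fin.insertNth_self_removeNth i m).symm⟩

lemma insertNth_mem_glue {i : Fin (n + 1)} {k j : ℕ} {S : ℕ → Finset (Fin n → ℕ)}
    {p : Fin n → ℕ} : (i.insertNth j p : Fin (n + 1) → ℕ) ∈ glue i k S ↔ j < k ∧ p ∈ S j := by
  simp only [glue, Finset.mem_biUnion, Finset.mem_image, Finset.mem_range, insertNth_eq_iff]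
  constructor
  · rintro ⟨j', hj', p', hp', rfl, rfl⟩
    exact ⟨hj', hp'⟩
  · rintro ⟨hj, hp⟩
    exact ⟨j, hj, p, hp, rfl, rfl⟩

lemma sum_glue (i : Fin (n + 1)) (k : ℕ) (S : ℕ → Finset (Fin n → ℕ))
    (w : (Fin (n + 1) → ℕ) → ℕ) :
    ∑ m ∈ glue i k S, w m = ∑ j ∈ Finset.range k, ∑ p ∈ S j, w (i.insertNth j p) := by
  rw [glue, Finset.sum_biUnion]
  · refine Finset.sum_congr rfl fun j _ => Finset.sum_image fun p _ p' _ h => ?_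
    exact (insertNth_eq_iff.1 h).2
  · intro j _ j' _ hne
    rw [Function.onFun, Finset.disjoint_left]
    intro m hm hm'
    obtain ⟨p, _, rfl⟩ := Finset.mem_image.1 hm
    obtain ⟨p', _, h⟩ := Finset.mem_image.1 hm'
    exact hne (insertNth_eq_iff.1 h).1.symm

lemma card_glue (i : Fin (n + 1)) (k : ℕ) (S : ℕ → Finset (Fin n → ℕ)) :
    (glue i k S).card = ∑ j ∈ Finset.range k, (S j).card := by
  simp only [Finset.card_eq_sum_ones, sum_glue]

lemma insertNth_mem_box {a : Fin (n + 1) → ℕ} {e : ℕ} {i : Fin (n + 1)} {j : ℕ}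
    {p : Fin n → ℕ} : (i.insertNth j p : Fin (n + 1) → ℕ) ∈ box a e ↔
      j < a i ∧ j ≤ e ∧ p ∈ box (a ∘ i.succAbove) (e - j) := by
  rw [mem_box, mem_box, Fin.sum_univ_succAbove _ i, Fin.forall_iff_succAbove i]
  simp only [Fin.insertNth_apply_same, Fin.insertNth_apply_succAbove, Function.comp]
  constructor
  · rintro ⟨⟨h1, h2⟩, h3⟩
    exact ⟨h1, by omega, h2, by omega⟩
  · rintro ⟨h1, h2, h3, h4⟩
    exact ⟨⟨h1, h3⟩, by omega⟩

lemma glue_slice {a : Fin (n + 1) → ℕ} {e : ℕ} {T : Finset (Fin (n + 1) → ℕ)}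
    (hT : T ⊆ box a e) (i : Fin (n + 1)) : glue i (a i) (fun j => slice i j T) = T := by
  ext m
  obtain ⟨p, hp⟩ := exists_eq_insertNth i m
  rw [hp, insertNth_mem_glue, mem_slice, ← hp, and_iff_right_iff_imp]
  exact fun hm => (mem_box.1 (hT hm)).1 i

lemma slice_subset_box {a : Fin (n + 1) → ℕ} {e : ℕ} {T : Finset (Fin (n + 1) → ℕ)}
    (hT : T ⊆ box a e) (i : Fin (n + 1)) (j : ℕ) :
    slice i j T ⊆ box (a ∘ i.succAbove) (e - j) := fun _ hp =>
  (insertNth_mem_box.1 (hT (mem_slice.1 hp))).2.2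

lemma slice_eq_empty {a : Fin (n + 1) → ℕ} {e : ℕ} {T : Finset (Fin (n + 1) → ℕ)}
    (hT : T ⊆ box a e) (i : Fin (n + 1)) {j : ℕ} (hj : e < j) : slice i j T = ∅ := by
  rw [Finset.eq_empty_iff_forall_notMem]
  exact fun p hp => absurd (insertNth_mem_box.1 (hT (mem_slice.1 hp))).2.1 (not_le.2 hj)

lemma insertNth_lex_lt {i : Fin (n + 1)} {j : ℕ} {p p' : Fin n → ℕ} (h : toLex p < toLex p') :
    toLex (i.insertNth j p : Fin (n + 1) → ℕ) < toLex (i.insertNth j p' : Fin (n + 1) → ℕ) := by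
  obtain ⟨l, hl, hll⟩ := lex_lt_iff.1 h
  refine lex_lt_iff.2 ⟨i.succAbove l, fun k hk => ?_, by simpa using hll⟩
  rcases Fin.eq_self_or_eq_succAbove i k with rfl | ⟨q, rfl⟩
  · simp
  · simpa using hl q (by simpa using hk)

lemma insertNth_add_single_same (i : Fin (n + 1)) (j : ℕ) (p : Fin n → ℕ) :
    (i.insertNth j p : Fin (n + 1) → ℕ) + Pi.single i 1 = i.insertNth (j + 1) p := by
  ext k
  rcases Fin.eq_self_or_eq_succAbove i k with rfl | ⟨q, rfl⟩ <;> simp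

lemma insertNth_add_single_succAbove (i : Fin (n + 1)) (j : ℕ) (p : Fin n → ℕ) (l : Fin n) :
    (i.insertNth j p : Fin (n + 1) → ℕ) + Pi.single (i.succAbove l) 1 =
      i.insertNth j (p + Pi.single l 1) := by
  ext k
  rcases Fin.eq_self_or_eq_succAbove i k with rfl | ⟨q, rfl⟩
  · simp
  · simp [Pi.single_apply]

/-- The Clements–Lindström property in `n` variables. -/
def ClementsLindstrom (n : ℕ) : Prop :=
  ∀ (a : Fin n → ℕ) (e : ℕ) (T T' C C' : Finset (Fin n → ℕ)), Monotone a →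
    T ⊆ box a e → T' ⊆ box a (e + 1) → UpClosed a T T' →
    IsInitial (box a e) C → IsInitial (box a (e + 1)) C' →
    C.card = T.card → C'.card = T'.card → UpClosed a C C'

/-- The slices of `T` in direction `i` are initial segments. -/
def CompressedAt (i : Fin n) (B T : Finset (Fin n → ℕ)) : Prop :=
  ∀ m ∈ T, ∀ m' ∈ B, m i = m' i → toLex m < toLex m' → m' ∈ T

lemma exists_compression (ih : ClementsLindstrom n) {a : Fin (n + 1) → ℕ} (ha : Monotone a)
    {e : ℕ} (i : Fin (n + 1)) {T T' : Finset (Fin (n + 1) → ℕ)} (hT : T ⊆ box a e)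
    (hT' : T' ⊆ box a (e + 1)) (hTT' : UpClosed a T T') {w : (Fin (n + 1) → ℕ) → ℕ}
    (hw : ∀ m ∈ box a e, ∀ m' ∈ box a e, toLex m < toLex m' → w m < w m') :
    CompressedAt i (box a e) T ∨
    ∃ S S', S ⊆ box a e ∧ S' ⊆ box a (e + 1) ∧ UpClosed a S S' ∧ S.card = T.card ∧
      S'.card = T'.card ∧ ∑ m ∈ T, w m < ∑ m ∈ S, w m := by
  set a' := a ∘ i.succAbove with ha'
  have key : ∀ j, ∃ S, IsInitial (box a' (e - j)) S ∧ S.card = (slice i j T).card := fun j =>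
    exists_isInitial _ (Finset.card_le_card (slice_subset_box hT i j))
  have key' : ∀ j, ∃ S, IsInitial (box a' (e + 1 - j)) S ∧ S.card = (slice i j T').card := fun j =>
    exists_isInitial _ (Finset.card_le_card (slice_subset_box hT' i j))
  choose S hS hSc using key
  choose S' hS' hSc' using key'
  have hlt : ∀ {j p}, p ∈ S j → j ≤ e := by
    intro j p hp
    by_contra! hcon
    have := hSc j
    rw [slice_eq_empty hT i hcon, Finset.card_empty, Finset.card_eq_zero] at this
    rw [this] at hp
    simp at hp
  have hlt' : ∀ {j p}, p ∈ S' j → j ≤ e + 1 := by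
    intro j p hp
    by_contra! hcon
    have := hSc' j
    rw [slice_eq_empty hT' i hcon, Finset.card_empty, Finset.card_eq_zero] at this
    rw [this] at hp
    simp at hp
  by_cases hcomp : ∀ j < a i, slice i j T = S j
  · left
    intro m hm m' hm' hmm' hlex
    obtain ⟨p, hp⟩ := exists_eq_insertNth i m
    obtain ⟨p', hp'⟩ := exists_eq_insertNth i m'
    rw [← hmm'] at hp'
    have hj : m i < a i := (mem_box.1 (hT hm)).1 i
    generalize m i = j at *
    subst hp hp'
    have hpp : toLex p < toLex p' := by
      have hne : p ≠ p' := by rintro rfl; exact lt_irrefl _ hlex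
      rcases lex_lt_or_lt hne with h | h
      · exact h
      · exact absurd hlex (insertNth_lex_lt h).asymm
    rw [← mem_slice, hcomp _ hj] at hm ⊢
    exact (hS j).2 p hm p' (insertNth_mem_box.1 hm').2.2 hpp
  · right
    push Not at hcomp
    obtain ⟨j₀, hj₀, hne⟩ := hcomp
    refine ⟨glue i (a i) S, glue i (a i) S', ?_, ?_, ?_, ?_, ?_, ?_⟩
    · intro m hm
      obtain ⟨p, hp⟩ := exists_eq_insertNth i m
      rw [hp, insertNth_mem_glue] at hm
      rw [hp, insertNth_mem_box]
      exact ⟨hm.1, hlt hm.2, (hS _).1 hm.2⟩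
    · intro m hm
      obtain ⟨p, hp⟩ := exists_eq_insertNth i m
      rw [hp, insertNth_mem_glue] at hm
      rw [hp, insertNth_mem_box]
      exact ⟨hm.1, hlt' hm.2, (hS' _).1 hm.2⟩
    · intro m hm l hl
      obtain ⟨p, hp⟩ := exists_eq_insertNth i m
      generalize m i = j at hp
      subst hp
      rw [insertNth_mem_glue] at hm
      rcases Fin.eq_self_or_eq_succAbove i l with rfl | ⟨q, rfl⟩
      · rw [Fin.insertNth_apply_same] at hl
        rw [insertNth_add_single_same, insertNth_mem_glue]
        refine ⟨hl, ?_⟩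
        have h' := hS' (j + 1)
        rw [Nat.add_sub_add_right] at h'
        refine (hS j).subset_of_card_le h' ?_ hm.2
        rw [hSc, hSc']
        refine Finset.card_le_card fun q hq => ?_
        rw [mem_slice] at hq ⊢
        rw [← insertNth_add_single_same]
        exact hTT' _ hq l (by simpa using hl)
      · rw [Fin.insertNth_apply_succAbove] at hl
        rw [insertNth_add_single_succAbove, insertNth_mem_glue]
        refine ⟨hm.1, ?_⟩
        have hje := hlt hm.2
        have h' := hS' j
        have hs' := slice_subset_box hT' i j
        rw [Nat.sub_add_comm hje] at h' hs'
        refine ih a' (e - j) (slice i j T) (slice i j T') (S j) (S' j)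
          (fun x y h => ha (i.strictMono_succAbove.monotone h)) (slice_subset_box hT i j)
          hs' ?_ (hS j) h' (hSc j) (hSc' j) p hm.2 q hl
        intro r hr k hk
        rw [mem_slice] at hr ⊢
        rw [← insertNth_add_single_succAbove]
        exact hTT' _ hr _ (by simpa [ha'] using hk)
    · rw [card_glue, ← glue_slice hT i, card_glue]
      exact Finset.sum_congr rfl fun j _ => hSc j
    · rw [card_glue, ← glue_slice hT' i, card_glue]
      exact Finset.sum_congr rfl fun j _ => hSc' j
    · rw [← glue_slice hT i, sum_glue, sum_glue]
      have hsum : ∀ j < a i, ∑ p ∈ slice i j T, w (i.insertNth j p) ≤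
          ∑ p ∈ S j, w (i.insertNth j p) ∧ (slice i j T ≠ S j →
          ∑ p ∈ slice i j T, w (i.insertNth j p) < ∑ p ∈ S j, w (i.insertNth j p)) := by
        intro j hj
        by_cases hje : j ≤ e
        · refine (hS j).sum_le (slice_subset_box hT i j) (hSc j).symm fun p hp p' hp' hpp => ?_
          exact hw _ (insertNth_mem_box.2 ⟨hj, hje, hp⟩) _ (insertNth_mem_box.2 ⟨hj, hje, hp'⟩)
            (insertNth_lex_lt hpp)
        · have h1 := slice_eq_empty hT i (not_le.1 hje)
          have h2 : S j = ∅ := by rw [← Finset.card_eq_zero, hSc, h1, Finset.card_empty]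
          simp [h1, h2]
      exact Finset.sum_lt_sum (fun j hj => (hsum j (Finset.mem_range.1 hj)).1)
        ⟨j₀, Finset.mem_range.2 hj₀, (hsum j₀ hj₀).2 hne⟩

end Combinatorics
section Combinatorics

variable {n : ℕ}

lemma sum_two_eq {a : Fin 2 → ℕ} {e : ℕ} {m : Fin 2 → ℕ} (hm : m ∈ box a e) :
    m 0 + m 1 = e := by
  simpa using (mem_box.1 hm).2

lemma ext_box_two {a : Fin 2 → ℕ} {e : ℕ} {m m' : Fin 2 → ℕ} (hm : m ∈ box a e)
    (hm' : m' ∈ box a e) (h : m 0 = m' 0) : m = m' := by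
  have h1 := sum_two_eq hm
  have h2 := sum_two_eq hm'
  ext i
  fin_cases i
  · exact h
  · change m 1 = m' 1
    omega

/-- If the shadow of `C` is at most as large as `T'`, then initial segments nest. -/
lemma upClosed_of_card_le {a : Fin n → ℕ} {e : ℕ} {C C' : Finset (Fin n → ℕ)}
    (hC : IsInitial (box a e) C) (hC' : IsInitial (box a (e + 1)) C')
    (h : (upShadow a C).card ≤ C'.card) : UpClosed a C C' :=
  upClosed_iff_upShadow_subset.2 (hC.upShadow.subset_of_card_le hC' h)

lemma upClosed_of_eq_box {a : Fin n → ℕ} {e : ℕ} {T T' C C' : Finset (Fin n → ℕ)}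
    (hTT' : UpClosed a T T') (hC : IsInitial (box a e) C) (hC' : IsInitial (box a (e + 1)) C')
    (hCT : C.card = T.card) (hCT' : C'.card = T'.card) (hT : T = box a e) : UpClosed a C C' := by
  have : C = T := hT ▸ Finset.eq_of_subset_of_card_le hC.1 (by rw [hCT, hT])
  refine upClosed_of_card_le hC hC' ?_
  rw [hCT', this]
  exact Finset.card_le_card (upClosed_iff_upShadow_subset.1 hTT')

lemma clementsLindstrom_of_le_one (hn : n ≤ 1) : ClementsLindstrom n := by
  intro a e T T' C C' _ hT _ hTT' hC hC' hCT hCT'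
  rcases T.eq_empty_or_nonempty with rfl | ⟨m, hm⟩
  · rw [Finset.card_empty, Finset.card_eq_zero] at hCT
    subst hCT
    exact fun m hm => absurd hm (Finset.notMem_empty m)
  · refine upClosed_of_eq_box hTT' hC hC' hCT hCT' (hT.antisymm fun m' hm' => ?_)
    have h1 := (mem_box.1 (hT hm)).2
    have h2 := (mem_box.1 hm').2
    have : m' = m := by
      interval_cases n
      · exact Subsingleton.elim _ _
      · ext i
        rw [Subsingleton.elim i 0]
        simp only [Finset.univ_unique, Fin.default_eq_zero, Finset.sum_singleton] at h1 h2
        omega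
    exact this ▸ hm

lemma card_le_of_ne_box_two {a : Fin 2 → ℕ} {e : ℕ} {T T' : Finset (Fin 2 → ℕ)}
    (hT : T ⊆ box a e) (hTT' : UpClosed a T T') (hne : T ≠ box a e) : T.card ≤ T'.card := by
  obtain ⟨g, hg, hgT⟩ : ∃ g ∈ box a e, g ∉ T := by
    by_contra! hcon
    exact hne (hT.antisymm hcon)
  have hg0 := (mem_box.1 hg).1 0
  have hg1 := (mem_box.1 hg).1 1
  have hgs := sum_two_eq hg
  refine Finset.card_le_card_of_injOn
    (fun m => m + Pi.single (if m 0 < g 0 then 0 else 1) 1) (fun m hm => ?_) ?_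
  · have hms := sum_two_eq (hT hm)
    refine hTT' m hm _ ?_
    have hne0 : m 0 ≠ g 0 := fun h => hgT (ext_box_two (hT hm) hg h ▸ hm)
    split_ifs with h <;> omega
  · intro m hm m' hm' h
    have hne0 : m 0 ≠ g 0 := fun h => hgT (ext_box_two (hT hm) hg h ▸ hm)
    have hne0' : m' 0 ≠ g 0 := fun h => hgT (ext_box_two (hT hm') hg h ▸ hm')
    refine ext_box_two (hT hm) (hT hm') ?_
    have h0 := congrFun h 0
    simp only [Pi.add_apply] at h0
    split_ifs at h0 with h1 h2 h2 <;> simp at h0 <;> omega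

lemma clementsLindstrom_two : ClementsLindstrom 2 := by
  intro a e T T' C C' ha hT hT' hTT' hC hC' hCT hCT'
  by_cases hbox : T = box a e
  · exact upClosed_of_eq_box hTT' hC hC' hCT hCT' hbox
  have hle := card_le_of_ne_box_two hT hTT' hbox
  refine upClosed_of_card_le hC hC' ?_
  rw [hCT']
  have ha01 : a 0 ≤ a 1 := ha (by simp)
  -- division by the last variable
  have hdiv : ((upShadow a C).filter fun m => 0 < m 1).card ≤ C.card := by
    refine Finset.card_le_card_of_injOn (fun m => m - Pi.single 1 1) (fun m hm => ?_) ?_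
    · rw [Finset.mem_coe, Finset.mem_filter] at hm
      obtain ⟨c, rfl⟩ := exists_add_single hm.2
      simp only [add_tsub_cancel_right, Finset.mem_coe]
      obtain ⟨d, hd, i, hi, hid⟩ := mem_upShadow.1 hm.1
      have hcb := mem_box_of_add_single (upShadow_subset_box hC.1 hm.1)
      by_cases hi1 : i = 1
      · subst hi1
        exact add_right_cancel hid ▸ hd
      · have hi0 : i = 0 := by omega
        subst hi0
        refine hC.2 d hd c hcb (lex_lt_iff.2 ⟨0, by simp, ?_⟩)
        have := congrFun hid 0
        simp at this
        omega
    · intro m hm m' hm' h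
      rw [Finset.mem_coe, Finset.mem_filter] at hm hm'
      obtain ⟨c, rfl⟩ := exists_add_single hm.2
      obtain ⟨c', rfl⟩ := exists_add_single hm'.2
      simp only [add_tsub_cancel_right] at h
      rw [h]
  have hsplit := Finset.card_filter_add_card_filter_not (s := upShadow a C) (fun m => 0 < m 1)
  rcases T.eq_empty_or_nonempty with rfl | hTne
  · rw [Finset.card_empty, Finset.card_eq_zero] at hCT
    subst hCT
    simp [upShadow]
  rcases le_or_gt (a 0) (e + 1) with hea | hea
  · have hall : (upShadow a C).filter (fun m => ¬ 0 < m 1) = ∅ := by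
      rw [Finset.filter_eq_empty_iff]
      intro m hm
      have h1 := upShadow_subset_box hC.1 hm
      have h2 := sum_two_eq h1
      have h3 := (mem_box.1 h1).1 0
      omega
    rw [hall, Finset.card_empty] at hsplit
    omega
  · have hone : ((upShadow a C).filter (fun m => ¬ 0 < m 1)).card ≤ 1 := by
      refine Finset.card_le_one.2 fun m hm m' hm' => ?_
      rw [Finset.mem_filter] at hm hm'
      have h1 := upShadow_subset_box hC.1 hm.1
      have h2 := upShadow_subset_box hC.1 hm'.1
      have h3 := sum_two_eq h1
      have h4 := sum_two_eq h2
      exact ext_box_two h1 h2 (by omega)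
    obtain ⟨x, hx, hmax⟩ := T.exists_max_image (fun m => m 0) hTne
    have himage : insert (x + Pi.single 0 1) (T.image fun m => m + Pi.single 1 1) ⊆ T' := by
      refine Finset.insert_subset ?_ ?_
      · have := sum_two_eq (hT hx)
        exact hTT' x hx 0 (by omega)
      · intro m' hm'
        obtain ⟨m, hm, rfl⟩ := Finset.mem_image.1 hm'
        have := sum_two_eq (hT hm)
        exact hTT' m hm 1 (by omega)
    have hcard := Finset.card_le_card himage
    rw [Finset.card_insert_of_notMem, Finset.card_image_of_injective _ (add_left_injective _)]
      at hcard
    · omega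
    · intro hmem
      obtain ⟨m, hm, h⟩ := Finset.mem_image.1 hmem
      have h0 := congrFun h 0
      have := hmax m hm
      simp at h0
      omega

lemma mem_of_lex_lt_of_compressed {a : Fin (n + 3) → ℕ} {e : ℕ} {T : Finset (Fin (n + 3) → ℕ)}
    (hT : T ⊆ box a e) (hcomp : ∀ i, CompressedAt i (box a e) T) {p : Fin (n + 3) → ℕ}
    (hp : p ∈ box a e) {q : Fin (n + 3) → ℕ} (hq : q ∈ T) (hlt : toLex q < toLex p)
    (hle : p (Fin.last _) ≤ q (Fin.last _)) : p ∈ T := by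
  induction hN : q (Fin.last _) - p (Fin.last _) generalizing q with
  | zero => exact hcomp (Fin.last _) q hq p hp (by omega) hlt
  | succ N ih =>
    obtain ⟨l, hl, hll⟩ := lex_lt_iff.1 hlt
    have hllast : l < Fin.last _ := by
      refine lt_of_le_of_ne (Fin.le_last l) ?_
      rintro rfl
      omega
    have hpa := (mem_box.1 hp).1
    have hne : (Finset.univ.filter fun k => l ≤ k ∧ k < Fin.last _ ∧ q k + 1 < a k).Nonempty := by
      refine ⟨l, ?_⟩
      have := hpa l
      simp only [Finset.mem_filter, Finset.mem_univ, true_and]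
      exact ⟨le_rfl, hllast, by omega⟩
    obtain ⟨k, hk, hmax⟩ := Finset.exists_max_image _ id hne
    simp only [Finset.mem_filter, Finset.mem_univ, true_and, id] at hk hmax
    obtain ⟨c, rfl⟩ := exists_add_single (m := q) (i := Fin.last _) (by omega)
    obtain ⟨e', rfl⟩ : ∃ e', e = e' + 1 := by
      have := (mem_box.1 (hT hq)).2
      rw [sum_add_single] at this
      exact ⟨_, this.symm⟩
    have hkl : k ≠ Fin.last _ := hk.2.1.ne
    have hcb := mem_box_of_add_single (hT hq)
    have hck : c k + 1 < a k := by simpa [Pi.single_eq_of_ne hkl] using hk.2.2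
    have hq1 : c + Pi.single k 1 ∈ box a (e' + 1) := add_single_mem_box hcb hck
    have hq1T : c + Pi.single k 1 ∈ T := by
      obtain ⟨i, hi⟩ : ∃ i : Fin (n + 3), i ≠ k ∧ i ≠ Fin.last _ := by
        by_cases hk0 : k = 0
        · refine ⟨1, by rw [hk0]; simp, ?_⟩
          rw [Ne, Fin.ext_iff]
          simp
        · refine ⟨0, Ne.symm hk0, ?_⟩
          rw [Ne, Fin.ext_iff]
          simp
      refine hcomp i _ hq _ hq1 ?_ (lt_add_single_of_lt hk.2.1)
      simp [Pi.single_eq_of_ne hi.1, Pi.single_eq_of_ne hi.2]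
    have hqc : ∀ j, j ≠ Fin.last _ → (c + (Pi.single (Fin.last _) 1 : Fin (n + 3) → ℕ)) j = c j :=
      fun j hj => by simp [Pi.single_eq_of_ne hj]
    have hq1c : ∀ j, j ≠ k → (c + (Pi.single k 1 : Fin (n + 3) → ℕ)) j = c j :=
      fun j hj => by simp [Pi.single_eq_of_ne hj]
    have hlast : (c + (Pi.single (Fin.last _) 1 : Fin (n + 3) → ℕ)) (Fin.last _) =
        c (Fin.last _) + 1 := by simp
    have hk1 : (c + (Pi.single k 1 : Fin (n + 3) → ℕ)) k = c k + 1 := by simp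
    have hpre : ∀ j < l, (c + (Pi.single k 1 : Fin (n + 3) → ℕ)) j = p j := fun j hj => by
      rw [hq1c j (hj.trans_le hk.1).ne, ← hl j hj, hqc j (hj.trans hllast).ne]
    by_cases hcmp : (c + (Pi.single k 1 : Fin (n + 3) → ℕ)) l < p l
    · refine ih hq1T (lex_lt_iff.2 ⟨l, hpre, hcmp⟩) ?_ ?_
      · rw [hq1c _ hkl.symm]
        omega
      · rw [hq1c _ hkl.symm]
        omega
    · have hkleq : k = l := by
        by_contra hkl'
        rw [hq1c l (Ne.symm hkl')] at hcmp
        rw [hqc l hllast.ne] at hll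
        exact hcmp hll
      subst hkleq
      rw [hqc k hkl] at hll
      have hge : ∀ j ∈ Finset.univ, p j ≤ (c + (Pi.single k 1 : Fin (n + 3) → ℕ)) j := by
        intro j _
        rcases lt_trichotomy j k with hj | rfl | hj
        · exact (hpre j hj).ge
        · omega
        · rw [hq1c j hj.ne']
          rcases (Fin.le_last j).lt_or_eq with hjl | rfl
          · by_contra! hcon
            have h1 := hpa j
            have := hmax j ⟨hj.le, hjl, by rw [hqc j hjl.ne]; omega⟩
            exact absurd hj (not_lt.2 this)
          · omega
      have heq := (Finset.sum_eq_sum_iff_of_le hge).1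
        (by rw [(mem_box.1 hp).2, (mem_box.1 hq1).2])
      have : p = c + Pi.single k 1 := funext fun j => heq j (Finset.mem_univ j)
      exact this ▸ hq1T

lemma card_filter_last_le {a : Fin (n + 3) → ℕ} {e : ℕ} {T C : Finset (Fin (n + 3) → ℕ)}
    (hT : T ⊆ box a e) (hcomp : ∀ i, CompressedAt i (box a e) T)
    (hC : IsInitial (box a e) C) (hCT : C.card = T.card) (t : ℕ) :
    (C.filter fun m => m (Fin.last _) < t).card ≤ (T.filter fun m => m (Fin.last _) < t).card := by
  by_contra! hcon
  have h1 := Finset.card_filter_add_card_filter_not (s := C) (fun m => m (Fin.last _) < t)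
  have h2 := Finset.card_filter_add_card_filter_not (s := T) (fun m => m (Fin.last _) < t)
  obtain ⟨p, hp, hpT⟩ := Finset.exists_mem_notMem_of_card_lt_card hcon
  obtain ⟨q, hq, hqC⟩ := Finset.exists_mem_notMem_of_card_lt_card
    (s := C.filter fun m => ¬ m (Fin.last _) < t) (t := T.filter fun m => ¬ m (Fin.last _) < t)
    (by omega)
  simp only [Finset.mem_filter, not_and] at hp hpT hq hqC
  have hqC' : q ∉ C := fun h => hqC h hq.2
  have hpT' : p ∉ T := fun h => hpT h hp.2
  have hne : q ≠ p := by rintro rfl; exact hqC' hp.1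
  rcases lex_lt_or_lt hne with h | h
  · exact hpT' (mem_of_lex_lt_of_compressed hT hcomp (hC.1 hp.1) hq.1 h (by omega))
  · exact hqC' (hC.2 p hp.1 q (hT hq.1) h)

lemma card_upShadow_le_of_compressed {a : Fin (n + 3) → ℕ} {e : ℕ}
    {T T' C : Finset (Fin (n + 3) → ℕ)} (hT : T ⊆ box a e) (hTT' : UpClosed a T T')
    (hcomp : ∀ i, CompressedAt i (box a e) T)
    (hC : IsInitial (box a e) C) (hCT : C.card = T.card) :
    (upShadow a C).card ≤ T'.card := by
  set z := Fin.last (n + 2) with hz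
  have h1 := Finset.card_filter_add_card_filter_not (s := upShadow a C) (fun m => 0 < m z)
  have h2 := Finset.card_filter_add_card_filter_not (s := T') (fun m => 0 < m z)
  have hcount : ∀ t, (C.filter fun m => m z < t).card ≤ (T.filter fun m => m z < t).card :=
    card_filter_last_le hT hcomp hC hCT
  -- the part divisible by the last variable
  have hA : ((upShadow a C).filter fun m => 0 < m z).card ≤
      (C.filter fun m => m z < a z - 1).card := by
    refine Finset.card_le_card_of_injOn (fun m => m - Pi.single z 1) (fun m hm => ?_) ?_
    · rw [Finset.mem_coe, Finset.mem_filter] at hm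
      obtain ⟨c, rfl⟩ := exists_add_single hm.2
      have hb := upShadow_subset_box hC.1 hm.1
      have hcz := lt_of_add_single_mem_box hb
      simp only [add_tsub_cancel_right, Finset.coe_filter, Set.mem_ofPred_eq]
      refine ⟨?_, by omega⟩
      obtain ⟨d, hd, i, hi, hid⟩ := mem_upShadow.1 hm.1
      rcases (Fin.le_last i).lt_or_eq with hiz | rfl
      · obtain ⟨b, rfl⟩ : ∃ b, b + Pi.single z 1 = d := by
          refine exists_add_single ?_
          have hiz0 : (Pi.single i 1 : Fin (n + 3) → ℕ) z = 0 := Pi.single_eq_of_ne hiz.ne' _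
          have := congrFun hid z
          simp only [Pi.add_apply, hiz0, Pi.single_eq_same] at this
          omega
        have hcb : c = b + Pi.single i 1 := by
          rw [add_right_comm] at hid
          exact (add_right_cancel hid).symm
        refine hC.2 _ hd c (mem_box_of_add_single hb) ?_
        rw [hcb]
        exact lt_add_single_of_lt hiz
      · exact add_right_cancel hid ▸ hd
    · intro m hm m' hm' h
      rw [Finset.mem_coe, Finset.mem_filter] at hm hm'
      obtain ⟨c, rfl⟩ := exists_add_single hm.2
      obtain ⟨c', rfl⟩ := exists_add_single hm'.2
      simp only [add_tsub_cancel_right] at h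
      rw [h]
  have hB : (T.filter fun m => m z < a z - 1).card ≤ (T'.filter fun m => 0 < m z).card := by
    refine Finset.card_le_card_of_injOn (fun m => m + Pi.single z 1) (fun m hm => ?_)
      (add_left_injective _).injOn
    simp only [Finset.coe_filter, Set.mem_ofPred_eq] at hm ⊢
    exact ⟨hTT' m hm.1 z (by omega), by simp⟩
  -- the part free of the last variable
  have hD : ((upShadow a C).filter fun m => ¬ 0 < m z).card ≤
      (T'.filter fun m => ¬ 0 < m z).card := by
    refine Finset.card_le_card fun m hm => ?_
    rw [Finset.mem_filter] at hm ⊢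
    refine ⟨?_, hm.2⟩
    obtain ⟨c, hc, i, hi, rfl⟩ := mem_upShadow.1 hm.1
    refine hTT' c ?_ i hi
    have hcz : c z = 0 := by
      have := hm.2
      simp at this
      omega
    by_contra hcT
    obtain ⟨t, ht, htC⟩ : ∃ t ∈ T.filter (fun m : Fin (n + 3) → ℕ => m z < 1),
        t ∉ C.filter fun m : Fin (n + 3) → ℕ => m z < 1 := by
      by_contra! hcon
      have := Finset.eq_of_subset_of_card_le hcon (hcount 1)
      have hc' : c ∈ C.filter fun m => m z < 1 := by simp [hc, hcz]
      rw [← this] at hc'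
      exact hcT (Finset.mem_filter.1 hc').1
    simp only [Finset.mem_filter, not_and] at ht htC
    have htC' : t ∉ C := fun h => htC h ht.2
    have hne : t ≠ c := by rintro rfl; exact htC' hc
    rcases lex_lt_or_lt hne with h | h
    · exact hcT (hcomp z t ht.1 c (hC.1 hc) (by omega) h)
    · exact htC' (hC.2 c hc t (hT ht.1) h)
  have := hcount (a z - 1)
  omega

lemma clementsLindstrom_add_three (ih : ClementsLindstrom (n + 2)) :
    ClementsLindstrom (n + 3) := by
  classical
  intro a e T T' C C' ha hT hT' hTT' hC hC' hCT hCT'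
  set w : (Fin (n + 3) → ℕ) → ℕ := fun m =>
    ((box a e).filter fun q => toLex q < toLex m).card
  have hw : ∀ m ∈ box a e, ∀ m' ∈ box a e, toLex m < toLex m' → w m < w m' := by
    intro m hm m' _ hlt
    refine Finset.card_lt_card ((Finset.ssubset_iff_of_subset fun q => ?_).2
      ⟨m, by simp [hm, hlt], fun h => lt_irrefl _ (Finset.mem_filter.1 h).2⟩)
    simp only [Finset.mem_filter]
    exact fun h => ⟨h.1, h.2.trans hlt⟩
  let P : Finset (Fin (n + 3) → ℕ) → Prop := fun S => S.card = T.card ∧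
    ∃ S', S' ⊆ box a (e + 1) ∧ UpClosed a S S' ∧ S'.card = T'.card
  set 𝒮 := (box a e).powerset.filter P
  have hne : 𝒮.Nonempty :=
    ⟨T, Finset.mem_filter.2 ⟨Finset.mem_powerset.2 hT, rfl, T', hT', hTT', rfl⟩⟩
  obtain ⟨S, hS, hmax⟩ := 𝒮.exists_max_image (fun S => ∑ m ∈ S, w m) hne
  simp only [𝒮, P, Finset.mem_filter, Finset.mem_powerset] at hS hmax
  obtain ⟨hSb, hSc, S', hS'b, hSS', hSc'⟩ := hS
  have hcomp : ∀ i, CompressedAt i (box a e) S := by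
    intro i
    rcases exists_compression ih ha i hSb hS'b hSS' hw with h | ⟨U, U', h1, h2, h3, h4, h5, h6⟩
    · exact h
    · exact absurd (hmax U ⟨h1, h4.trans hSc, U', h2, h3, h5.trans hSc'⟩) (not_le.2 h6)
  refine upClosed_of_card_le hC hC' ?_
  rw [hCT', ← hSc']
  exact card_upShadow_le_of_compressed hSb hSS' hcomp hC (hCT.trans hSc.symm)

/-- **The Clements–Lindström theorem**: replacing sets of monomials below `a` by initial lex
segments of the same size is compatible with multiplication by variables. -/
theorem clementsLindstrom (n : ℕ) : ClementsLindstrom n := by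
  induction n with
  | zero => exact clementsLindstrom_of_le_one (by omega)
  | succ n ih =>
    match n, ih with
    | 0, _ => exact clementsLindstrom_of_le_one le_rfl
    | 1, _ => exact clementsLindstrom_two
    | n + 2, ih => exact clementsLindstrom_add_three ih

end Combinatorics
section ExtRegular

open CategoryTheory CategoryTheory.Abelian RingTheory.Sequence Pointwise

universe u

variable {R : Type u} [CommRing R]

lemma ext_comp_smul_id_eq_zero {N M : ModuleCat.{u} R} {r : R}
    (hr : r ∈ Module.annihilator R N) {i : ℕ} (x : Ext N M i) :
    x.comp (Ext.mk₀ (M.smulShortComplex r).f) (add_zero i) = 0 :=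
  DFunLike.congr_fun (AddCommGrpCat.ofHom_injective
    (Ext.postcomp_smul_id_eq_zero_of_mem_annihilator (M := M) (N := N) hr i)) x

lemma subsingleton_ext_and_nonempty_linearEquiv (N : ModuleCat.{u} R) (rs : List R)
    (hrs : ∀ r ∈ rs, r ∈ Module.annihilator R N) (M : ModuleCat.{u} R)
    (hM : IsWeaklyRegular M rs) :
    (∀ i < rs.length, Subsingleton (Ext N M i)) ∧
      Nonempty ((N →ₗ[R] (M ⧸ (Ideal.ofList rs • ⊤ : Submodule R M))) ≃ₗ[R]
        Ext N M rs.length) := by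
  induction rs generalizing M with
  | nil =>
    refine ⟨by simp, ⟨?_⟩⟩
    have e : (M ⧸ (Ideal.ofList ([] : List R) • ⊤ : Submodule R M)) ≃ₗ[R] M :=
      Submodule.quotEquivOfEqBot _ (by simp)
    exact (LinearEquiv.congrRight e).trans
      ((ModuleCat.homLinearEquiv (S := R)).symm.trans (Ext.linearEquiv₀ (R := R)).symm)
  | cons r rs ih =>
    rw [isWeaklyRegular_cons_iff] at hM
    simp only [List.mem_cons, forall_eq_or_imp] at hrs
    obtain ⟨hvan, ⟨e⟩⟩ := ih hrs.2 (ModuleCat.of R (QuotSMulTop r M)) hM.2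
    have hS := hM.1.smulShortComplex_shortExact
    have hvan' : ∀ i < rs.length + 1, Subsingleton (Ext N M i) := by
      intro i hi
      refine subsingleton_of_forall_eq 0 fun x => ?_
      have hx := ext_comp_smul_id_eq_zero hrs.1 x
      match i, hi with
      | 0, _ =>
        have := hS.mono_f
        refine Ext.postcomp_mk₀_injective_of_mono N (M.smulShortComplex r).f ?_
        exact hx.trans (map_zero _).symm
      | i + 1, hi =>
        obtain ⟨y, hy⟩ := Ext.covariant_sequence_exact₁ N hS x hx rfl
        have := hvan i (by omega)
        rw [← hy, show y = 0 from this.elim y 0]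
        exact Ext.zero_comp _ _ _ _ _
    refine ⟨hvan', ⟨?_⟩⟩
    let δ : Ext N (ModuleCat.of R (QuotSMulTop r M)) rs.length →ₗ[R]
        Ext N M (rs.length + 1) :=
      { toFun := fun x => x.comp hS.extClass rfl
        map_add' := fun x y => Ext.add_comp _ _ _ _
        map_smul' := fun c x => Ext.smul_comp _ _ _ _ }
    have hδ : Function.Bijective δ := by
      constructor
      · rw [injective_iff_map_eq_zero]
        intro x hx
        obtain ⟨y, hy⟩ := Ext.covariant_sequence_exact₃ N hS x rfl hx
        have := hvan' rs.length (by omega)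
        rw [← hy, show y = 0 from this.elim y 0]
        exact Ext.zero_comp _ _ _ _ _
      · intro x
        exact Ext.covariant_sequence_exact₁ N hS x (ext_comp_smul_id_eq_zero hrs.1 x) rfl
    exact (LinearEquiv.congrRight (Submodule.quotOfListConsSMulTopEquivQuotSMulTopInner M r rs)).trans
      (e.trans (LinearEquiv.ofBijective δ hδ))

/-- Weakly regular sequences of the same length which annihilate `N` have isomorphic
Hom-modules from `N` into the quotients. -/
lemma nonempty_hom_quotient_linearEquiv (N M : Type u) [AddCommGroup N] [Module R N]
    [AddCommGroup M] [Module R M] {rs ss : List R} (hlen : rs.length = ss.length)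
    (hr : ∀ r ∈ rs, r ∈ Module.annihilator R N) (hs : ∀ r ∈ ss, r ∈ Module.annihilator R N)
    (hrM : IsWeaklyRegular M rs) (hsM : IsWeaklyRegular M ss) :
    Nonempty ((N →ₗ[R] (M ⧸ (Ideal.ofList rs • ⊤ : Submodule R M))) ≃ₗ[R]
      (N →ₗ[R] (M ⧸ (Ideal.ofList ss • ⊤ : Submodule R M)))) := by
  obtain ⟨e⟩ := (subsingleton_ext_and_nonempty_linearEquiv (ModuleCat.of R N) rs hr
    (ModuleCat.of R M) hrM).2
  obtain ⟨e'⟩ := (subsingleton_ext_and_nonempty_linearEquiv (ModuleCat.of R N) ss hs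
    (ModuleCat.of R M) hsM).2
  rw [hlen] at e
  exact ⟨e.trans e'.symm⟩

end ExtRegular

section RegularSequences

open RingTheory.Sequence Pointwise

variable {K : Type*} [Field K] {n r : ℕ}

lemma mul_X_pow_mem_span_monomial {M : Set (Fin n →₀ ℕ)} {i : Fin n} {c : ℕ}
    (hM : ∀ m ∈ M, m i = 0) {g : MvPolynomial (Fin n) K}
    (hg : g * X i ^ c ∈ Ideal.span ((fun m => (monomial m (1 : K))) '' M)) :
    g ∈ Ideal.span ((fun m => (monomial m (1 : K))) '' M) := by
  rw [mem_ideal_span_monomial_image] at hg ⊢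
  intro m hm
  obtain ⟨m', hm', hle⟩ := hg (m + Finsupp.single i c) (by
    rw [mem_support_iff, X_pow_eq_monomial, coeff_mul_monomial, mul_one]
    exact mem_support_iff.1 hm)
  refine ⟨m', hm', fun j => ?_⟩
  by_cases hj : j = i
  · subst hj
    simp [hM m' hm']
  · simpa [Finsupp.single_apply, Ne.symm hj] using hle j

lemma setOf_X_pow_eq (a : Fin n → ℕ) (P : Fin n → Prop) :
    {p : MvPolynomial (Fin n) K | ∃ j, P j ∧ p = X j ^ a j} =
      (fun m => (monomial m (1 : K))) '' {m | ∃ j, P j ∧ m = Finsupp.single j (a j)} := by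
  ext p
  constructor
  · rintro ⟨j, hj, rfl⟩
    exact ⟨_, ⟨j, hj, rfl⟩, X_pow_eq_monomial.symm⟩
  · rintro ⟨_, ⟨j, hj, rfl⟩, rfl⟩
    exact ⟨j, hj, X_pow_eq_monomial.symm⟩

lemma isRegSeq_X_pow (a : Fin n → ℕ) :
    IsRegSeq fun i : Fin n => (X i ^ a i : MvPolynomial (Fin n) K) := by
  intro i g hg
  rw [setOf_X_pow_eq] at hg ⊢
  refine mul_X_pow_mem_span_monomial ?_ hg
  rintro _ ⟨j, hj, rfl⟩
  simp [hj.ne]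

lemma ofList_ofFn (f : Fin r → MvPolynomial (Fin n) K) :
    Ideal.ofList (List.ofFn f) = Ideal.span (Set.range f) := by
  simp [Ideal.ofList, List.mem_ofFn', Set.range]

lemma ofList_take_ofFn (f : Fin r → MvPolynomial (Fin n) K) (i : ℕ) :
    Ideal.ofList ((List.ofFn f).take i) =
      Ideal.span {p | ∃ j : Fin r, (j : ℕ) < i ∧ p = f j} := by
  refine congrArg Ideal.span (Set.ext fun p => ?_)
  change p ∈ List.take i (List.ofFn f) ↔ _
  simp only [List.mem_take_iff_getElem, List.getElem_ofFn, List.length_ofFn, lt_min_iff]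
  constructor
  · rintro ⟨k, hk, rfl⟩
    exact ⟨⟨k, hk.2⟩, hk.1, rfl⟩
  · rintro ⟨j, hj, rfl⟩
    exact ⟨j, ⟨hj, j.2⟩, rfl⟩

lemma isWeaklyRegular_of_isRegSeq {f : Fin r → MvPolynomial (Fin n) K} (hf : IsRegSeq f) :
    IsWeaklyRegular (MvPolynomial (Fin n) K) (List.ofFn f) := by
  refine ⟨fun i hi => ?_⟩
  rw [List.length_ofFn] at hi
  rw [ofList_take_ofFn, List.getElem_ofFn, isSMulRegular_iff_right_eq_zero_of_smul]
  intro x hx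
  obtain ⟨g, rfl⟩ := Submodule.Quotient.mk_surjective _ x
  rw [← Submodule.Quotient.mk_smul, Submodule.Quotient.mk_eq_zero, smul_eq_mul,
    Ideal.mul_top] at hx
  rw [Submodule.Quotient.mk_eq_zero, smul_eq_mul, Ideal.mul_top]
  refine hf ⟨i, hi⟩ g ?_
  rw [mul_comm]
  exact hx

/-- The ideal generated by the variables. -/
noncomputable abbrev irrelevant (K : Type*) [Field K] (n : ℕ) : Ideal (MvPolynomial (Fin n) K) :=
  Ideal.span (Set.range X)

lemma sub_C_mem_irrelevant (p : MvPolynomial (Fin n) K) :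
    p - C (coeff 0 p) ∈ irrelevant K n := by
  rw [irrelevant, ← Set.image_univ, mem_ideal_span_X_image]
  intro m hm
  have hm0 : m ≠ 0 := by
    rintro rfl
    simp at hm
  obtain ⟨i, hi⟩ := Finsupp.ne_iff.1 hm0
  exact ⟨i, Set.mem_univ _, hi⟩

lemma X_mem_irrelevant (i : Fin n) : (X i : MvPolynomial (Fin n) K) ∈ irrelevant K n :=
  Ideal.subset_span ⟨i, rfl⟩

lemma mem_irrelevant_of_isHomogeneous {p : MvPolynomial (Fin n) K} {d : ℕ}
    (hp : p.IsHomogeneous d) (hd : d ≠ 0) : p ∈ irrelevant K n := by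
  have h : coeff 0 p = 0 := by
    by_contra h
    exact hd (by simpa using (hp h).symm)
  simpa [h] using sub_C_mem_irrelevant p

/-- The socle of a quotient by a regular sequence of `n` elements is at most one-dimensional. -/
lemma exists_sub_C_mul_mem {f : Fin n → MvPolynomial (Fin n) K} (hf : IsRegSeq f)
    (hm : ∀ i, f i ∈ irrelevant K n) {u v : MvPolynomial (Fin n) K}
    (hu : u ∉ Ideal.span (Set.range f))
    (hXu : ∀ i, X i * u ∈ Ideal.span (Set.range f))
    (hXv : ∀ i, X i * v ∈ Ideal.span (Set.range f)) :
    ∃ c : K, v - C c * u ∈ Ideal.span (Set.range f) := by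
  set F := Ideal.span (Set.range f) with hF
  have hX : IsRegSeq fun i : Fin n => (X i : MvPolynomial (Fin n) K) := by
    simpa using isRegSeq_X_pow (K := K) (fun _ : Fin n => 1)
  have key := nonempty_hom_quotient_linearEquiv (MvPolynomial (Fin n) K ⧸ irrelevant K n)
    (MvPolynomial (Fin n) K) (rs := List.ofFn f)
    (ss := List.ofFn fun i : Fin n => (X i : MvPolynomial (Fin n) K)) (by simp)
    (by simpa [Ideal.annihilator_quotient] using hm)
    (by simpa [Ideal.annihilator_quotient] using X_mem_irrelevant (K := K))
    (isWeaklyRegular_of_isRegSeq hf) (isWeaklyRegular_of_isRegSeq hX)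
  rw [ofList_ofFn, ofList_ofFn, smul_eq_mul, smul_eq_mul, Ideal.mul_top, Ideal.mul_top] at key
  obtain ⟨e⟩ := key
  have hlift : ∀ w, (∀ i, X i * w ∈ F) →
      ∃ φ : (MvPolynomial (Fin n) K ⧸ irrelevant K n) →ₗ[MvPolynomial (Fin n) K]
        (MvPolynomial (Fin n) K ⧸ F), φ (Submodule.Quotient.mk 1) = Submodule.Quotient.mk w := by
    intro w hw
    refine ⟨Submodule.liftQ _ (LinearMap.toSpanSingleton _ _ (Submodule.Quotient.mk w)) ?_, ?_⟩
    · refine Ideal.span_le.2 ?_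
      rintro _ ⟨i, rfl⟩
      rw [SetLike.mem_coe, LinearMap.mem_ker, LinearMap.toSpanSingleton_apply,
        ← Submodule.Quotient.mk_smul, Submodule.Quotient.mk_eq_zero]
      exact hw i
    · rw [Submodule.liftQ_apply, LinearMap.toSpanSingleton_apply, one_smul]
  obtain ⟨φ, hφ⟩ := hlift u hXu
  obtain ⟨ψ, hψ⟩ := hlift v hXv
  obtain ⟨p, hp⟩ := Submodule.Quotient.mk_surjective _ (e φ (Submodule.Quotient.mk 1))
  obtain ⟨q, hq⟩ := Submodule.Quotient.mk_surjective _ (e ψ (Submodule.Quotient.mk 1))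
  have hC : ∀ g : MvPolynomial (Fin n) K,
      (Submodule.Quotient.mk g : MvPolynomial (Fin n) K ⧸ irrelevant K n) =
        Submodule.Quotient.mk (C (coeff 0 g)) :=
    fun g => (Submodule.Quotient.eq _).2 (sub_C_mem_irrelevant g)
  have hp0 : coeff 0 p ≠ 0 := by
    intro h
    refine hu ((Submodule.Quotient.mk_eq_zero F).1 ?_)
    have h0 : e φ = 0 := by
      refine Submodule.linearMap_qext _ (LinearMap.ext_ring ?_)
      rw [LinearMap.comp_apply, Submodule.mkQ_apply, ← hp, hC p, h, C_0]
      rfl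
    rw [← hφ, e.map_eq_zero_iff.1 h0]
    rfl
  refine ⟨coeff 0 q / coeff 0 p, (Submodule.Quotient.mk_eq_zero F).1 ?_⟩
  have h0 : e (ψ - (C (coeff 0 q / coeff 0 p) : MvPolynomial (Fin n) K) • φ) = 0 := by
    refine Submodule.linearMap_qext _ (LinearMap.ext_ring ?_)
    rw [map_sub, map_smul]
    simp only [LinearMap.comp_apply, Submodule.mkQ_apply, LinearMap.sub_apply,
      LinearMap.smul_apply, ← hp, ← hq, LinearMap.zero_comp, LinearMap.zero_apply]
    rw [hC p, hC q, ← Submodule.Quotient.mk_smul, smul_eq_mul, ← C_mul, div_mul_cancel₀ _ hp0,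
      sub_self]
  have := LinearMap.congr_fun (e.map_eq_zero_iff.1 h0) (Submodule.Quotient.mk 1)
  rw [LinearMap.sub_apply, LinearMap.smul_apply, hφ, hψ, ← Submodule.Quotient.mk_smul,
    ← Submodule.Quotient.mk_sub] at this
  exact this

end RegularSequences

section HilbertFunction

variable {K : Type*} [Field K] {n r : ℕ}

instance finite_homogeneousSubmodule (d : ℕ) :
    Module.Finite K (homogeneousSubmodule (Fin n) K d) :=
  Module.Finite.iff_fg.2 (homogeneousSubmodule_fg _ _ d)

instance finite_component (I : Ideal (MvPolynomial (Fin n) K)) (d : ℕ) :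
    Module.Finite K (component I d) :=
  Submodule.finiteDimensional_of_le inf_le_right

lemma mem_component {I : Ideal (MvPolynomial (Fin n) K)} {d : ℕ} {p : MvPolynomial (Fin n) K} :
    p ∈ component I d ↔ p ∈ I ∧ p.IsHomogeneous d := Iff.rfl

section

attribute [local instance] MvPolynomial.gradedAlgebra

lemma decompose_coe_eq (p : MvPolynomial (Fin n) K) (d : ℕ) :
    (DirectSum.decompose (homogeneousSubmodule (Fin n) K) p d : MvPolynomial (Fin n) K) =
      homogeneousComponent d p :=
  decomposition.decompose'_apply p d

lemma homogeneousComponent_mul_add {p q : MvPolynomial (Fin n) K} {c : ℕ}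
    (hq : q.IsHomogeneous c) (d : ℕ) :
    homogeneousComponent (d + c) (p * q) = homogeneousComponent d p * q := by
  rw [← decompose_coe_eq, ← decompose_coe_eq]
  exact DirectSum.coe_decompose_mul_add_of_right_mem (homogeneousSubmodule (Fin n) K) hq

lemma homogeneousComponent_mul_of_lt {p q : MvPolynomial (Fin n) K} {c d : ℕ}
    (hq : q.IsHomogeneous c) (hd : d < c) : homogeneousComponent d (p * q) = 0 := by
  rw [← decompose_coe_eq]
  exact DirectSum.coe_decompose_mul_of_right_mem_of_not_le (homogeneousSubmodule (Fin n) K) hq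
    (not_le.2 hd)

lemma isHomog_span {s : Set (MvPolynomial (Fin n) K)} (hs : ∀ p ∈ s, ∃ c, p.IsHomogeneous c) :
    IsHomog (Ideal.span s) := fun _ hp d =>
  homogeneousComponent_mem_of_mem
    (Ideal.homogeneous_span (homogeneousSubmodule (Fin n) K) s hs) hp d

end

lemma component_sup_span_singleton_of_lt {P : Ideal (MvPolynomial (Fin n) K)} (hP : IsHomog P)
    {f : MvPolynomial (Fin n) K} {c d : ℕ} (hf : f.IsHomogeneous c) (hd : d < c) :
    component (P ⊔ Ideal.span {f}) d = component P d := by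
  ext p
  rw [mem_component, mem_component]
  refine and_congr_left fun hp => ⟨fun h => ?_, fun h => Ideal.mem_sup_left h⟩
  rw [sup_comm] at h
  obtain ⟨g, q, hq, rfl⟩ := Ideal.mem_span_singleton_sup.1 h
  rw [← homogeneousComponent_eq_self hp, map_add, homogeneousComponent_mul_of_lt hf hd, zero_add]
  exact hP q hq d

lemma component_top (d : ℕ) :
    component (⊤ : Ideal (MvPolynomial (Fin n) K)) d = homogeneousSubmodule (Fin n) K d := by
  ext p
  rw [mem_component, mem_homogeneousSubmodule]
  exact and_iff_right Submodule.mem_top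

lemma finrank_map_of_injective {V W : Type*} [AddCommGroup V] [Module K V] [AddCommGroup W]
    [Module K W] {φ : V →ₗ[K] W} (hφ : Function.Injective φ) (S : Submodule K V) :
    Module.finrank K (S.map φ) = Module.finrank K S :=
  (Submodule.equivMapOfInjective φ hφ S).finrank_eq.symm

lemma hilb_sup_span_singleton {P : Ideal (MvPolynomial (Fin n) K)} (hP : IsHomog P)
    {f : MvPolynomial (Fin n) K} {c : ℕ} (hf : f.IsHomogeneous c)
    (hreg : ∀ g, g * f ∈ P → g ∈ P) (d : ℕ) :
    hilb (P ⊔ Ideal.span {f}) (d + c) + hilb P d =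
      hilb P (d + c) + Module.finrank K (homogeneousSubmodule (Fin n) K d) := by
  by_cases hf0 : f = 0
  · subst hf0
    have hP1 : P = ⊤ := P.eq_top_iff_one.2 (hreg 1 (by simp))
    subst hP1
    rw [sup_eq_left.2 le_top, hilb, hilb, component_top, component_top]
  have hinj : Function.Injective (LinearMap.mulRight K f) := fun x y h =>
    mul_right_cancel₀ hf0 h
  have hsup : component (P ⊔ Ideal.span {f}) (d + c) =
      component P (d + c) ⊔ (homogeneousSubmodule (Fin n) K d).map (LinearMap.mulRight K f) := by
    ext p
    rw [mem_component]
    constructor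
    · rintro ⟨h, hp⟩
      rw [sup_comm] at h
      obtain ⟨g, q, hq, rfl⟩ := Ideal.mem_span_singleton_sup.1 h
      refine Submodule.mem_sup.2
        ⟨homogeneousComponent (d + c) q, ⟨hP q hq _, homogeneousComponent_mem _ _⟩,
        homogeneousComponent d g * f, ⟨_, homogeneousComponent_mem _ _, rfl⟩, ?_⟩
      rw [← homogeneousComponent_mul_add hf, ← map_add, add_comm q,
        homogeneousComponent_eq_self hp]
    · intro h
      obtain ⟨q, ⟨hq, hq'⟩, _, ⟨g, hg, rfl⟩, rfl⟩ := Submodule.mem_sup.1 h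
      refine ⟨Ideal.add_mem _ (Ideal.mem_sup_left hq) (Ideal.mem_sup_right ?_),
        hq'.add (IsHomogeneous.mul hg hf)⟩
      exact Ideal.mul_mem_left _ _ (Ideal.mem_span_singleton_self f)
  have hinf : component P (d + c) ⊓
      (homogeneousSubmodule (Fin n) K d).map (LinearMap.mulRight K f) =
        (component P d).map (LinearMap.mulRight K f) := by
    ext p
    constructor
    · rintro ⟨⟨hp, _⟩, g, hg, rfl⟩
      exact ⟨g, ⟨hreg g hp, hg⟩, rfl⟩
    · rintro ⟨g, ⟨hg, hg'⟩, rfl⟩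
      exact ⟨⟨Ideal.mul_mem_right _ _ hg, IsHomogeneous.mul hg' hf⟩, g, hg', rfl⟩
  have h := Submodule.finrank_sup_add_finrank_inf_eq (component P (d + c))
    ((homogeneousSubmodule (Fin n) K d).map (LinearMap.mulRight K f))
  rw [← hsup, hinf, finrank_map_of_injective hinj,
    finrank_map_of_injective hinj] at h
  exact h

lemma setOf_lt_succ_eq_insert (f : Fin r → MvPolynomial (Fin n) K) {i : ℕ} (hi : i < r) :
    {p | ∃ j : Fin r, (j : ℕ) < i + 1 ∧ p = f j} =
      {p | ∃ j : Fin r, (j : ℕ) < i ∧ p = f j} ∪ {f ⟨i, hi⟩} := by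
  ext p
  constructor
  · rintro ⟨j, hj, rfl⟩
    rcases Nat.lt_succ_iff_lt_or_eq.1 hj with h | h
    · exact Or.inl ⟨j, h, rfl⟩
    · exact Or.inr (congrArg f (Fin.ext h))
  · rintro (⟨j, hj, rfl⟩ | rfl)
    · exact ⟨j, by omega, rfl⟩
    · exact ⟨⟨i, hi⟩, by simp, rfl⟩

/-- The Hilbert function of an ideal generated by a homogeneous regular sequence depends only on
the degrees. -/
lemma hilb_span_eq_hilb_span {f g : Fin r → MvPolynomial (Fin n) K} (hf : IsRegSeq f)
    (hg : IsRegSeq g) {a : Fin r → ℕ} (hfa : ∀ i, (f i).IsHomogeneous (a i))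
    (hga : ∀ i, (g i).IsHomogeneous (a i)) (d : ℕ) :
    hilb (Ideal.span (Set.range f)) d = hilb (Ideal.span (Set.range g)) d := by
  have key : ∀ i ≤ r, ∀ d, hilb (Ideal.span {p | ∃ j : Fin r, (j : ℕ) < i ∧ p = f j}) d =
      hilb (Ideal.span {p | ∃ j : Fin r, (j : ℕ) < i ∧ p = g j}) d := by
    intro i
    induction i with
    | zero => simp
    | succ i ih =>
      intro hi d
      rw [setOf_lt_succ_eq_insert f hi, setOf_lt_succ_eq_insert g hi, Ideal.span_union,
        Ideal.span_union]
      have hPf : IsHomog (Ideal.span {p | ∃ j : Fin r, (j : ℕ) < i ∧ p = f j}) :=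
        isHomog_span (by rintro _ ⟨j, _, rfl⟩; exact ⟨_, hfa j⟩)
      have hPg : IsHomog (Ideal.span {p | ∃ j : Fin r, (j : ℕ) < i ∧ p = g j}) :=
        isHomog_span (by rintro _ ⟨j, _, rfl⟩; exact ⟨_, hga j⟩)
      have ih := ih (by omega)
      rcases lt_or_ge d (a ⟨i, hi⟩) with hd | hd
      · have := ih d
        rwa [hilb, hilb, component_sup_span_singleton_of_lt hPf (hfa _) hd,
          component_sup_span_singleton_of_lt hPg (hga _) hd]
      · obtain ⟨e, rfl⟩ := Nat.exists_eq_add_of_le' hd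
        have h1 := hilb_sup_span_singleton hPf (hfa ⟨i, hi⟩) (hf ⟨i, hi⟩) e
        have h2 := hilb_sup_span_singleton hPg (hga ⟨i, hi⟩) (hg ⟨i, hi⟩) e
        have h3 := ih e
        have h4 := ih (e + a ⟨i, hi⟩)
        omega
  have hrange : ∀ h : Fin r → MvPolynomial (Fin n) K,
      {p | ∃ j : Fin r, (j : ℕ) < r ∧ p = h j} = Set.range h := fun h => by
    ext p
    simp [eq_comm]
  simpa only [hrange] using key r le_rfl d

end HilbertFunction

section MonomialIdeals

variable {K : Type*} [Field K] {n : ℕ} {a b : Fin n → ℕ}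

/-- The exponent vectors of degree `d` which do not lie strictly below `a`. -/
def nonBox (a : Fin n → ℕ) (d : ℕ) : Set (Fin n →₀ ℕ) :=
  {m | expDeg m = d ∧ ∃ i, a i ≤ m i}

/-- A set of functions, regarded as a set of finitely supported functions. -/
def exponents (C : Finset (Fin n → ℕ)) : Set (Fin n →₀ ℕ) := {m | ⇑m ∈ C}

lemma ncard_exponents (C : Finset (Fin n → ℕ)) : (exponents C).ncard = C.card := by
  rw [← Set.ncard_coe_finset, ← Set.ncard_image_of_injective (exponents C) DFunLike.coe_injective]
  congr 1
  ext m
  constructor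
  · rintro ⟨m, hm, rfl⟩
    exact hm
  · exact fun hm => ⟨Finsupp.equivFunOnFinite.symm m, hm, rfl⟩

lemma finite_exponents (C : Finset (Fin n → ℕ)) : (exponents C).Finite :=
  C.finite_toSet.preimage DFunLike.coe_injective.injOn

lemma expDeg_eq_degree (m : Fin n →₀ ℕ) : expDeg m = m.degree :=
  (Finsupp.degree_eq_sum m).symm

lemma finite_setOf_expDeg_eq (n d : ℕ) : {m : Fin n →₀ ℕ | expDeg m = d}.Finite := by
  refine (finite_exponents (box (fun _ => d + 1) d)).subset fun m hm => mem_box.2 ⟨fun i => ?_, hm⟩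
  exact Nat.lt_succ_iff.2 ((Finset.single_le_sum (fun _ _ => Nat.zero_le _)
    (Finset.mem_univ i)).trans_eq hm)

lemma finite_nonBox (a : Fin n → ℕ) (d : ℕ) : (nonBox a d).Finite :=
  (finite_setOf_expDeg_eq n d).subset fun _ hm => hm.1

lemma setOf_expDeg_eq (a : Fin n → ℕ) (d : ℕ) :
    {m : Fin n →₀ ℕ | expDeg m = d} = nonBox a d ∪ exponents (box a d) := by
  ext m
  simp only [nonBox, exponents, Set.mem_union, Set.mem_ofPred_eq, mem_box, expDeg]
  constructor
  · intro h
    by_cases h' : ∃ i, a i ≤ m i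
    · exact Or.inl ⟨h, h'⟩
    · exact Or.inr ⟨by simpa using h', h⟩
  · rintro (h | h)
    exacts [h.1, h.2]

lemma disjoint_nonBox_exponents {d : ℕ} {T : Finset (Fin n → ℕ)} (hT : T ⊆ box a d) :
    Disjoint (nonBox a d) (exponents T) :=
  Set.disjoint_left.2 fun _ ⟨_, i, hi⟩ hm => not_le.2 ((mem_box.1 (hT hm)).1 i) hi

lemma homogeneousSubmodule_eq_restrictSupport (d : ℕ) :
    homogeneousSubmodule (Fin n) K d = restrictSupport K {m | expDeg m = d} := by
  simp only [expDeg_eq_degree]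
  exact homogeneousSubmodule_eq_finsupp_supported _ _ d

lemma finrank_restrictSupport (S : Set (Fin n →₀ ℕ)) :
    Module.finrank K (restrictSupport K S) = S.ncard :=
  Module.finrank_eq_nat_card_basis (basisRestrictSupport K S)

lemma span_monomial_eq_restrictSupportIdeal {M : Set (Fin n →₀ ℕ)} {U : Set (Fin n →₀ ℕ)}
    (hU : IsUpperSet U) (h : ∀ m, m ∈ U ↔ ∃ m' ∈ M, m' ≤ m) :
    Ideal.span ((fun m => (monomial m (1 : K) : MvPolynomial (Fin n) K)) '' M) =
      restrictSupportIdeal K U hU := by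
  ext p
  rw [mem_ideal_span_monomial_image]
  exact forall₂_congr fun m _ => (h m).symm

lemma component_restrictSupportIdeal {U : Set (Fin n →₀ ℕ)} (hU : IsUpperSet U) (d : ℕ) :
    component (restrictSupportIdeal K U hU) d =
      restrictSupport K {m | expDeg m = d ∧ m ∈ U} := by
  rw [component, homogeneousSubmodule_eq_restrictSupport]
  ext p
  exact ⟨fun h m hm => ⟨h.2 hm, h.1 hm⟩, fun h => ⟨fun m hm => (h hm).2, fun m hm => (h hm).1⟩⟩

lemma isUpperSet_setOf_exists_le (a : Fin n → ℕ) :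
    IsUpperSet {m : Fin n →₀ ℕ | ∃ i, a i ≤ m i} :=
  fun _ _ hle ⟨i, hi⟩ => ⟨i, hi.trans (hle i)⟩

lemma component_purePowers (a : Fin n → ℕ) (d : ℕ) :
    component (purePowers K le_rfl a) d = restrictSupport K (nonBox a d) := by
  have h : purePowers K le_rfl a = restrictSupportIdeal K _ (isUpperSet_setOf_exists_le a) := by
    rw [← span_monomial_eq_restrictSupportIdeal (M := Set.range fun i => Finsupp.single i (a i)),
      ← Set.range_comp]
    · simp [purePowers, X_pow_eq_monomial, Function.comp_def]
    · simp
  rw [h, component_restrictSupportIdeal]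
  rfl

lemma finrank_nonBox_union {d : ℕ} {T : Finset (Fin n → ℕ)} (hT : T ⊆ box a d) :
    Module.finrank K (restrictSupport K (nonBox a d ∪ exponents T)) =
      hilb (purePowers K le_rfl a) d + T.card := by
  rw [hilb, component_purePowers, finrank_restrictSupport, finrank_restrictSupport,
    Set.ncard_union_eq (disjoint_nonBox_exponents hT) (finite_nonBox a d) (finite_exponents T),
    ncard_exponents]

lemma finrank_homogeneousSubmodule (a : Fin n → ℕ) (d : ℕ) :
    Module.finrank K (homogeneousSubmodule (Fin n) K d) =
      hilb (purePowers K le_rfl a) d + (box a d).card := by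
  rw [homogeneousSubmodule_eq_restrictSupport, setOf_expDeg_eq a,
    finrank_nonBox_union (Finset.Subset.refl _)]

/-- A lex-plus-powers ideal with respect to `b ≤ a` is determined modulo the powers given by `a`
by sets of monomials strictly below `a` which are compatible with multiplication. -/
lemma exists_upClosed_of_isLPP (hba : ∀ i, b i ≤ a i) {J : Ideal (MvPolynomial (Fin n) K)}
    (hJ : IsLPP le_rfl b J) :
    ∃ T : ℕ → Finset (Fin n → ℕ), (∀ e, T e ⊆ box a e) ∧ (∀ e, UpClosed a (T e) (T (e + 1))) ∧
      ∀ e, hilb J e = hilb (purePowers K le_rfl a) e + (T e).card := by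
  classical
  refine ⟨fun e => (box a e).filter fun m =>
    monomial (Finsupp.equivFunOnFinite.symm m) (1 : K) ∈ J, fun e => Finset.filter_subset _ _,
    fun e m hm i hi => ?_, fun e => ?_⟩
  · rw [Finset.mem_filter] at hm ⊢
    refine ⟨add_single_mem_box hm.1 hi, ?_⟩
    have h : (monomial (Finsupp.equivFunOnFinite.symm (m + Pi.single i 1)) (1 : K) :
        MvPolynomial (Fin n) K) = X i * monomial (Finsupp.equivFunOnFinite.symm m) 1 := by
      have h' : Finsupp.equivFunOnFinite.symm (m + Pi.single i 1) =
          Finsupp.single i 1 + Finsupp.equivFunOnFinite.symm m := by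
        ext j
        simp [Finsupp.single_eq_pi_single, add_comm]
      rw [X, monomial_mul, one_mul, h']
    rw [h]
    exact Ideal.mul_mem_left _ _ hm.2
  · obtain ⟨S, hS, hSJ⟩ := hJ.2 e
    rw [component_purePowers, restrictSupport_eq_span, ← Submodule.span_union, ← Set.image_union,
      ← restrictSupport_eq_span] at hSJ
    have hM : ∀ m : Fin n →₀ ℕ, expDeg m = e →
        ((monomial m (1 : K) : MvPolynomial (Fin n) K) ∈ J ↔ m ∈ S ∪ nonBox b e) := by
      intro m hm
      have h : (monomial m (1 : K)).IsHomogeneous e :=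
        isHomogeneous_monomial _ ((expDeg_eq_degree m).symm.trans hm)
      have h' := (monomial_mem_restrictSupport K (s := S ∪ nonBox b e) (m := m) (r := (1 : K))).trans
        (or_iff_left one_ne_zero)
      rw [← h', ← hSJ, mem_component, and_iff_left h]
    rw [← finrank_nonBox_union (Finset.filter_subset _ _), hilb, hSJ]
    have : S ∪ nonBox b e = nonBox a e ∪ exponents ((box a e).filter fun m =>
        monomial (Finsupp.equivFunOnFinite.symm m) (1 : K) ∈ J) := by
      ext m
      have hm' : Finsupp.equivFunOnFinite.symm ⇑m = m := Finsupp.equivFunOnFinite.symm_apply_apply m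
      constructor
      · intro hm
        have hme : expDeg m = e := hm.elim (fun h => hS.1 m h) fun h => h.1
        have hm2 : m ∈ nonBox a e ∪ exponents (box a e) := setOf_expDeg_eq a e ▸ hme
        refine hm2.imp_right fun h => Finset.mem_filter.2 ⟨h, ?_⟩
        rw [hm']
        exact (hM m hme).2 hm
      · rintro (⟨hme, i, hi⟩ | hm)
        · exact Or.inr ⟨hme, i, (hba i).trans hi⟩
        · obtain ⟨hmb, hmJ⟩ := Finset.mem_filter.1 hm
          rw [hm'] at hmJ
          exact (hM m (mem_box.1 hmb).2).1 hmJ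
    rw [this]

lemma exists_isLexSegment {k : ℕ} {C : Finset (Fin n → ℕ)} (hC : IsInitial (box a k) C) :
    ∃ S, IsLexSegment n k S ∧ S ∪ nonBox a k = nonBox a k ∪ exponents C := by
  refine ⟨{m | expDeg m = k ∧ ∃ m₀ ∈ exponents C, lexLe m₀ m}, ⟨fun m hm => hm.1, ?_⟩, ?_⟩
  · rintro m ⟨hm, m₀, hm₀, hle⟩ m' hm' hle'
    refine ⟨hm', m₀, hm₀, ?_⟩
    rcases hle with rfl | hlt
    · exact hle'
    rcases hle' with rfl | hlt'
    · exact Or.inr hlt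
    · obtain ⟨i, hi⟩ := lex_lt_iff.1 ((lex_lt_iff.2 hlt).trans (lex_lt_iff.2 hlt'))
      exact Or.inr ⟨i, hi⟩
  · ext m
    constructor
    · rintro (⟨hm, m₀, hm₀, hle⟩ | hm)
      · have : m ∈ nonBox a k ∪ exponents (box a k) := setOf_expDeg_eq a k ▸ hm
        refine this.imp_right fun hmb => ?_
        rcases hle with rfl | hlt
        · exact hm₀
        · exact hC.2 _ hm₀ _ hmb (lex_lt_iff.2 hlt)
      · exact Or.inl hm
    · rintro (hm | hm)
      · exact Or.inr hm
      · exact Or.inl ⟨(mem_box.1 (hC.1 hm)).2, m, hm, Or.inl rfl⟩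

lemma isUpperSet_of_add_single {U : Set (Fin n →₀ ℕ)}
    (hU : ∀ m ∈ U, ∀ i, m + Finsupp.single i 1 ∈ U) : IsUpperSet U := by
  suffices h : ∀ c, ∀ m ∈ U, m + c ∈ U by
    intro m m' hle hm
    obtain ⟨c, rfl⟩ := exists_add_of_le hle
    exact h c m hm
  intro c
  induction c using Finsupp.induction_linear with
  | zero => simp
  | add c c' ih ih' =>
    intro m hm
    rw [← add_assoc]
    exact ih' _ (ih _ hm)
  | single i k =>
    intro m hm
    induction k with
    | zero => simpa using hm
    | succ k ih =>
      rw [Finsupp.single_add, ← add_assoc]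
      exact hU _ ih i

/-- Initial lex segments below `a` which are compatible with multiplication define a
lex-plus-powers ideal. -/
lemma exists_isLPP {C : ℕ → Finset (Fin n → ℕ)} (hC : ∀ k, IsInitial (box a k) (C k))
    (hup : ∀ k, UpClosed a (C k) (C (k + 1))) :
    ∃ J : Ideal (MvPolynomial (Fin n) K), IsLPP le_rfl a J ∧
      ∀ k, hilb J k = hilb (purePowers K le_rfl a) k + (C k).card := by
  have hU : IsUpperSet {m : Fin n →₀ ℕ | (∃ i, a i ≤ m i) ∨ ⇑m ∈ C (expDeg m)} := by
    refine isUpperSet_of_add_single ?_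
    rintro m (⟨j, hj⟩ | hm) i
    · exact Or.inl ⟨j, hj.trans (by simp)⟩
    · by_cases hi : m i + 1 < a i
      · refine Or.inr ?_
        have h1 : expDeg (m + Finsupp.single i 1) = expDeg m + 1 := by
          simp [expDeg_eq_degree]
        have h2 : ((m + Finsupp.single i 1 : Fin n →₀ ℕ) : Fin n → ℕ) = ⇑m + Pi.single i 1 := by
          rw [Finsupp.coe_add, Finsupp.single_eq_pi_single]
        rw [h1, h2]
        exact hup _ _ hm i hi
      · exact Or.inl ⟨i, by simpa using hi⟩
  have hcomp : ∀ k, component (restrictSupportIdeal K _ hU) k =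
      restrictSupport K (nonBox a k ∪ exponents (C k)) := by
    intro k
    rw [component_restrictSupportIdeal]
    congr 1
    ext m
    constructor
    · rintro ⟨rfl, h | h⟩
      exacts [Or.inl ⟨rfl, h⟩, Or.inr h]
    · rintro (⟨rfl, h⟩ | h)
      · exact ⟨rfl, Or.inl h⟩
      · have hk : expDeg m = k := (mem_box.1 ((hC k).1 h)).2
        exact ⟨hk, Or.inr (hk ▸ h)⟩
  refine ⟨restrictSupportIdeal K _ hU, ⟨fun p hp d m hm => ?_, fun k => ?_⟩, fun k => ?_⟩
  · refine hp ?_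
    replace hm : coeff m (homogeneousComponent d p) ≠ 0 := mem_support_iff.1 hm
    rw [coeff_homogeneousComponent] at hm
    exact Finset.mem_coe.2 (mem_support_iff.2 fun h : coeff m p = 0 => hm (by simp [h]))
  · obtain ⟨S, hS, hSC⟩ := exists_isLexSegment (hC k)
    refine ⟨S, hS, ?_⟩
    rw [hcomp, component_purePowers, ← hSC, restrictSupport_eq_span, restrictSupport_eq_span,
      Set.image_union, Submodule.span_union]
  · rw [hilb, hcomp, finrank_nonBox_union (hC k).1]

end MonomialIdeals

section Complement

variable {n : ℕ} {a : Fin n → ℕ}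

/-- The exponent vector complementary to `m` among those strictly below `a`. -/
def compl (a m : Fin n → ℕ) : Fin n → ℕ := fun i => a i - 1 - m i

lemma sum_le_of_mem_box {k : ℕ} {m : Fin n → ℕ} (hm : m ∈ box a k) : k ≤ ∑ i, (a i - 1) := by
  rw [mem_box] at hm
  rw [← hm.2]
  exact Finset.sum_le_sum fun i _ => Nat.le_sub_one_of_lt (hm.1 i)

lemma compl_compl {k : ℕ} {m : Fin n → ℕ} (hm : m ∈ box a k) : compl a (compl a m) = m := by
  ext i
  have := (mem_box.1 hm).1 i
  simp only [compl]
  omega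

lemma compl_mem_box {k t : ℕ} (h : k + t = ∑ i, (a i - 1)) {m : Fin n → ℕ} (hm : m ∈ box a k) :
    compl a m ∈ box a t := by
  rw [mem_box] at hm ⊢
  refine ⟨fun i => ?_, ?_⟩
  · have := hm.1 i
    simp only [compl]
    omega
  · have h' : ∑ i, compl a m i + ∑ i, m i = ∑ i, (a i - 1) := by
      rw [← Finset.sum_add_distrib]
      refine Finset.sum_congr rfl fun i _ => ?_
      have := hm.1 i
      simp only [compl]
      omega
    omega

lemma compl_injOn (a : Fin n → ℕ) (k : ℕ) : Set.InjOn (compl a) (box a k) := fun m hm m' hm' h => by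
  rw [← compl_compl hm, h, compl_compl hm']

lemma card_box_eq {k t : ℕ} (h : k + t = ∑ i, (a i - 1)) : (box a k).card = (box a t).card :=
  le_antisymm
    (Finset.card_le_card_of_injOn _ (fun _ hm => compl_mem_box h hm) (compl_injOn a k))
    (Finset.card_le_card_of_injOn _ (fun _ hm => compl_mem_box ((add_comm t k).trans h) hm)
      (compl_injOn a t))

lemma box_eq_empty {k : ℕ} (h : ∑ i, (a i - 1) < k) : box a k = ∅ :=
  Finset.eq_empty_of_forall_notMem fun _ hm => not_le.2 h (sum_le_of_mem_box hm)

lemma card_box_sum (ha : ∀ i, 0 < a i) : (box a (∑ i, (a i - 1))).card = 1 := by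
  rw [card_box_eq (add_zero _), Finset.card_eq_one]
  refine ⟨0, Finset.ext fun m => ?_⟩
  rw [mem_box, Finset.mem_singleton]
  constructor
  · rintro ⟨-, h⟩
    ext i
    exact (Finset.sum_eq_zero_iff.1 h) i (Finset.mem_univ i)
  · rintro rfl
    exact ⟨ha, by simp⟩

/-- The exponent vectors of degree `k` below `a` whose complements do not lie in `C`. -/
def complement (a : Fin n → ℕ) (k : ℕ) (C : Finset (Fin n → ℕ)) : Finset (Fin n → ℕ) :=
  (box a k).filter fun m => compl a m ∉ C

lemma mem_complement {k : ℕ} {C : Finset (Fin n → ℕ)} {m : Fin n → ℕ} :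
    m ∈ complement a k C ↔ m ∈ box a k ∧ compl a m ∉ C := Finset.mem_filter

lemma card_complement {k t : ℕ} (h : k + t = ∑ i, (a i - 1)) {C : Finset (Fin n → ℕ)}
    (hC : C ⊆ box a t) : (complement a k C).card + C.card = (box a k).card := by
  have h' : ((box a k).filter fun m => compl a m ∈ C).card = C.card := by
    refine Finset.card_bij (fun m _ => compl a m) (fun m hm => (Finset.mem_filter.1 hm).2)
      (fun m hm m' hm' h => compl_injOn a k (Finset.mem_filter.1 hm).1 (Finset.mem_filter.1 hm').1 h)
      fun m hm => ⟨compl a m, ?_, compl_compl (hC hm)⟩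
    rw [Finset.mem_filter, compl_compl (hC hm)]
    exact ⟨compl_mem_box ((add_comm t k).trans h) (hC hm), hm⟩
  rw [← h', add_comm, complement, Finset.card_filter_add_card_filter_not]

lemma compl_lt_compl {k : ℕ} {m m' : Fin n → ℕ} (hm' : m' ∈ box a k)
    (h : toLex m < toLex m') : toLex (compl a m') < toLex (compl a m) := by
  obtain ⟨i, hi, hlt⟩ := lex_lt_iff.1 h
  refine lex_lt_iff.2 ⟨i, fun j hj => by simp only [compl, hi j hj], ?_⟩
  have := (mem_box.1 hm').1 i
  simp only [compl]
  omega

lemma IsInitial.complement {k t : ℕ} (h : k + t = ∑ i, (a i - 1)) {C : Finset (Fin n → ℕ)}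
    (hC : IsInitial (box a t) C) : IsInitial (box a k) (complement a k C) := by
  refine ⟨Finset.filter_subset _ _, fun m hm m' hm' hlt => ?_⟩
  rw [mem_complement] at hm ⊢
  exact ⟨hm', fun hmC => hm.2 (hC.2 _ hmC _ (compl_mem_box h hm.1) (compl_lt_compl hm' hlt))⟩

lemma UpClosed.complement {d : ℕ} {C C' : Finset (Fin n → ℕ)} (hC : UpClosed a C C') :
    UpClosed a (complement a d C') (complement a (d + 1) C) := by
  intro m hm i hi
  rw [mem_complement] at hm ⊢
  refine ⟨add_single_mem_box hm.1 hi, fun hmC => hm.2 ?_⟩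
  have h : compl a (m + Pi.single i 1) + Pi.single i 1 = compl a m := by
    ext j
    rcases eq_or_ne j i with rfl | hj
    · simp only [compl, Pi.add_apply, Pi.single_eq_same]
      omega
    · simp [compl, hj]
  rw [← h]
  refine hC _ hmC i ?_
  simp only [compl, Pi.add_apply, Pi.single_eq_same]
  omega

end Complement

section Duality

variable {K : Type*} [Field K] {n : ℕ} {a : Fin n → ℕ} {f : Fin n → MvPolynomial (Fin n) K}

lemma hilb_span_eq_hilb_purePowers (hf : IsRegSeq f) (hfa : ∀ i, (f i).IsHomogeneous (a i))
    (d : ℕ) : hilb (Ideal.span (Set.range f)) d = hilb (purePowers K le_rfl a) d :=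
  hilb_span_eq_hilb_span hf (isRegSeq_X_pow a) hfa
    (fun i => by simpa using (isHomogeneous_X K i).pow (a i)) d

lemma finrank_homogeneousSubmodule_eq (hf : IsRegSeq f) (hfa : ∀ i, (f i).IsHomogeneous (a i))
    (d : ℕ) : Module.finrank K (homogeneousSubmodule (Fin n) K d) =
      hilb (Ideal.span (Set.range f)) d + (box a d).card := by
  rw [finrank_homogeneousSubmodule a d, hilb_span_eq_hilb_purePowers hf hfa]

lemma mem_span_of_sum_lt (hf : IsRegSeq f) (hfa : ∀ i, (f i).IsHomogeneous (a i)) {d : ℕ}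
    (hd : ∑ i, (a i - 1) < d) {p : MvPolynomial (Fin n) K} (hp : p.IsHomogeneous d) :
    p ∈ Ideal.span (Set.range f) := by
  have h : component (Ideal.span (Set.range f)) d = homogeneousSubmodule (Fin n) K d := by
    refine Submodule.eq_of_le_of_finrank_le inf_le_right ?_
    rw [finrank_homogeneousSubmodule_eq hf hfa, box_eq_empty hd]
    rfl
  exact (mem_component.1 (h ▸ hp : p ∈ component _ d)).1

lemma exists_notMem_span (hf : IsRegSeq f) (hfa : ∀ i, (f i).IsHomogeneous (a i))
    (ha : ∀ i, 0 < a i) : ∃ w : MvPolynomial (Fin n) K,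
      w.IsHomogeneous (∑ i, (a i - 1)) ∧ w ∉ Ideal.span (Set.range f) := by
  by_contra! h
  have h' : component (Ideal.span (Set.range f)) (∑ i, (a i - 1)) =
      homogeneousSubmodule (Fin n) K (∑ i, (a i - 1)) :=
    le_antisymm inf_le_right fun p hp => ⟨h p hp, hp⟩
  have := finrank_homogeneousSubmodule_eq hf hfa (∑ i, (a i - 1))
  rw [card_box_sum ha, hilb, h'] at this
  omega

/-- Below the top degree, the quotient by a homogeneous regular sequence of `n` elements has no
socle. -/
lemma mem_span_of_X_mul_mem (hf : IsRegSeq f) (hfa : ∀ i, (f i).IsHomogeneous (a i))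
    (ha : ∀ i, 0 < a i) {d : ℕ} (hd : d < ∑ i, (a i - 1)) {u : MvPolynomial (Fin n) K}
    (hu : u.IsHomogeneous d) (hXu : ∀ i, X i * u ∈ Ideal.span (Set.range f)) :
    u ∈ Ideal.span (Set.range f) := by
  by_contra huF
  obtain ⟨w, hw, hwF⟩ := exists_notMem_span hf hfa ha
  obtain ⟨c, hc⟩ := exists_sub_C_mul_mem hf
    (fun i => mem_irrelevant_of_isHomogeneous (hfa i) (ha i).ne') huF hXu fun i =>
      mem_span_of_sum_lt hf hfa (Nat.lt_succ_self _)
        (by simpa [add_comm] using (isHomogeneous_X K i).mul hw)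
  have hF : IsHomog (Ideal.span (Set.range f)) :=
    isHomog_span (by rintro _ ⟨i, rfl⟩; exact ⟨_, hfa i⟩)
  have h := hF _ hc (∑ i, (a i - 1))
  rw [map_sub, homogeneousComponent_C_mul, homogeneousComponent_eq_self hw,
    homogeneousComponent_of_mem hu, if_neg hd.ne', mul_zero, sub_zero] at h
  exact hwF h

lemma mem_span_of_forall_mul_mem (hf : IsRegSeq f) (hfa : ∀ i, (f i).IsHomogeneous (a i))
    (ha : ∀ i, 0 < a i) {t k : ℕ} (hk : k + t = ∑ i, (a i - 1)) {h : MvPolynomial (Fin n) K}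
    (hh : h.IsHomogeneous k)
    (H : ∀ g : MvPolynomial (Fin n) K, g.IsHomogeneous t → g * h ∈ Ideal.span (Set.range f)) :
    h ∈ Ideal.span (Set.range f) := by
  induction t generalizing k h with
  | zero => simpa using H 1 (isHomogeneous_one _ _)
  | succ t ih =>
    refine mem_span_of_X_mul_mem hf hfa ha (by omega) hh fun i => ih (k := 1 + k) (by omega)
      ((isHomogeneous_X K i).mul hh) fun g hg => ?_
    rw [← mul_assoc]
    exact H _ (hg.mul (isHomogeneous_X K i))

lemma exists_functional (hf : IsRegSeq f) (hfa : ∀ i, (f i).IsHomogeneous (a i))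
    (ha : ∀ i, 0 < a i) : ∃ φ : MvPolynomial (Fin n) K →ₗ[K] K,
      ∀ p : MvPolynomial (Fin n) K, p.IsHomogeneous (∑ i, (a i - 1)) →
        (φ p = 0 ↔ p ∈ Ideal.span (Set.range f)) := by
  obtain ⟨w, hw, hwF⟩ := exists_notMem_span hf hfa ha
  obtain ⟨φ, hφw, hφ⟩ := Submodule.exists_le_ker_of_notMem
    (p := component (Ideal.span (Set.range f)) (∑ i, (a i - 1))) fun h => hwF h.1
  have hlt : homogeneousSubmodule (Fin n) K (∑ i, (a i - 1)) ⊓ LinearMap.ker φ <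
      homogeneousSubmodule (Fin n) K (∑ i, (a i - 1)) :=
    lt_of_le_of_ne inf_le_left fun h => hφw (inf_eq_left.1 h hw)
  have hlt' := Submodule.finrank_lt_finrank_of_lt hlt
  have hdim := finrank_homogeneousSubmodule_eq hf hfa (∑ i, (a i - 1))
  rw [card_box_sum ha, hilb] at hdim
  have : Module.Finite K ↥(homogeneousSubmodule (Fin n) K (∑ i, (a i - 1)) ⊓ LinearMap.ker φ) :=
    Submodule.finiteDimensional_of_le inf_le_left
  have heq : component (Ideal.span (Set.range f)) (∑ i, (a i - 1)) =
      homogeneousSubmodule (Fin n) K (∑ i, (a i - 1)) ⊓ LinearMap.ker φ :=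
    Submodule.eq_of_le_of_finrank_le (le_inf inf_le_right hφ) (by omega)
  refine ⟨φ, fun p hp => ⟨fun h => ?_, fun h => hφ ⟨h, hp⟩⟩⟩
  exact (heq.ge ⟨hp, h⟩).1

lemma finrank_range_flip {V W : Type*} [AddCommGroup V] [Module K V] [AddCommGroup W] [Module K W]
    [FiniteDimensional K W] (β : V →ₗ[K] W →ₗ[K] K) :
    Module.finrank K (LinearMap.range β.flip) = Module.finrank K (LinearMap.range β) := by
  have h : β.flip = LinearMap.dualMap β ∘ₗ Module.Dual.eval K W := rfl
  rw [h, LinearMap.range_comp_of_range_eq_top _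
    (LinearMap.range_eq_top.2 (Module.evalEquiv K W).surjective :
      LinearMap.range (Module.Dual.eval K W) = ⊤)]
  exact LinearMap.finrank_range_dualMap_eq_finrank_range β

lemma mem_colon_of_forall_mul_mem (hf : IsRegSeq f) (hfa : ∀ i, (f i).IsHomogeneous (a i))
    (ha : ∀ i, 0 < a i) {I : Ideal (MvPolynomial (Fin n) K)} (hI : IsHomog I) {d t : ℕ}
    (hd : d + t = ∑ i, (a i - 1)) {g : MvPolynomial (Fin n) K} (hg : g.IsHomogeneous d)
    (H : ∀ h ∈ component I t, g * h ∈ Ideal.span (Set.range f)) :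
    g ∈ Submodule.colon (Ideal.span (Set.range f)) (I : Set (MvPolynomial (Fin n) K)) := by
  rw [Submodule.mem_colon]
  intro h hh
  rw [smul_eq_mul, ← sum_homogeneousComponent h, Finset.mul_sum]
  refine Ideal.sum_mem _ fun j _ => ?_
  have hgh := hg.mul (homogeneousComponent_isHomogeneous j h)
  rcases lt_or_ge t j with hj | hj
  · exact mem_span_of_sum_lt hf hfa (by omega) hgh
  · obtain ⟨t, rfl⟩ := Nat.exists_eq_add_of_le hj
    refine mem_span_of_forall_mul_mem hf hfa ha (t := t) (by omega) hgh fun g' hg' => ?_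
    rw [mul_left_comm]
    refine H _ ⟨Ideal.mul_mem_left _ _ (hI h hh j), ?_⟩
    rw [add_comm]
    exact hg'.mul (homogeneousComponent_isHomogeneous j h)

/-- Linkage by a homogeneous regular sequence is a duality on Hilbert functions. -/
lemma hilb_colon_add_hilb (hf : IsRegSeq f) (hfa : ∀ i, (f i).IsHomogeneous (a i))
    (ha : ∀ i, 0 < a i) {I : Ideal (MvPolynomial (Fin n) K)} (hI : IsHomog I)
    (hFI : Ideal.span (Set.range f) ≤ I) {d t : ℕ} (hd : d + t = ∑ i, (a i - 1)) :
    hilb (Submodule.colon (Ideal.span (Set.range f)) (I : Set (MvPolynomial (Fin n) K))) d +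
        hilb I t =
      Module.finrank K (homogeneousSubmodule (Fin n) K d) +
        hilb (Ideal.span (Set.range f)) t := by
  obtain ⟨φ, hφ⟩ := exists_functional hf hfa ha
  set V := homogeneousSubmodule (Fin n) K d with hV
  set W := component I t with hW
  let β : V →ₗ[K] W →ₗ[K] K :=
    ((LinearMap.mul K (MvPolynomial (Fin n) K)).compr₂ φ).domRestrict₁₂ V W
  have hβ : ∀ (g : V) (h : W),
      β g h = 0 ↔ (g * h : MvPolynomial (Fin n) K) ∈ Ideal.span (Set.range f) :=
    fun g h => hφ _ (hd ▸ IsHomogeneous.mul g.2 h.2.2)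
  have hker : (LinearMap.ker β).map V.subtype =
      component (Submodule.colon (Ideal.span (Set.range f)) (I : Set (MvPolynomial (Fin n) K))) d := by
    ext g
    constructor
    · rintro ⟨g, hg, rfl⟩
      refine ⟨mem_colon_of_forall_mul_mem hf hfa ha hI hd g.2 fun h hh => ?_, g.2⟩
      exact (hβ g ⟨h, hh⟩).1 (LinearMap.congr_fun (LinearMap.mem_ker.1 hg) _)
    · rintro ⟨hg, hg'⟩
      refine ⟨⟨g, hg'⟩, LinearMap.mem_ker.2 (LinearMap.ext fun h => (hβ _ _).2 ?_), rfl⟩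
      exact Submodule.mem_colon.1 hg h h.2.1
  have hker' : (LinearMap.ker β.flip).map W.subtype = component (Ideal.span (Set.range f)) t := by
    ext h
    constructor
    · rintro ⟨h, hh, rfl⟩
      refine ⟨mem_span_of_forall_mul_mem hf hfa ha (t := d) (by omega) h.2.2 fun g hg => ?_, h.2.2⟩
      exact (hβ ⟨g, hg⟩ h).1 (LinearMap.congr_fun (LinearMap.mem_ker.1 hh) _)
    · rintro ⟨hh, hh'⟩
      refine ⟨⟨h, hFI hh, hh'⟩, LinearMap.mem_ker.2 (LinearMap.ext fun g => (hβ _ _).2 ?_), rfl⟩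
      exact Ideal.mul_mem_left _ _ hh
  have h1 := β.finrank_range_add_finrank_ker
  have h2 := β.flip.finrank_range_add_finrank_ker
  rw [finrank_range_flip, ← finrank_map_of_injective W.injective_subtype, hker'] at h2
  rw [← finrank_map_of_injective V.injective_subtype, hker] at h1
  have h3 : hilb I t = Module.finrank K W := rfl
  simp only [hilb] at h3 ⊢
  omega

end Duality

section Linkage

variable {K : Type*} [Field K] {n : ℕ} {a : Fin n → ℕ}

/-- Two consecutive initial lex segments compatible with multiplication are realized by a
lex-plus-powers ideal. -/
lemma exists_isLPP_of_upClosed {d : ℕ} {D D' : Finset (Fin n → ℕ)} (hD : IsInitial (box a d) D)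
    (hD' : IsInitial (box a (d + 1)) D') (hup : UpClosed a D D') :
    ∃ J : Ideal (MvPolynomial (Fin n) K), IsLPP le_rfl a J ∧
      hilb J d = hilb (purePowers K le_rfl a) d + D.card ∧
      hilb J (d + 1) = hilb (purePowers K le_rfl a) (d + 1) + D'.card := by
  let C : ℕ → Finset (Fin n → ℕ) := fun k =>
    if k < d then ∅ else if k = d then D else if k = d + 1 then D' else box a k
  have hCd : C d = D := by simp [C]
  have hCd' : C (d + 1) = D' := by simp [C]
  have hlow : ∀ k < d, C k = ∅ := fun k hk => if_pos hk
  have hhigh : ∀ k, d + 1 < k → C k = box a k := fun k hk => by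
    simp only [C]
    rw [if_neg (by omega), if_neg (by omega), if_neg (by omega)]
  have hCi : ∀ k, IsInitial (box a k) (C k) := by
    intro k
    rcases lt_trichotomy k d with hk | rfl | hk
    · rw [hlow k hk]
      exact ⟨by simp, by simp⟩
    · rwa [hCd]
    · rcases eq_or_lt_of_le (Nat.succ_le_of_lt hk) with rfl | hk
      · rwa [hCd']
      · rw [hhigh k hk]
        exact ⟨Finset.Subset.refl _, fun _ _ _ h _ => h⟩
  obtain ⟨J, hJ, hJC⟩ := exists_isLPP (K := K) hCi fun k => by
    rcases lt_trichotomy k d with hk | rfl | hk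
    · rw [hlow k hk]
      intro m hm
      simp at hm
    · rwa [hCd, hCd']
    · rw [hhigh (k + 1) (by omega)]
      exact fun m hm i hi => add_single_mem_box ((hCi k).1 hm) hi
  exact ⟨J, hJ, by rw [hJC, hCd], by rw [hJC, hCd']⟩

lemma exists_initial_of_link (hmono : Monotone a) {d e i j : ℕ}
    (hde : d + (e + 1) = ∑ i, (a i - 1)) {T T' : Finset (Fin n → ℕ)} (hT : T ⊆ box a e)
    (hT' : T' ⊆ box a (e + 1)) (hup : UpClosed a T T') (hj : T.card + j = (box a (d + 1)).card)
    (hi : T'.card + i ≤ (box a d).card) :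
    ∃ D D', IsInitial (box a d) D ∧ IsInitial (box a (d + 1)) D' ∧ UpClosed a D D' ∧
      D.card = i ∧ D'.card = j := by
  obtain ⟨C, hC, hCT⟩ := exists_isInitial (box a e) (Finset.card_le_card hT)
  obtain ⟨C', hC', hCT'⟩ := exists_isInitial (box a (e + 1)) (Finset.card_le_card hT')
  have hCup := clementsLindstrom n a e T T' C C' hmono hT hT' hup hC hC' hCT hCT'
  have hde' : d + 1 + e = ∑ i, (a i - 1) := by omega
  obtain ⟨D, hD, hDi⟩ := exists_isInitial (box a d) (t := i) (by omega)
  have h := card_complement hde hC'.1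
  have h' := card_complement hde' hC.1
  have hsub : D ⊆ complement a d C' := hD.subset_of_card_le (hC'.complement hde) (by omega)
  exact ⟨D, complement a (d + 1) C, hD, hC.complement hde',
    fun m hm i hi => hCup.complement m (hsub hm) i hi, hDi, by omega⟩

end Linkage

end LexPlusPowers

open LexPlusPowers

/-- **Chong.** Let `F ⊆ A = K[x_1,…,x_n]` be generated by a homogeneous regular sequence of
degree `a = (a_1,…,a_n)` and let `I ⊇ F` be homogeneous.  If `b` is a degree sequence with
`b_i ≤ a_i` for all `i` and the link `I^ℓ = (F : I)` satisfies `EGH_b`, then `I`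
satisfies `EGH_a`. -/
theorem chong_linkage {K : Type*} [Field K] {n : ℕ}
    (a b : Fin n → ℕ) (hapos : ∀ i, 0 < a i) (hamono : Monotone a)
    (hbpos : ∀ i, 0 < b i) (hbmono : Monotone b) (hba : ∀ i, b i ≤ a i)
    (f : Fin n → MvPolynomial (Fin n) K)
    (hreg : IsRegSeq f) (hdeg : ∀ i, (f i).IsHomogeneous (a i))
    (I : Ideal (MvPolynomial (Fin n) K)) (hI : IsHomog I)
    (hFI : Ideal.span (Set.range f) ≤ I)
    (hlink : EGH (le_refl n) b (Submodule.colon (Ideal.span (Set.range f)) I)) :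
    EGH (le_refl n) a I := by
  intro d
  have hF := hilb_span_eq_hilb_purePowers hreg hdeg
  have hN := finrank_homogeneousSubmodule_eq hreg hdeg
  have hFle : ∀ k, hilb (Ideal.span (Set.range f)) k ≤ hilb I k := fun k =>
    Submodule.finrank_mono (inf_le_inf_right _ hFI)
  have hle : ∀ k, hilb I k ≤ Module.finrank K (homogeneousSubmodule (Fin n) K k) := fun k =>
    Submodule.finrank_mono inf_le_right
  suffices h : ∃ D D', IsInitial (box a d) D ∧ IsInitial (box a (d + 1)) D' ∧ UpClosed a D D' ∧
      hilb I d = hilb (Ideal.span (Set.range f)) d + D.card ∧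
      hilb I (d + 1) = hilb (Ideal.span (Set.range f)) (d + 1) + D'.card by
    obtain ⟨D, D', hD, hD', hup, hDI, hDI'⟩ := h
    obtain ⟨J, hJ, hJd, hJd'⟩ := exists_isLPP_of_upClosed (K := K) hD hD' hup
    exact ⟨J, hJ, by rw [hJd, hDI, hF], by rw [hJd', hDI', hF]⟩
  have hFd := hFle d
  have hFd' := hFle (d + 1)
  have hId := hle d
  have hId' := hle (d + 1)
  rw [hN] at hId hId'
  rcases lt_or_ge d (∑ i, (a i - 1)) with hd | hd
  · obtain ⟨e, he⟩ := Nat.exists_eq_add_of_le (Nat.succ_le_of_lt hd)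
    have hde : d + (e + 1) = ∑ i, (a i - 1) := by omega
    have hde' : d + 1 + e = ∑ i, (a i - 1) := by omega
    obtain ⟨J, hJ, hJe, hJe'⟩ := hlink e
    obtain ⟨T, hT, hTup, hJT⟩ := exists_upClosed_of_isLPP hba hJ
    have h1 := hilb_colon_add_hilb hreg hdeg hapos hI hFI ((add_comm e (d + 1)).trans hde')
    have h2 := hilb_colon_add_hilb hreg hdeg hapos hI hFI ((add_comm (e + 1) d).trans hde)
    have h3 := hJT e
    have h4 := hJT (e + 1)
    rw [hN, card_box_eq ((add_comm e (d + 1)).trans hde')] at h1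
    rw [hN, card_box_eq ((add_comm (e + 1) d).trans hde)] at h2
    rw [← hF] at h3 h4
    obtain ⟨D, D', hD, hD', hup, hDi, hDj⟩ := exists_initial_of_link hamono hde (hT e) (hT (e + 1))
      (hTup e) (i := hilb I d - hilb (Ideal.span (Set.range f)) d)
      (j := hilb I (d + 1) - hilb (Ideal.span (Set.range f)) (d + 1)) (by omega) (by omega)
    exact ⟨D, D', hD, hD', hup, by omega, by omega⟩
  · obtain ⟨D, hD, hDi⟩ := exists_isInitial (box a d)
      (t := hilb I d - hilb (Ideal.span (Set.range f)) d) (by omega)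
    have hempty : box a (d + 1) = ∅ := box_eq_empty (Nat.lt_succ_of_le hd)
    rw [hempty, Finset.card_empty] at hId'
    refine ⟨D, ∅, hD, ⟨by simp, by simp⟩, fun m hm i hi => ?_, by omega, ?_⟩
    · exact hempty ▸ add_single_mem_box (hD.1 hm) hi
    · rw [Finset.card_empty]
      omega
end
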